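/- arXiv:1802.05917 — 11 statements merged into one kernel-verified Lean document; each statement's English description precedes it below -/
import Mathlib

section
/- Fix Δ > 0. Assume p_k(θ) > 0 for every k and θ, ∫_Θ |θ| π(θ) dθ < ∞, that D(q,·) is continuous on Θ for every q ∈ Γ, and that for each θ ∈ Θ the map q ↦ D(q,θ) is continuous on Γ with respect to the l1 metric. Let q_j, q ∈ Γ̃ with Σ_k |q_{j,k} − q_k| → 0 as j → ∞. Then T̄_Δ(q_j) → T̄_Δ(q); i.e., the EDAP function is continuous with respect to the l1 metric on Γ̃. -/
open MeasureTheory Filter Topology Set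

/-- Pearson residual. -/
noncomputable def pearson (f : ℝ → ℕ → ℝ) (q : ℕ → ℝ) (θ : ℝ) (k : ℕ) : ℝ :=
  if 0 < f θ k then q k / f θ k - 1 else 0

/-- Disparity `D(q,θ) = Σ_k G(δ(q,θ,k)) p_k(θ)`. -/
noncomputable def disparity (G : ℝ → ℝ) (f : ℝ → ℕ → ℝ) (q : ℕ → ℝ) (θ : ℝ) : ℝ :=
  ∑' k, G (pearson f q θ k) * f θ k

/-- Probability mass function on ℕ. -/
def IsPMF (q : ℕ → ℝ) : Prop := (∀ k, 0 ≤ q k) ∧ ∑' k, q k = 1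

/-- EDAP value `T̄_Δ(q)`. -/
noncomputable def edap (G : ℝ → ℝ) (f : ℝ → ℕ → ℝ) (π : ℝ → ℝ) (Θ : Set ℝ)
    (Δ : ℝ) (q : ℕ → ℝ) : ℝ :=
  (∫ θ in Θ, θ * Real.exp (-Δ * disparity G f q θ) * π θ) /
  (∫ θ in Θ, Real.exp (-Δ * disparity G f q θ) * π θ)

theorem IsPMF.summable {q : ℕ → ℝ} (hq : IsPMF q) : Summable q := by
  by_contra h
  have := hq.2
  simp [tsum_eq_zero_of_not_summable h] at this

/-- A convex function on `[-1, ∞)` vanishing and differentiable at `0` lies above its tangent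
line at `0`. -/
theorem ConvexOn.deriv_zero_mul_le {G : ℝ → ℝ} (hG : ConvexOn ℝ (Ici (-1 : ℝ)) G)
    (hG0 : G 0 = 0) (hd : DifferentiableAt ℝ G 0) {x : ℝ} (hx : -1 ≤ x) :
    deriv G 0 * x ≤ G x := by
  have h0 : (0 : ℝ) ∈ Ici (-1 : ℝ) := by simp
  rcases lt_trichotomy x 0 with h | rfl | h
  · have := hG.slope_le_of_hasDerivAt (mem_Ici.2 hx) h0 h hd.hasDerivAt
    rw [slope_def_field, hG0, div_le_iff₀ (by linarith)] at this
    linarith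
  · simp [hG0]
  · have := hG.le_slope_of_hasDerivAt h0 (mem_Ici.2 hx) h hd.hasDerivAt
    rw [slope_def_field, hG0, le_div_iff₀ (by linarith)] at this
    linarith

/-- The disparity is nonnegative (Jensen's inequality), also when its series diverges and
the value is `0` by convention. -/
theorem disparity_nonneg {G : ℝ → ℝ} {f : ℝ → ℕ → ℝ} {q : ℕ → ℝ} {θ : ℝ}
    (hf_pos : ∀ k, 0 < f θ k) (hf_pmf : ∑' k, f θ k = 1)
    (hG : ConvexOn ℝ (Ici (-1 : ℝ)) G) (hG0 : G 0 = 0) (hd : DifferentiableAt ℝ G 0)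
    (hq : IsPMF q) : 0 ≤ disparity G f q θ := by
  unfold disparity
  by_cases hs : Summable fun k => G (pearson f q θ k) * f θ k
  swap
  · rw [tsum_eq_zero_of_not_summable hs]
  have hf : IsPMF (f θ) := ⟨fun k => (hf_pos k).le, hf_pmf⟩
  have hsub : Summable fun k => deriv G 0 * (q k - f θ k) :=
    (hq.summable.sub hf.summable).mul_left _
  have hzero : ∑' k, deriv G 0 * (q k - f θ k) = 0 := by
    rw [tsum_mul_left, hq.summable.tsum_sub hf.summable, hq.2, hf_pmf]
    simp
  rw [← hzero]
  refine hsub.tsum_le_tsum (fun k => ?_) hs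
  have hp : pearson f q θ k = q k / f θ k - 1 := by simp [pearson, hf_pos k]
  have hge : -1 ≤ pearson f q θ k := by
    rw [hp]
    linarith [div_nonneg (hq.1 k) (hf_pos k).le]
  have hmul : pearson f q θ k * f θ k = q k - f θ k := by
    rw [hp, sub_mul, div_mul_cancel₀ _ (hf_pos k).ne', one_mul]
  rw [← hmul, ← mul_assoc]
  exact mul_le_mul_of_nonneg_right (hG.deriv_zero_mul_le hG0 hd hge) (hf_pos k).le

/-- continuity of the EDAP function with respect to the l1 metric on `Γ̃`. -/
theorem stmt2 (Θ : Set ℝ) (hΘ : MeasurableSet Θ)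
    (f : ℝ → ℕ → ℝ) (G : ℝ → ℝ) (π : ℝ → ℝ) (Δ : ℝ) (hΔ : 0 < Δ)
    (hf_pos : ∀ θ ∈ Θ, ∀ k, 0 < f θ k) (hf_pmf : ∀ θ ∈ Θ, ∑' k, f θ k = 1)
    (hG : StrictConvexOn ℝ (Set.Ici (-1 : ℝ)) G)
    (hG3 : ContDiffOn ℝ 3 G (Set.Ici (-1 : ℝ))) (hG0 : G 0 = 0)
    (hπ_meas : Measurable π) (hπ_nn : ∀ θ, 0 ≤ π θ) (hπ_one : ∫ θ in Θ, π θ = 1)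
    (hπ_mom : Integrable (fun θ => |θ| * π θ) (volume.restrict Θ))
    (hD_cont : ∀ q : ℕ → ℝ, IsPMF q → ContinuousOn (disparity G f q) Θ)
    (hD_l1 : ∀ θ ∈ Θ, ∀ (rs : ℕ → ℕ → ℝ) (r : ℕ → ℝ), (∀ j, IsPMF (rs j)) → IsPMF r →
      Tendsto (fun j => ∑' k, |rs j k - r k|) atTop (𝓝 0) →
      Tendsto (fun j => disparity G f (rs j) θ) atTop (𝓝 (disparity G f r θ)))
    (qs : ℕ → ℕ → ℝ) (q : ℕ → ℝ) (hqs : ∀ j, IsPMF (qs j)) (hq : IsPMF q)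
    (hqsΓ : ∀ j, 0 < volume {θ | θ ∈ Θ ∧ 0 < π θ ∧
      Summable (fun k => G (pearson f (qs j) θ k) * f θ k)})
    (hqΓ : 0 < volume {θ | θ ∈ Θ ∧ 0 < π θ ∧
      Summable (fun k => G (pearson f q θ k) * f θ k)})
    (hconv : Tendsto (fun j => ∑' k, |qs j k - q k|) atTop (𝓝 0)) :
    Tendsto (fun j => edap G f π Θ Δ (qs j)) atTop (𝓝 (edap G f π Θ Δ q)) := by
  have hd : DifferentiableAt ℝ G 0 :=
    (hG3.contDiffAt (Ici_mem_nhds (by norm_num))).differentiableAt (by norm_num)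
  have hnn : ∀ r, IsPMF r → ∀ θ ∈ Θ, Real.exp (-Δ * disparity G f r θ) ≤ 1 := by
    intro r hr θ hθ
    rw [Real.exp_le_one_iff]
    have := disparity_nonneg (hf_pos θ hθ) (hf_pmf θ hθ) hG.convexOn hG0 hd hr
    nlinarith
  have hmeas : ∀ r, IsPMF r → AEStronglyMeasurable
      (fun θ => Real.exp (-Δ * disparity G f r θ)) (volume.restrict Θ) := fun r hr =>
    (Real.continuous_exp.comp_continuousOn
      (continuousOn_const.mul (hD_cont r hr))).aestronglyMeasurable hΘ
  have hπ_int : Integrable π (volume.restrict Θ) := by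
    by_contra h
    rw [integral_undef h] at hπ_one
    exact zero_ne_one hπ_one
  have hlim : ∀ θ ∈ Θ, Tendsto (fun j => Real.exp (-Δ * disparity G f (qs j) θ)) atTop
      (𝓝 (Real.exp (-Δ * disparity G f q θ))) := fun θ hθ =>
    (Real.continuous_exp.tendsto _).comp ((hD_l1 θ hθ qs q hqs hq hconv).const_mul _)
  refine Tendsto.div ?_ ?_ ?_
  · refine tendsto_integral_of_dominated_convergence (fun θ => |θ| * π θ) (fun j => ?_) hπ_mom
      (fun j => ?_) ?_
    · exact (measurable_id.aestronglyMeasurable.mul (hmeas _ (hqs j))).mul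
        hπ_meas.aestronglyMeasurable
    · filter_upwards [ae_restrict_mem hΘ] with θ hθ
      rw [Real.norm_eq_abs, abs_mul, abs_mul, Real.abs_exp, abs_of_nonneg (hπ_nn θ)]
      exact mul_le_mul_of_nonneg_right
        (mul_le_of_le_one_right (abs_nonneg _) (hnn _ (hqs j) θ hθ)) (hπ_nn θ)
    · filter_upwards [ae_restrict_mem hΘ] with θ hθ
      exact ((hlim θ hθ).const_mul θ).mul_const _
  · refine tendsto_integral_of_dominated_convergence π (fun j => ?_) hπ_int (fun j => ?_) ?_
    · exact (hmeas _ (hqs j)).mul hπ_meas.aestronglyMeasurable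
    · filter_upwards [ae_restrict_mem hΘ] with θ hθ
      rw [Real.norm_eq_abs, abs_mul, Real.abs_exp, abs_of_nonneg (hπ_nn θ)]
      exact mul_le_of_le_one_left (hπ_nn θ) (hnn _ (hqs j) θ hθ)
    · filter_upwards [ae_restrict_mem hΘ] with θ hθ
      exact (hlim θ hθ).mul_const _
  · have hint : Integrable (fun θ => Real.exp (-Δ * disparity G f q θ) * π θ)
        (volume.restrict Θ) := by
      refine hπ_int.mono' ((hmeas q hq).mul hπ_meas.aestronglyMeasurable) ?_
      filter_upwards [ae_restrict_mem hΘ] with θ hθ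
      rw [Real.norm_eq_abs, abs_mul, Real.abs_exp, abs_of_nonneg (hπ_nn θ)]
      exact mul_le_of_le_one_left (hπ_nn θ) (hnn q hq θ hθ)
    intro hzero
    rw [integral_eq_zero_iff_of_nonneg
      (fun θ => mul_nonneg (Real.exp_pos _).le (hπ_nn θ)) hint] at hzero
    have hπ0 : π =ᵐ[volume.restrict Θ] 0 := by
      filter_upwards [hzero] with θ hθ
      simpa [Real.exp_ne_zero] using hθ
    rw [integral_congr_ae hπ0] at hπ_one
    simp at hπ_one
end

section
/- Fix Δ > 0 and let Θ ⊆ ℝ be complete and separable. Assume π is continuous and strictly positive on Θ, and for q' ∈ Γ set g(q',θ) = Δ·D(q',θ) − log π(θ). Let q, q_1, q_2, … ∈ Γ be such that D(q,·) and each D(q_j,·) are continuous on Θ; suppose there exist a compact set C ⊆ Θ and θ⁺ ∈ C with inf_{θ∈Θ∖C} g(q,θ) > g(q,θ⁺); suppose g(q,·) has a unique minimizer T̃(q) on Θ; suppose sup_{θ∈Θ} |D(q_j,θ) − D(q,θ)| → 0 as j → ∞; and suppose that for all sufficiently large j the function g(q_j,·) has a unique minimizer T̃(q_j) on Θ. Then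 T̃(q_j) → T̃(q) as j → ∞; i.e., the MDAP function is continuous under uniform convergence of the disparities. -/
open MeasureTheory Filter Topology Set

/-- The objective `g(q,θ) = Δ·D(q,θ) − log π(θ)` minimized by the MDAP. -/
noncomputable def mdapObj (G : ℝ → ℝ) (f : ℝ → ℕ → ℝ) (π : ℝ → ℝ) (Δ : ℝ)
    (q : ℕ → ℝ) (θ : ℝ) : ℝ :=
  Δ * disparity G f q θ - Real.log (π θ)

/-- A continuous function with a unique minimizer on `s`, bounded away from its minimum outside a
compact set, is bounded away from its minimum outside every neighborhood of the minimizer. -/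
theorem exists_pos_add_le_of_unique_min {X : Type*} [TopologicalSpace X] {s C U : Set X}
    {g : X → ℝ} {x₀ y : X} (hg : ContinuousOn g s) (hCs : C ⊆ s) (hC : IsCompact C)
    (hy : y ∈ s) (hout : ∃ ε > 0, ∀ x ∈ s \ C, g y + ε ≤ g x)
    (hmin : ∀ x ∈ s, g x₀ ≤ g x) (huniq : ∀ t ∈ s, (∀ x ∈ s, g t ≤ g x) → t = x₀)
    (hU : IsOpen U) (hx₀ : x₀ ∈ U) :
    ∃ c > 0, ∀ x ∈ s \ U, g x₀ + c ≤ g x := by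
  obtain ⟨ε, hε, hout⟩ := hout
  rcases (C \ U).eq_empty_or_nonempty with hK | hK
  · refine ⟨ε, hε, fun x hx => ?_⟩
    have hxC : x ∉ C := fun h => hx.2 (sdiff_eq_bot_iff.mp hK h)
    linarith [hout x ⟨hx.1, hxC⟩, hmin y hy]
  · obtain ⟨t, ht, htmin⟩ :=
      (hC.diff hU).exists_isMinOn hK (hg.mono (sdiff_subset.trans hCs))
    have hlt : g x₀ < g t := by
      by_contra! h
      have := huniq t (hCs ht.1) fun x hx => h.trans (hmin x hx)
      exact ht.2 (this ▸ hx₀)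
    refine ⟨min ε (g t - g x₀), lt_min hε (sub_pos.mpr hlt), fun x hx => ?_⟩
    by_cases hxC : x ∈ C
    · have h : g t ≤ g x := htmin ⟨hxC, hx.2⟩
      linarith [min_le_right ε (g t - g x₀)]
    · linarith [hout x ⟨hx.1, hxC⟩, hmin y hy, min_le_left ε (g t - g x₀)]

/-- continuity of the MDAP function under uniform convergence of the
disparities, over a complete separable parameter set `Θ ⊆ ℝ` (i.e. a closed set). -/
theorem stmt3 (Θ : Set ℝ) (hΘclosed : IsClosed Θ)
    (f : ℝ → ℕ → ℝ) (G : ℝ → ℝ) (π : ℝ → ℝ) (Δ : ℝ) (hΔ : 0 < Δ)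
    (hf_pmf : ∀ θ ∈ Θ, (∀ k, 0 ≤ f θ k) ∧ ∑' k, f θ k = 1)
    (hG : StrictConvexOn ℝ (Set.Ici (-1 : ℝ)) G)
    (hG3 : ContDiffOn ℝ 3 G (Set.Ici (-1 : ℝ))) (hG0 : G 0 = 0)
    (hπ_cont : ContinuousOn π Θ) (hπ_pos : ∀ θ ∈ Θ, 0 < π θ)
    (q : ℕ → ℝ) (qs : ℕ → ℕ → ℝ) (hq : IsPMF q) (hqs : ∀ j, IsPMF (qs j))
    (hDq_cont : ContinuousOn (disparity G f q) Θ)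
    (hDqs_cont : ∀ j, ContinuousOn (disparity G f (qs j)) Θ)
    (C : Set ℝ) (hCsub : C ⊆ Θ) (hCcomp : IsCompact C) (θplus : ℝ) (hθplus : θplus ∈ C)
    (hcoer : ∃ ε > 0, ∀ θ ∈ Θ \ C,
      mdapObj G f π Δ q θplus + ε ≤ mdapObj G f π Δ q θ)
    (Tq : ℝ) (hTq_mem : Tq ∈ Θ)
    (hTq_min : ∀ θ ∈ Θ, mdapObj G f π Δ q Tq ≤ mdapObj G f π Δ q θ)
    (hTq_uniq : ∀ t ∈ Θ, (∀ θ ∈ Θ, mdapObj G f π Δ q t ≤ mdapObj G f π Δ q θ) → t = Tq)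
    (hunif : ∀ ε > 0, ∃ J : ℕ, ∀ j ≥ J, ∀ θ ∈ Θ,
      |disparity G f (qs j) θ - disparity G f q θ| ≤ ε)
    (Ts : ℕ → ℝ) (J₀ : ℕ)
    (hTs_mem : ∀ j ≥ J₀, Ts j ∈ Θ)
    (hTs_min : ∀ j ≥ J₀, ∀ θ ∈ Θ, mdapObj G f π Δ (qs j) (Ts j) ≤ mdapObj G f π Δ (qs j) θ)
    (hTs_uniq : ∀ j ≥ J₀, ∀ t ∈ Θ,
      (∀ θ ∈ Θ, mdapObj G f π Δ (qs j) t ≤ mdapObj G f π Δ (qs j) θ) → t = Ts j) :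
    Tendsto Ts atTop (𝓝 Tq) := by
  have hg : ContinuousOn (mdapObj G f π Δ q) Θ :=
    (continuousOn_const.mul hDq_cont).sub (hπ_cont.log fun θ hθ => (hπ_pos θ hθ).ne')
  rw [tendsto_nhds]
  intro U hU hTqU
  obtain ⟨c, hc, hsep⟩ := exists_pos_add_le_of_unique_min hg hCsub hCcomp (hCsub hθplus) hcoer
    hTq_min hTq_uniq hU hTqU
  obtain ⟨J, hJ⟩ := hunif (c / (4 * Δ)) (by positivity)
  have hclose : ∀ j ≥ J, ∀ θ ∈ Θ,
      |mdapObj G f π Δ (qs j) θ - mdapObj G f π Δ q θ| ≤ c / 4 := by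
    intro j hj θ hθ
    calc |mdapObj G f π Δ (qs j) θ - mdapObj G f π Δ q θ|
        = Δ * |disparity G f (qs j) θ - disparity G f q θ| := by
          rw [← abs_of_pos hΔ, ← abs_mul, abs_of_pos hΔ]
          simp only [mdapObj]
          congr 1
          ring
      _ ≤ Δ * (c / (4 * Δ)) := by gcongr; exact hJ j hj θ hθ
      _ = c / 4 := by field_simp
  filter_upwards [eventually_ge_atTop (max J J₀)] with j hj
  have hjJ : J ≤ j := (le_max_left _ _).trans hj
  have hjJ₀ : J₀ ≤ j := (le_max_right _ _).trans hj
  by_contra hjU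
  have h₁ := abs_le.mp (hclose j hjJ _ (hTs_mem j hjJ₀))
  have h₂ := abs_le.mp (hclose j hjJ _ hTq_mem)
  linarith [hsep _ ⟨hTs_mem j hjJ₀, hjU⟩, hTs_min j hjJ₀ _ hTq_mem, h₁.1, h₂.2]
end

section
/- Let (Δ_n)_{n≥1} be positive reals with Δ_n → ∞. Assume: π is thrice differentiable with bounded third derivative and ∫_Θ |θ| π(θ) dθ < ∞; q ∈ Γ is such that T(q) exists, is the unique minimizer of D(q,·) over Θ, and lies in the interior of Θ; π(T(q)) > 0; D(q,·) is twice continuously differentiable on Θ with ∂²_θ D(q,θ)|_{θ=T(q)} > 0; and the separation condition holds: for every η > 0 there exists ρ > 0 with inf_{θ∈Θ, |θ−T(q)|>η} D(q,θ) − D(q,T(q)) > ρ. Then Δ_n^{1/2} (T̄_{Δ_n}(q) − T(q)) → 0 as n → ∞; that is, the EDAP function satisfies T̄_{Δ_n}(q) − T(q) = o(Δ_n^{−1/2}). -/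
open MeasureTheory Filter Topology Set

/-- **Laplace's method**, local part: on a ball around a nondegenerate zero of `g`, the rescaled
moments of `exp (-s² g) p` converge to Gaussian moments. -/
lemma tendsto_laplace_ball {g p : ℝ → ℝ} {T η a M : ℝ} (j : ℕ) (hη : 0 < η) (ha : 0 < a)
    (hg : ContinuousOn g (Metric.ball T η)) (hp : ContinuousOn p (Metric.ball T η))
    (hlow : ∀ x ∈ Metric.ball T η, a / 2 * (x - T) ^ 2 ≤ g x)
    (hM : ∀ x ∈ Metric.ball T η, |p x| ≤ M)
    (hgo : (fun x => g x - a * (x - T) ^ 2) =o[𝓝 T] fun x => (x - T) ^ 2) :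
    Tendsto (fun s : ℝ => s ^ (j + 1) *
        ∫ x in Metric.ball T η, (x - T) ^ j * Real.exp (-s ^ 2 * g x) * p x) atTop
      (𝓝 (∫ u : ℝ, u ^ j * Real.exp (-a * u ^ 2) * p T)) := by
  have hM0 : 0 ≤ M := (abs_nonneg _).trans (hM T (Metric.mem_ball_self hη))
  set K : ℝ → ℝ → ℝ := fun s x => (x - T) ^ j * Real.exp (-s ^ 2 * g x) * p x with hK
  have hrescale : ∀ s : ℝ, 0 < s →
      ∫ u : ℝ, s ^ j * (Metric.ball T η).indicator (K s) (T + u / s) =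
        s ^ (j + 1) * ∫ x in Metric.ball T η, K s x := by
    intro s hs
    rw [integral_const_mul,
      Measure.integral_comp_div (fun y => (Metric.ball T η).indicator (K s) (T + y)) s,
      integral_add_left_eq_self (fun y => (Metric.ball T η).indicator (K s) y) T,
      integral_indicator measurableSet_ball, abs_of_pos hs, smul_eq_mul]
    ring
  refine Tendsto.congr' ((eventually_gt_atTop 0).mono hrescale) ?_
  refine tendsto_integral_filter_of_dominated_convergence
    (fun u => |u| ^ j * Real.exp (-(a / 2) * u ^ 2) * M) ?_ ?_ ?_ ?_
  · refine .of_forall fun s => ?_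
    have hmaps : Continuous fun u : ℝ => T + u / s := by fun_prop
    have hset : MeasurableSet ((fun u : ℝ => T + u / s) ⁻¹' Metric.ball T η) :=
      hmaps.measurable measurableSet_ball
    have hind : (fun u : ℝ => (Metric.ball T η).indicator (K s) (T + u / s)) =
        ((fun u : ℝ => T + u / s) ⁻¹' Metric.ball T η).indicator fun u => K s (T + u / s) := by
      ext u; simp only [indicator]; rfl
    have hcont : ContinuousOn (K s) (Metric.ball T η) := by
      simp only [hK]; fun_prop
    have : AEStronglyMeasurable
        (fun u : ℝ => (Metric.ball T η).indicator (K s) (T + u / s)) volume := by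
      rw [hind, aestronglyMeasurable_indicator_iff hset]
      exact (hcont.comp hmaps.continuousOn (mapsTo_preimage _ _)).aestronglyMeasurable hset
    exact this.const_mul _
  · filter_upwards [eventually_gt_atTop 0] with s hs
    refine .of_forall fun u => ?_
    by_cases hu : T + u / s ∈ Metric.ball T η
    · have h1 := hlow _ hu
      have h2 := hM _ hu
      rw [indicator_of_mem hu]
      simp only [hK, add_sub_cancel_left] at h1 ⊢
      have h3 : s ^ j * ((u / s) ^ j * Real.exp (-s ^ 2 * g (T + u / s)) * p (T + u / s)) =
          u ^ j * Real.exp (-s ^ 2 * g (T + u / s)) * p (T + u / s) := by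
        rw [← mul_assoc, ← mul_assoc, ← mul_pow, mul_div_cancel₀ u hs.ne']
      have h4 : -s ^ 2 * g (T + u / s) ≤ -(a / 2) * u ^ 2 := by
        have := mul_le_mul_of_nonneg_left h1 (sq_nonneg s)
        have h5 : s ^ 2 * (a / 2 * (u / s) ^ 2) = a / 2 * u ^ 2 := by field_simp
        linarith
      rw [h3, Real.norm_eq_abs, abs_mul, abs_mul, abs_pow, Real.abs_exp]
      gcongr
    · rw [indicator_of_notMem hu]
      simp only [mul_zero, norm_zero]
      positivity
  · refine Integrable.mul_const ?_ M
    have h := (integrable_rpow_mul_exp_neg_mul_sq (b := a / 2) (half_pos ha) (s := j)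
      (by linarith [(Nat.cast_nonneg j : (0 : ℝ) ≤ j)])).norm
    refine h.congr (.of_forall fun u => ?_)
    simp
  · refine .of_forall fun u => ?_
    have hy : Tendsto (fun s : ℝ => T + u / s) atTop (𝓝 T) := by
      simpa using (tendsto_const_nhds (x := T)).add (tendsto_const_nhds.div_atTop tendsto_id)
    have hball : ∀ᶠ s : ℝ in atTop, T + u / s ∈ Metric.ball T η :=
      hy.eventually (Metric.ball_mem_nhds T hη)
    have hexp : Tendsto (fun s : ℝ => -s ^ 2 * g (T + u / s)) atTop (𝓝 (-a * u ^ 2)) := by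
      have h1 := (Asymptotics.isBigO_refl (fun s : ℝ => s ^ 2) atTop).mul_isLittleO
        (hgo.comp_tendsto hy)
      have h2 : (fun s : ℝ => s ^ 2 * ((fun x => (x - T) ^ 2) ∘ fun s => T + u / s) s) =ᶠ[atTop]
          fun _ => u ^ 2 := by
        filter_upwards [eventually_gt_atTop 0] with s hs
        simp only [Function.comp, add_sub_cancel_left]
        field_simp
      have h3 := (h1.congr' .rfl h2).trans_isBigO
        (Asymptotics.isBigO_const_const (u ^ 2) (one_ne_zero (α := ℝ)) atTop)
      rw [Asymptotics.isLittleO_one_iff] at h3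
      have h4 := (tendsto_const_nhds (x := -a * u ^ 2)).sub h3
      rw [sub_zero] at h4
      refine h4.congr' ?_
      filter_upwards [eventually_gt_atTop 0] with s hs
      simp only [Function.comp, add_sub_cancel_left]
      field_simp
      ring
    have hpT : Tendsto (fun s : ℝ => p (T + u / s)) atTop (𝓝 (p T)) :=
      (hp.continuousAt (Metric.ball_mem_nhds T hη)).tendsto.comp hy
    refine (((Real.continuous_exp.tendsto _).comp hexp).const_mul (u ^ j) |>.mul hpT).congr' ?_
    filter_upwards [hball, eventually_gt_atTop 0] with s hs hs0
    rw [indicator_of_mem hs]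
    simp only [hK, Function.comp, add_sub_cancel_left]
    rw [← mul_assoc, ← mul_assoc, ← mul_pow, mul_div_cancel₀ u hs0.ne']

/-- **Laplace's method**, tail part: the contribution of a region where `g` is bounded below by a
positive constant is negligible at every polynomial scale. -/
lemma tendsto_laplace_tail {g w : ℝ → ℝ} {S : Set ℝ} {ρ : ℝ} (m : ℕ) (hS : MeasurableSet S)
    (hρ : 0 < ρ) (hlow : ∀ x ∈ S, ρ ≤ g x) (hw : IntegrableOn w S) :
    Tendsto (fun s : ℝ => s ^ m * ∫ x in S, Real.exp (-s ^ 2 * g x) * w x) atTop (𝓝 0) := by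
  have hdecay : Tendsto (fun s : ℝ => s ^ m * Real.exp (-s ^ 2 * ρ)) atTop (𝓝 0) := by
    have h1 : Tendsto (fun s : ℝ => s ^ m * Real.exp (-s * ρ)) atTop (𝓝 0) := by
      have h2 := ((Real.tendsto_pow_mul_exp_neg_atTop_nhds_zero m).comp
        (tendsto_id.atTop_mul_const hρ)).const_mul (ρ ^ m)⁻¹
      rw [mul_zero] at h2
      refine h2.congr fun s => ?_
      simp only [Function.comp, id, mul_pow, neg_mul]
      field_simp
    refine squeeze_zero' ?_ ?_ h1
    · filter_upwards [eventually_ge_atTop 0] with s hs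
      positivity
    · filter_upwards [eventually_ge_atTop 1] with s hs
      gcongr
      nlinarith
  have hbound := hdecay.mul_const (∫ x in S, |w x|)
  rw [zero_mul] at hbound
  refine squeeze_zero_norm' ?_ hbound
  filter_upwards [eventually_ge_atTop 0] with s hs
  rw [norm_mul, Real.norm_of_nonneg (pow_nonneg hs m), mul_assoc, ← integral_const_mul]
  gcongr
  refine norm_integral_le_of_norm_le (hw.abs.const_mul _) ?_
  filter_upwards [ae_restrict_mem hS] with x hx
  rw [Real.norm_eq_abs, abs_mul, Real.abs_exp]
  have := mul_le_mul_of_nonneg_left (hlow x hx) (sq_nonneg s)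
  gcongr ?_ * _
  exact Real.exp_le_exp.2 (by linarith)

/-- **Laplace's method** for the moments of `exp (-s² g) p` around a well-separated nondegenerate
minimiser of `g`. -/
lemma tendsto_laplace {g p : ℝ → ℝ} {Θ : Set ℝ} {T a : ℝ} (j : ℕ) (hΘ : MeasurableSet Θ)
    (hT : Θ ∈ 𝓝 T) (ha : 0 < a) (hg : ContinuousOn g Θ) (hg0 : ∀ x ∈ Θ, 0 ≤ g x)
    (hp : Continuous p)
    (hgo : (fun x => g x - a * (x - T) ^ 2) =o[𝓝 T] fun x => (x - T) ^ 2)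
    (hsep : ∀ η > 0, ∃ ρ > 0, ∀ x ∈ Θ, η < |x - T| → ρ < g x)
    (hint : IntegrableOn (fun x => (x - T) ^ j * p x) Θ) :
    Tendsto (fun s : ℝ => s ^ (j + 1) *
        ∫ x in Θ, (x - T) ^ j * Real.exp (-s ^ 2 * g x) * p x) atTop
      (𝓝 (∫ u : ℝ, u ^ j * Real.exp (-a * u ^ 2) * p T)) := by
  have hlow : ∀ᶠ x in 𝓝 T, a / 2 * (x - T) ^ 2 ≤ g x := by
    filter_upwards [hgo.def (half_pos ha)] with x hx
    rw [Real.norm_eq_abs, Real.norm_of_nonneg (sq_nonneg _)] at hx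
    linarith [neg_le_of_abs_le hx]
  have hM : ∀ᶠ x in 𝓝 T, |p x| ≤ |p T| + 1 :=
    (hp.abs.tendsto T).eventually (eventually_le_nhds (lt_add_one _))
  obtain ⟨η, hη, hball⟩ := Metric.eventually_nhds_iff_ball.1 ((eventually_mem_set.2 hT).and (hlow.and hM))
  have hsub : Metric.ball T η ⊆ Θ := fun x hx => (hball x hx).1
  obtain ⟨ρ, hρ, hfar⟩ := hsep (η / 2) (half_pos hη)
  have hnear := tendsto_laplace_ball j hη ha (hg.mono hsub) hp.continuousOn
    (fun x hx => (hball x hx).2.1) (fun x hx => (hball x hx).2.2) hgo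
  have htail := tendsto_laplace_tail (g := g) (S := Θ \ Metric.ball T η) (j + 1)
    (hΘ.diff measurableSet_ball) hρ
    (fun x hx => (hfar x hx.1 (by
      have := hx.2
      rw [Metric.mem_ball, Real.dist_eq, not_lt] at this
      linarith)).le) (hint.mono_set sdiff_subset)
  have hsum := hnear.add htail
  rw [add_zero] at hsum
  refine hsum.congr fun s => ?_
  have hK : IntegrableOn (fun x => (x - T) ^ j * Real.exp (-s ^ 2 * g x) * p x) Θ := by
    refine Integrable.mono hint ?_ ?_
    · have : ContinuousOn (fun x => (x - T) ^ j * Real.exp (-s ^ 2 * g x) * p x) Θ := by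
        have := hp.continuousOn (s := Θ)
        fun_prop
      exact this.aestronglyMeasurable hΘ
    · filter_upwards [ae_restrict_mem hΘ] with x hx
      rw [mul_right_comm, norm_mul _ (Real.exp _), Real.norm_of_nonneg (Real.exp_pos _).le]
      refine mul_le_of_le_one_right (norm_nonneg _) (Real.exp_le_one_iff.2 ?_)
      nlinarith [hg0 x hx, sq_nonneg s, mul_nonneg (sq_nonneg s) (hg0 x hx)]
  rw [← mul_add, ← integral_inter_add_sdiff measurableSet_ball hK,
    inter_eq_self_of_subset_right hsub]
  simp_rw [mul_right_comm _ (Real.exp _) (p _), mul_comm _ (Real.exp _)]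

/-- Second-order Taylor expansion at a local minimum. -/
lemma IsLocalMin.sub_isLittleO_sq {D : ℝ → ℝ} {T : ℝ} (hmin : IsLocalMin D T)
    (hD : ContDiffAt ℝ 2 D T) :
    (fun x => D x - D T - iteratedDeriv 2 D T / 2 * (x - T) ^ 2) =o[𝓝 T]
      fun x => (x - T) ^ 2 := by
  obtain ⟨u, hu, hDu⟩ := hD.contDiffOn (m := 2) le_rfl (by simp)
  obtain ⟨ε, hε, hball⟩ := Metric.mem_nhds_iff.1 hu
  have hT : T ∈ Metric.ball T ε := Metric.mem_ball_self hε
  have h := taylor_isLittleO (n := 2) (convex_ball T ε) hT (hDu.mono (by simpa using hball))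
  rw [Metric.isOpen_ball.nhdsWithin_eq hT] at h
  refine h.congr_left fun x => ?_
  have h1 : iteratedDerivWithin 1 D (Metric.ball T ε) T = 0 := by
    rw [iteratedDerivWithin_of_isOpen Metric.isOpen_ball hT, iteratedDeriv_one,
      hmin.deriv_eq_zero]
  rw [taylorWithinEval_succ, taylorWithinEval_succ, taylor_within_zero_eval]
  simp only [zero_add, Nat.reduceAdd, h1,
    iteratedDerivWithin_of_isOpen (n := 2) Metric.isOpen_ball hT, smul_eq_mul]
  norm_num
  ring

/-- the EDAP function satisfies `T̄_{Δ_n}(q) − T(q) = o(Δ_n^{−1/2})`. -/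
theorem stmt4 (Θ : Set ℝ) (hΘ : MeasurableSet Θ)
    (f : ℝ → ℕ → ℝ) (G : ℝ → ℝ) (π : ℝ → ℝ) (Δ : ℕ → ℝ)
    (hΔpos : ∀ n, 0 < Δ n) (hΔ : Tendsto Δ atTop atTop)
    (hf_pmf : ∀ θ ∈ Θ, (∀ k, 0 ≤ f θ k) ∧ ∑' k, f θ k = 1)
    (hG : StrictConvexOn ℝ (Set.Ici (-1 : ℝ)) G)
    (hG3 : ContDiffOn ℝ 3 G (Set.Ici (-1 : ℝ))) (hG0 : G 0 = 0)
    (hπ_nn : ∀ θ, 0 ≤ π θ) (hπ_one : ∫ θ in Θ, π θ = 1)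
    (hπ_smooth : ContDiff ℝ 3 π) (hπ3_bdd : ∃ M, ∀ x, |iteratedDeriv 3 π x| ≤ M)
    (hπ_mom : Integrable (fun θ => |θ| * π θ) (volume.restrict Θ))
    (q : ℕ → ℝ) (hq : IsPMF q)
    (Tq : ℝ) (hTq_int : Tq ∈ interior Θ)
    (hTq_min : ∀ θ ∈ Θ, disparity G f q Tq ≤ disparity G f q θ)
    (hTq_uniq : ∀ t ∈ Θ, (∀ θ ∈ Θ, disparity G f q t ≤ disparity G f q θ) → t = Tq)
    (hπTq : 0 < π Tq)
    (hD_C2 : ContDiffOn ℝ 2 (disparity G f q) Θ)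
    (hD2_pos : 0 < iteratedDeriv 2 (disparity G f q) Tq)
    (hsep : ∀ η > 0, ∃ ρ > 0, ∀ θ ∈ Θ, η < |θ - Tq| →
      ρ < disparity G f q θ - disparity G f q Tq) :
    Tendsto (fun n => Real.sqrt (Δ n) * (edap G f π Θ (Δ n) q - Tq)) atTop (𝓝 0) := by
  set D := disparity G f q with hD
  have hΘT : Θ ∈ 𝓝 Tq := mem_interior_iff_mem_nhds.1 hTq_int
  have hπ_int : IntegrableOn π Θ := by
    by_contra h
    rw [integral_undef h] at hπ_one
    exact zero_ne_one hπ_one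
  have hmom : IntegrableOn (fun x => (x - Tq) * π x) Θ := by
    have h1 : IntegrableOn (fun x => x * π x) Θ := by
      refine hπ_mom.mono
        (continuous_id.mul hπ_smooth.continuous).aestronglyMeasurable (.of_forall fun x => ?_)
      simp
    exact (h1.sub (hπ_int.const_mul Tq)).congr (.of_forall fun x => by simp; ring)
  have hlap : ∀ j : ℕ, IntegrableOn (fun x => (x - Tq) ^ j * π x) Θ → _ := fun j =>
    tendsto_laplace (g := fun x => D x - D Tq) j hΘ hΘT (half_pos hD2_pos)
      (hD_C2.continuousOn.sub continuousOn_const) (fun x hx => sub_nonneg.2 (hTq_min x hx))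
      hπ_smooth.continuous
      (IsLocalMin.sub_isLittleO_sq (mem_of_superset hΘT hTq_min) (hD_C2.contDiffAt hΘT)) hsep
  have hden := hlap 0 (by simpa using hπ_int)
  have hnum := hlap 1 (by simpa using hmom)
  set a := iteratedDeriv 2 D Tq / 2 with ha_def
  have ha : 0 < a := half_pos hD2_pos
  have hodd : ∫ u : ℝ, u ^ 1 * Real.exp (-a * u ^ 2) * π Tq = 0 := by
    refine self_eq_neg.1 ?_
    rw [← integral_neg]
    conv_lhs => rw [← integral_neg_eq_self]
    congr 1
    ext u
    simp
  have hgauss : (∫ u : ℝ, u ^ 0 * Real.exp (-a * u ^ 2) * π Tq) ≠ 0 := by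
    simp only [pow_zero, one_mul]
    rw [integral_mul_const, integral_gaussian]
    have := Real.pi_pos
    positivity
  rw [hodd] at hnum
  have hquot := (hnum.div hden hgauss).comp (Real.tendsto_sqrt_atTop.comp hΔ)
  rw [zero_div] at hquot
  have hden_ne := (Real.tendsto_sqrt_atTop.comp hΔ).eventually (hden.eventually_ne hgauss)
  refine hquot.congr' ?_
  filter_upwards [hden_ne] with n hn
  simp only [Function.comp, Pi.div_apply, zero_add, pow_one, pow_zero, one_mul,
    Real.sq_sqrt (hΔpos n).le] at hn ⊢
  have hZ : (∫ x in Θ, Real.exp (-Δ n * (D x - D Tq)) * π x) ≠ 0 := right_ne_zero_of_mul hn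
  have hfactor : ∀ x, Real.exp (-Δ n * D x) =
      Real.exp (-Δ n * D Tq) * Real.exp (-Δ n * (D x - D Tq)) := fun x => by
    rw [← Real.exp_add]; ring_nf
  have hE : ∀ w : ℝ → ℝ, IntegrableOn w Θ →
      IntegrableOn (fun x => Real.exp (-Δ n * (D x - D Tq)) * w x) Θ := by
    intro w hw
    refine Integrable.bdd_mul (c := 1) hw ?_ ?_
    · have := hD_C2.continuousOn
      exact ContinuousOn.aestronglyMeasurable (by fun_prop) hΘ
    · filter_upwards [ae_restrict_mem hΘ] with x hx
      rw [Real.norm_of_nonneg (Real.exp_pos _).le]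
      refine Real.exp_le_one_iff.2 ?_
      nlinarith [mul_nonneg (hΔpos n).le (sub_nonneg.2 (hTq_min x hx))]
  have hedap : edap G f π Θ (Δ n) q - Tq =
      (∫ x in Θ, (x - Tq) * Real.exp (-Δ n * (D x - D Tq)) * π x) /
        ∫ x in Θ, Real.exp (-Δ n * (D x - D Tq)) * π x := by
    have h1 : ∫ x in Θ, x * Real.exp (-Δ n * D x) * π x = Real.exp (-Δ n * D Tq) *
        ((∫ x in Θ, (x - Tq) * Real.exp (-Δ n * (D x - D Tq)) * π x) +
          Tq * ∫ x in Θ, Real.exp (-Δ n * (D x - D Tq)) * π x) := by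
      rw [← integral_const_mul Tq, ← integral_add _ ((hE π hπ_int).const_mul Tq),
        ← integral_const_mul]
      · congr 1
        ext x
        rw [hfactor]
        ring
      · exact (hE _ hmom).congr (.of_forall fun x => by simp only; ring)
    have h2 : ∫ x in Θ, Real.exp (-Δ n * D x) * π x =
        Real.exp (-Δ n * D Tq) * ∫ x in Θ, Real.exp (-Δ n * (D x - D Tq)) * π x := by
      rw [← integral_const_mul]
      congr 1
      ext x
      rw [hfactor]
      ring
    rw [edap, ← hD, h1, h2, mul_div_mul_left _ _ (Real.exp_pos _).ne', add_div,
      mul_div_cancel_right₀ _ hZ, add_sub_cancel_right]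
  rw [hedap]
  rw [mul_div_mul_comm, Real.div_sqrt]
end

section
/- Let (Δ_n)_{n≥1} be positive reals with Δ_n → ∞, and let Θ ⊆ ℝ be complete and separable. Assume: π is bounded, thrice differentiable with bounded third derivative, and ∫_Θ |θ| π(θ) dθ < ∞; q ∈ Γ is such that T(q) exists, is the unique minimizer of D(q,·) over Θ, lies in the interior of Θ, and π(T(q)) > 0; D(q,·) is twice continuously differentiable on Θ with ∂²_θ D(q,θ)|_{θ=T(q)} > 0; the separation condition holds: for every η > 0 there is ρ > 0 with inf_{θ∈Θ, |θ−T(q)|>η} D(q,θ) − D(q,T(q)) > ρ; and there is n₀ such that for every n ≥ n₀ there exist a compact set C_n ⊆ Θ and θ⁺ ∈ C_n with inf_{θ∈Θ∖C_n} (Δ_n D(q,θ) − log π(θ)) > Δ_n D(q,θ⁺) − log π(θ⁺), and the minimizer T̃_n(q) of θ ↦ Δ_n D(q,θ) − log π(θ) over Θ is unique. Then Δ_n^{1/2} (T̃_n(q) − T(q)) → 0 as n → ∞; i.e., the MDAP function satisfies T̃_n(q) − T(q) = o(Δ_n^{−1/2}). -/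
open MeasureTheory Filter Topology Set

/-- A twice differentiable function grows at least quadratically away from a local minimum
where its second derivative is positive. -/
lemma IsLocalMin.eventually_mul_sq_le_sub {g : ℝ → ℝ} {x₀ : ℝ} (hmin : IsLocalMin g x₀)
    (hg : ∀ᶠ x in 𝓝 x₀, DifferentiableAt ℝ g x) (h2 : 0 < deriv (deriv g) x₀) :
    ∃ c > 0, ∀ᶠ x in 𝓝 x₀, c * (x - x₀) ^ 2 ≤ g x - g x₀ := by
  set a := deriv (deriv g) x₀ with ha
  have hquad (x : ℝ) :
      HasDerivAt (fun x => a / 4 * (x - x₀) ^ 2) (a / 2 * (x - x₀)) x := by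
    have h := (((hasDerivAt_id x).sub_const x₀).pow 2).const_mul (a / 4)
    refine (h.congr_deriv ?_)
    simp only [id_eq]
    ring
  set h : ℝ → ℝ := fun x => g x - a / 4 * (x - x₀) ^ 2 with hh
  have hderiv : deriv h =ᶠ[𝓝 x₀] fun x => deriv g x - a / 2 * (x - x₀) := by
    filter_upwards [hg] with x hx
    exact (hx.hasDerivAt.sub (hquad x)).deriv
  have hderiv₂ : deriv (deriv h) x₀ = a / 2 := by
    rw [hderiv.deriv_eq]
    have hd : HasDerivAt (deriv g) a x₀ :=
      (differentiableAt_of_deriv_ne_zero h2.ne').hasDerivAt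
    have hl := ((hasDerivAt_id x₀).sub_const x₀).const_mul (a / 2)
    refine (hd.sub hl).deriv.trans ?_
    ring
  have hloc : IsLocalMin h x₀ := by
    refine isLocalMin_of_deriv_deriv_pos (by rw [hderiv₂]; positivity) ?_ ?_
    · rw [hderiv.eq_of_nhds, hmin.deriv_eq_zero]
      simp
    · exact (hg.self_of_nhds.hasDerivAt.sub (hquad x₀)).continuousAt
  refine ⟨a / 4, by positivity, hloc.mono fun x hx => ?_⟩
  simp only [hh, sub_self] at hx
  linarith

/-- A function which is differentiable and nonzero at a point has a logarithm which is locally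
Lipschitz at that point. -/
lemma DifferentiableAt.eventually_abs_log_sub_log_le {p : ℝ → ℝ} {x₀ : ℝ}
    (hp : DifferentiableAt ℝ p x₀) (h0 : p x₀ ≠ 0) :
    ∃ L > 0, ∀ᶠ x in 𝓝 x₀, |Real.log (p x) - Real.log (p x₀)| ≤ L * |x - x₀| := by
  obtain ⟨L, hL, h⟩ := (hp.log h0).isBigO_sub.exists_pos
  exact ⟨L, hL, h.bound⟩

/-- the MDAP function satisfies `T̃_n(q) − T(q) = o(Δ_n^{−1/2})`. -/
theorem stmt5 (Θ : Set ℝ) (hΘ : MeasurableSet Θ) (hΘclosed : IsClosed Θ)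
    (f : ℝ → ℕ → ℝ) (G : ℝ → ℝ) (π : ℝ → ℝ) (Δ : ℕ → ℝ)
    (hΔpos : ∀ n, 0 < Δ n) (hΔ : Tendsto Δ atTop atTop)
    (hf_pmf : ∀ θ ∈ Θ, (∀ k, 0 ≤ f θ k) ∧ ∑' k, f θ k = 1)
    (hG : StrictConvexOn ℝ (Set.Ici (-1 : ℝ)) G)
    (hG3 : ContDiffOn ℝ 3 G (Set.Ici (-1 : ℝ))) (hG0 : G 0 = 0)
    (hπ_nn : ∀ θ, 0 ≤ π θ) (hπ_one : ∫ θ in Θ, π θ = 1)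
    (hπ_bdd : ∃ M, ∀ x, π x ≤ M)
    (hπ_smooth : ContDiff ℝ 3 π) (hπ3_bdd : ∃ M, ∀ x, |iteratedDeriv 3 π x| ≤ M)
    (hπ_mom : Integrable (fun θ => |θ| * π θ) (volume.restrict Θ))
    (q : ℕ → ℝ) (hq : IsPMF q)
    (Tq : ℝ) (hTq_int : Tq ∈ interior Θ)
    (hTq_min : ∀ θ ∈ Θ, disparity G f q Tq ≤ disparity G f q θ)
    (hTq_uniq : ∀ t ∈ Θ, (∀ θ ∈ Θ, disparity G f q t ≤ disparity G f q θ) → t = Tq)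
    (hπTq : 0 < π Tq)
    (hD_C2 : ContDiffOn ℝ 2 (disparity G f q) Θ)
    (hD2_pos : 0 < iteratedDeriv 2 (disparity G f q) Tq)
    (hsep : ∀ η > 0, ∃ ρ > 0, ∀ θ ∈ Θ, η < |θ - Tq| →
      ρ < disparity G f q θ - disparity G f q Tq)
    (Ts : ℕ → ℝ) (n₀ : ℕ)
    (hcoer : ∀ n ≥ n₀, ∃ C : Set ℝ, C ⊆ Θ ∧ IsCompact C ∧ ∃ θplus ∈ C, ∃ ε > 0,
      ∀ θ ∈ Θ \ C, mdapObj G f π (Δ n) q θplus + ε ≤ mdapObj G f π (Δ n) q θ)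
    (hTs_mem : ∀ n ≥ n₀, Ts n ∈ Θ)
    (hTs_min : ∀ n ≥ n₀, ∀ θ ∈ Θ, mdapObj G f π (Δ n) q (Ts n) ≤ mdapObj G f π (Δ n) q θ)
    (hTs_uniq : ∀ n ≥ n₀, ∀ t ∈ Θ,
      (∀ θ ∈ Θ, mdapObj G f π (Δ n) q t ≤ mdapObj G f π (Δ n) q θ) → t = Ts n) :
    Tendsto (fun n => Real.sqrt (Δ n) * (Ts n - Tq)) atTop (𝓝 0) := by
  have hΘ_nhds : Θ ∈ 𝓝 Tq := mem_interior_iff_mem_nhds.mp hTq_int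
  have hTq_mem : Tq ∈ Θ := interior_subset hTq_int
  obtain ⟨c, hc, hquad⟩ := IsLocalMin.eventually_mul_sq_le_sub (g := disparity G f q) (x₀ := Tq)
    (by filter_upwards [hΘ_nhds] with θ hθ using hTq_min θ hθ)
    (by
      filter_upwards [isOpen_interior.mem_nhds hTq_int] with θ hθ
      exact (hD_C2.contDiffAt (mem_interior_iff_mem_nhds.mp hθ)).differentiableAt (by norm_num))
    (by rwa [iteratedDeriv_succ, iteratedDeriv_one] at hD2_pos)
  obtain ⟨L, hL, hlog⟩ := DifferentiableAt.eventually_abs_log_sub_log_le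
    (hπ_smooth.differentiable (by norm_num) Tq) hπTq.ne'
  have hbasic : ∀ n ≥ n₀, Δ n * (disparity G f q (Ts n) - disparity G f q Tq) ≤
      Real.log (π (Ts n)) - Real.log (π Tq) := by
    intro n hn
    have h := hTs_min n hn Tq hTq_mem
    simp only [mdapObj] at h
    linarith
  obtain ⟨M, hM⟩ := hπ_bdd
  have hlog_le (x : ℝ) : Real.log (π x) ≤ |Real.log M| := by
    rcases (hπ_nn x).eq_or_lt with h | h
    · simp [← h]
    · exact (Real.log_le_log h (hM x)).trans (le_abs_self _)
  have hTs_lim : Tendsto Ts atTop (𝓝 Tq) := by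
    rw [Metric.tendsto_nhds]
    intro ε hε
    obtain ⟨ρ, hρ, hsepρ⟩ := hsep (ε / 2) (half_pos hε)
    filter_upwards [eventually_ge_atTop n₀,
      (hΔ.atTop_mul_const hρ).eventually_gt_atTop (|Real.log M| - Real.log (π Tq))] with n hn hlarge
    rw [Real.dist_eq]
    by_contra! hfar
    have hgap := hsepρ (Ts n) (hTs_mem n hn) (by linarith)
    have := mul_lt_mul_of_pos_left hgap (hΔpos n)
    linarith [hbasic n hn, hlog_le (Ts n)]
  have hbound : ∀ᶠ n in atTop, ‖√(Δ n) * (Ts n - Tq)‖ ≤ L / c * (√(Δ n))⁻¹ := by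
    filter_upwards [eventually_ge_atTop n₀, hTs_lim.eventually hquad,
      hTs_lim.eventually hlog] with n hn hq_n hlog_n
    have hs : 0 < √(Δ n) := Real.sqrt_pos.mpr (hΔpos n)
    rw [Real.norm_eq_abs, abs_mul, abs_of_pos hs, ← div_eq_mul_inv, le_div_iff₀ hs,
      le_div_iff₀ hc]
    rcases (abs_nonneg (Ts n - Tq)).eq_or_lt with h0 | h0
    · simpa [← h0] using hL.le
    · refine le_of_mul_le_mul_right ?_ h0
      calc √(Δ n) * |Ts n - Tq| * √(Δ n) * c * |Ts n - Tq|
          = (√(Δ n) * √(Δ n)) * (c * |Ts n - Tq| ^ 2) := by ring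
        _ = Δ n * (c * (Ts n - Tq) ^ 2) := by rw [Real.mul_self_sqrt (hΔpos n).le, sq_abs]
        _ ≤ Δ n * (disparity G f q (Ts n) - disparity G f q Tq) :=
          mul_le_mul_of_nonneg_left hq_n (hΔpos n).le
        _ ≤ Real.log (π (Ts n)) - Real.log (π Tq) := hbasic n hn
        _ ≤ L * |Ts n - Tq| := (le_abs_self _).trans hlog_n
  refine squeeze_zero_norm' hbound ?_
  simpa using (tendsto_inv_atTop_zero.comp (Real.tendsto_sqrt_atTop.comp hΔ)).const_mul (L / c)
end

section
/- In the asymptotic setting described in the context, define for t ∈ ℝ: w_n(t) = π(θ̂_n + tΔ_n^{−1/2}) · exp(−Δ_n (D(q̂_n, θ̂_n + tΔ_n^{−1/2}) − D(q̂_n, θ̂_n))) · 1_{R_n}(t) − π(θ_p) · exp(−t² I^D(θ_p)/2). Then, as n → ∞, (i) ∫_ℝ |w_n(t)| dt → 0, and (ii) ∫_ℝ |t| |w_n(t)| dt → 0. -/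
open MeasureTheory Filter Topology Set

/-- The auxiliary function `w_n(t)` of Lemma: the rescaled un-normalized D-posterior minus a
Gaussian shape, with `I^D(θ_p) = ∂²_θ D(p,·)|_{θ_p}`. -/
noncomputable def wAux (G : ℝ → ℝ) (f : ℝ → ℕ → ℝ) (π : ℝ → ℝ) (Θ : Set ℝ)
    (p : ℕ → ℝ) (θp : ℝ) (Δn : ℝ) (qn : ℕ → ℝ) (θn : ℝ) (t : ℝ) : ℝ :=
  Set.indicator ((fun θ => Real.sqrt Δn * (θ - θn)) '' Θ)
    (fun s => π (θn + s / Real.sqrt Δn) *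
      Real.exp (-Δn * (disparity G f qn (θn + s / Real.sqrt Δn) - disparity G f qn θn))) t
  - π θp * Real.exp (-(t ^ 2) * iteratedDeriv 2 (disparity G f p) θp / 2)

/-- A sequence of functions converging along every sequence `s n → x` converges along
`atTop ×ˢ 𝓝 x`. -/
lemma tendsto_uncurry_of_forall_seq {u : ℕ → ℝ → ℝ} {x l : ℝ}
    (h : ∀ s : ℕ → ℝ, Tendsto s atTop (𝓝 x) → Tendsto (fun n => u n (s n)) atTop (𝓝 l)) :
    Tendsto (Function.uncurry u) (atTop ×ˢ 𝓝 x) (𝓝 l) := by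
  rw [Metric.tendsto_nhds]
  intro ε hε
  by_contra hcon
  rw [Filter.not_eventually] at hcon
  have hfreq : ∀ j : ℕ, ∃ᶠ n in atTop, ∃ y, dist y x < 1 / ((j : ℝ) + 1) ∧
      ¬ dist (u n y) l < ε := by
    intro j
    by_contra hj
    rw [Filter.not_frequently] at hj
    have hball : ∀ᶠ y in 𝓝 x, dist y x < 1 / ((j : ℝ) + 1) :=
      Metric.ball_mem_nhds x (by positivity)
    refine hcon ((hj.prod_mk hball).mono ?_)
    rintro ⟨n, y⟩ ⟨h1, h2⟩ h3
    exact h1 ⟨y, h2, h3⟩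
  obtain ⟨φ, hφ, hbad⟩ := extraction_forall_of_frequently hfreq
  choose y hy hybad using hbad
  have hs : Tendsto (Function.extend φ y fun _ => x) atTop (𝓝 x) := by
    rw [Metric.tendsto_atTop]
    intro δ hδ
    obtain ⟨J, hJ⟩ := exists_nat_one_div_lt hδ
    refine ⟨φ J, fun n hn => ?_⟩
    by_cases hex : ∃ j, φ j = n
    · obtain ⟨j, rfl⟩ := hex
      rw [hφ.injective.extend_apply]
      have hJj : J ≤ j := hφ.le_iff_le.1 hn
      exact (hy j).trans_le ((one_div_le_one_div_of_le (by positivity) (by gcongr)).trans hJ.le)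
    · rw [Function.extend_apply' _ _ _ hex, dist_self]
      exact hδ
  have hlim := (h _ hs).comp hφ.tendsto_atTop
  obtain ⟨j, hj⟩ := (Metric.tendsto_nhds.1 hlim ε hε).exists
  simp only [Function.comp_apply, hφ.injective.extend_apply] at hj
  exact hybad j hj

/-- Second order Taylor expansion, with Lagrange remainder, at a critical point. -/
lemma exists_sub_eq_iteratedDeriv_two {g : ℝ → ℝ} {U : Set ℝ} (hU : IsOpen U)
    (hc : U.OrdConnected) (hg : ContDiffOn ℝ 2 g U) {a x : ℝ} (ha : a ∈ U) (hx : x ∈ U)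
    (h0 : deriv g a = 0) :
    ∃ ξ ∈ uIcc a x, g x - g a = iteratedDeriv 2 g ξ * (x - a) ^ 2 / 2 := by
  rcases eq_or_ne a x with rfl | hax
  · exact ⟨a, left_mem_uIcc, by simp⟩
  have hsub : uIcc a x ⊆ U := hc.uIcc_subset ha hx
  obtain ⟨ξ, hξ, he⟩ := taylor_mean_remainder_lagrange_iteratedDeriv (n := 1) hax
    (by simpa [one_add_one_eq_two] using hg.mono hsub)
  refine ⟨ξ, uIoo_subset_uIcc_self hξ, ?_⟩
  have hda : derivWithin g (uIcc a x) a = 0 := by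
    have hd : DifferentiableAt ℝ g a :=
      (hg.contDiffAt (hU.mem_nhds ha)).differentiableAt (by norm_num)
    rw [hd.derivWithin (uniqueDiffOn_uIcc hax a left_mem_uIcc), h0]
  simpa [taylorWithinEval_succ, iteratedDerivWithin_one, hda, one_add_one_eq_two] using he

/-- Laplace's method for integrals over `ℝ` of a rescaled unnormalised density, weighted by a
function `h` of at most linear growth. -/
lemma tendsto_integral_weight_mul_abs_rescaled_sub {Θ : Set ℝ} (hΘ : MeasurableSet Θ)
    {L : ℕ → ℝ → ℝ} {π : ℝ → ℝ} {Δ a : ℕ → ℝ} {θ₀ b c η : ℝ} {h : ℝ → ℝ}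
    (hΔpos : ∀ n, 0 < Δ n) (hΔ : Tendsto Δ atTop atTop) (ha : Tendsto a atTop (𝓝 θ₀))
    (hL : ∀ n, ContinuousOn (L n) Θ) (hb : 0 < b) (hc : 0 < c) (hη : 0 < η)
    (hnear : ∀ᶠ n in atTop, ∀ θ, |θ - a n| ≤ η → θ ∈ Θ ∧ c * (θ - a n) ^ 2 ≤ L n θ - L n (a n))
    (hlim : ∀ t, Tendsto (fun n => Δ n * (L n (a n + t / √(Δ n)) - L n (a n))) atTop
      (𝓝 (b * t ^ 2)))
    (hfar : ∃ r > 0, ∀ᶠ n in atTop, ∀ θ ∈ Θ, η < |θ - a n| → r ≤ L n θ - L n (a n))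
    (hπ : Continuous π) (hπ0 : ∀ θ, 0 ≤ π θ) (hπi : IntegrableOn π Θ)
    (hπm : IntegrableOn (fun θ => |θ| * π θ) Θ)
    (hh : Measurable h) (hh0 : ∀ t, 0 ≤ h t) (hh1 : ∀ t, h t ≤ 1 + |t|) :
    Tendsto (fun n => ∫ t, h t * |Θ.indicator
        (fun θ => π θ * Real.exp (-Δ n * (L n θ - L n (a n)))) (a n + t / √(Δ n))
      - π θ₀ * Real.exp (-b * t ^ 2)|) atTop (𝓝 0) := by
  obtain ⟨r, hr, hfar⟩ := hfar
  set s : ℕ → ℝ := fun n => √(Δ n) with hs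
  have hs0 : ∀ n, 0 < s n := fun n => Real.sqrt_pos.2 (hΔpos n)
  have hs2 : ∀ n, s n ^ 2 = Δ n := fun n => Real.sq_sqrt (hΔpos n).le
  have hsT : Tendsto s atTop atTop := Real.tendsto_sqrt_atTop.comp hΔ
  set H : ℕ → ℝ → ℝ := fun n => Θ.indicator
    (fun θ => π θ * Real.exp (-Δ n * (L n θ - L n (a n)))) with hH
  have hHmeas : ∀ n, Measurable (H n) := by
    classical
    intro n
    have hcont : ContinuousOn (fun θ => π θ * Real.exp (-Δ n * (L n θ - L n (a n)))) Θ :=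
      hπ.continuousOn.mul
        (Real.continuous_exp.comp_continuousOn
          (continuousOn_const.mul ((hL n).sub continuousOn_const)))
    have := hcont.measurable_piecewise (g := 0) continuousOn_const hΘ
    rwa [Set.piecewise_eq_indicator] at this
  have hH0 : ∀ n θ, 0 ≤ H n θ := fun n θ =>
    Set.indicator_nonneg (fun θ _ => mul_nonneg (hπ0 θ) (Real.exp_nonneg _)) θ
  set N : ℕ → Set ℝ := fun n => {t | |t / s n| ≤ η} with hN
  have hNmeas : ∀ n, MeasurableSet (N n) := fun n =>
    measurableSet_le (by fun_prop) measurable_const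
  set F : ℕ → ℝ → ℝ := fun n => (N n).indicator (fun t => H n (a n + t / s n)) with hF
  have hFmeas : ∀ n, Measurable (F n) := fun n =>
    ((hHmeas n).comp (by fun_prop)).indicator (hNmeas n)
  -- bound for the prior near the limit point
  obtain ⟨M, hM⟩ : ∃ M, ∀ θ ∈ Icc (θ₀ - (1 + η)) (θ₀ + (1 + η)), π θ ≤ M := by
    obtain ⟨M, hM⟩ := isCompact_Icc.bddAbove_image
      (hπ.continuousOn (s := Icc (θ₀ - (1 + η)) (θ₀ + (1 + η))))
    exact ⟨M, fun θ hθ => hM ⟨θ, hθ, rfl⟩⟩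
  have ha1 : ∀ᶠ n in atTop, |a n - θ₀| < 1 := by
    simpa [Real.dist_eq] using Metric.tendsto_nhds.1 ha 1 one_pos
  have hM0 : 0 ≤ M := (hπ0 θ₀).trans (hM θ₀ ⟨by linarith, by linarith⟩)
  have hFbound : ∀ᶠ n in atTop, ∀ t, |F n t| ≤ M * Real.exp (-c * t ^ 2) := by
    filter_upwards [hnear, ha1] with n hn hna t
    by_cases ht : t ∈ N n
    · obtain ⟨hm, hq⟩ := hn (a n + t / s n) (by simpa [hN] using ht)
      have hq' : c * t ^ 2 ≤ Δ n * (L n (a n + t / s n) - L n (a n)) := by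
        have := mul_le_mul_of_nonneg_left hq (hΔpos n).le
        have he : Δ n * (c * (a n + t / s n - a n) ^ 2) = c * t ^ 2 := by
          rw [← hs2 n]
          have := (hs0 n).ne'
          field_simp
          ring
        linarith
      have hFt : F n t = π (a n + t / s n) *
          Real.exp (-Δ n * (L n (a n + t / s n) - L n (a n))) := by
        simp only [hF, hH, Set.indicator_of_mem ht, Set.indicator_of_mem hm]
      rw [hFt, abs_of_nonneg (mul_nonneg (hπ0 _) (Real.exp_nonneg _))]
      have ht' : |t / s n| ≤ η := ht
      rw [abs_le] at ht'
      rw [abs_lt] at hna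
      refine mul_le_mul (hM _ ⟨by linarith, by linarith⟩) (Real.exp_le_exp.2 (by linarith))
        (Real.exp_nonneg _) hM0
    · simp only [hF, Set.indicator_of_notMem ht, abs_zero]
      positivity
  have hts : ∀ t : ℝ, Tendsto (fun n => t / s n) atTop (𝓝 0) := fun t => hsT.const_div_atTop t
  have hFlim : ∀ t, Tendsto (fun n => F n t) atTop (𝓝 (π θ₀ * Real.exp (-b * t ^ 2))) := by
    intro t
    have hπt : Tendsto (fun n => π (a n + t / s n)) atTop (𝓝 (π θ₀)) :=
      (hπ.tendsto θ₀).comp (by simpa using ha.add (hts t))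
    have het : Tendsto (fun n => Real.exp (-Δ n * (L n (a n + t / s n) - L n (a n)))) atTop
        (𝓝 (Real.exp (-b * t ^ 2))) := by
      refine (Real.continuous_exp.tendsto _).comp ?_
      simpa [neg_mul] using (hlim t).neg
    refine (hπt.mul het).congr' ?_
    have hsmall : ∀ᶠ n in atTop, |t / s n| < η := by
      simpa only [Real.dist_eq, sub_zero] using Metric.tendsto_nhds.1 (hts t) η hη
    filter_upwards [hnear, hsmall] with n hn ht
    have hm := (hn (a n + t / s n) (by simpa using ht.le)).1
    have htN : t ∈ N n := ht.le
    simp only [hF, hH, Set.indicator_of_mem htN, Set.indicator_of_mem hm]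
  -- the central part
  have hexp : ∀ {d : ℝ}, 0 < d → Integrable fun t : ℝ => (1 + |t|) * Real.exp (-d * t ^ 2) := by
    intro d hd
    refine ((integrable_exp_neg_mul_sq hd).add (integrable_mul_exp_neg_mul_sq hd).abs).congr
      (ae_of_all _ fun t => ?_)
    simp only [Pi.add_apply, abs_mul, Real.abs_exp]
    ring
  set P : ℕ → ℝ → ℝ := fun n t => h t * |F n t - π θ₀ * Real.exp (-b * t ^ 2)| with hP
  set B : ℝ → ℝ := fun t => M * ((1 + |t|) * Real.exp (-c * t ^ 2)) +
    π θ₀ * ((1 + |t|) * Real.exp (-b * t ^ 2)) with hB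
  have hBi : Integrable B := ((hexp hc).const_mul M).add ((hexp hb).const_mul _)
  have hPmeas : ∀ n, AEStronglyMeasurable (P n) volume := fun n =>
    (hh.mul (((hFmeas n).sub (by fun_prop)).abs)).aestronglyMeasurable
  have hPB : ∀ᶠ n in atTop, ∀ t, ‖P n t‖ ≤ B t := by
    filter_upwards [hFbound] with n hn t
    have h1 : |F n t - π θ₀ * Real.exp (-b * t ^ 2)| ≤
        M * Real.exp (-c * t ^ 2) + π θ₀ * Real.exp (-b * t ^ 2) := by
      refine (abs_sub _ _).trans (add_le_add (hn t) ?_)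
      rw [abs_of_nonneg (mul_nonneg (hπ0 _) (Real.exp_nonneg _))]
    rw [Real.norm_of_nonneg (mul_nonneg (hh0 t) (abs_nonneg _))]
    calc P n t ≤ (1 + |t|) *
          (M * Real.exp (-c * t ^ 2) + π θ₀ * Real.exp (-b * t ^ 2)) :=
          mul_le_mul (hh1 t) h1 (abs_nonneg _) (by positivity)
      _ = B t := by simp only [hB]; ring
  have hPi : ∀ᶠ n in atTop, Integrable (P n) := by
    filter_upwards [hPB] with n hn
    exact hBi.mono' (hPmeas n) (ae_of_all _ hn)
  have hP0 : Tendsto (fun n => ∫ t, P n t) atTop (𝓝 0) := by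
    have := tendsto_integral_filter_of_dominated_convergence (μ := volume) (F := P)
      (f := fun _ => (0 : ℝ)) B (Eventually.of_forall hPmeas)
      (hPB.mono fun n hn => ae_of_all _ hn) hBi (ae_of_all _ fun t => by
        have h0 := ((hFlim t).sub_const (π θ₀ * Real.exp (-b * t ^ 2))).abs.const_mul (h t)
        simpa only [sub_self, abs_zero, mul_zero] using h0)
    simpa using this
  -- the tails
  set k : ℝ → ℝ := Θ.indicator fun θ => (2 + |θ₀| + |θ|) * π θ with hk
  have hki : Integrable k := by
    refine (integrable_indicator_iff hΘ).2 (((hπi.const_mul (2 + |θ₀|)).add hπm).congr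
      (ae_of_all _ fun θ => ?_))
    simp only [Pi.add_apply]
    ring
  have hk0 : ∀ θ, 0 ≤ k θ := fun θ =>
    Set.indicator_nonneg (fun θ _ => mul_nonneg (by positivity) (hπ0 θ)) θ
  set Q : ℕ → ℝ → ℝ := fun n t => Real.exp (-(r * Δ n)) * (1 + s n) * k (a n + t / s n) with hQ
  have hQi : ∀ n, Integrable (Q n) := fun n =>
    ((hki.comp_add_left (a n)).comp_div (hs0 n).ne').const_mul _
  have hQint : ∀ n, ∫ t, Q n t = Real.exp (-(r * Δ n)) * (1 + s n) * (s n * ∫ θ, k θ) := by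
    intro n
    simp only [hQ]
    rw [integral_const_mul, Measure.integral_comp_div (fun y => k (a n + y)) (s n),
      integral_add_left_eq_self k (a n), abs_of_pos (hs0 n), smul_eq_mul]
  have hQ0 : Tendsto (fun n => ∫ t, Q n t) atTop (𝓝 0) := by
    have hbase : Tendsto (fun n => 2 * (∫ θ, k θ) / r * ((r * Δ n) ^ 1 * Real.exp (-(r * Δ n))))
        atTop (𝓝 0) := by
      have := ((Real.tendsto_pow_mul_exp_neg_atTop_nhds_zero 1).comp
        (hΔ.const_mul_atTop hr)).const_mul (2 * (∫ θ, k θ) / r)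
      simpa only [mul_zero, Function.comp_def] using this
    refine squeeze_zero' (Eventually.of_forall fun n => ?_) ?_ hbase
    · exact integral_nonneg fun t => mul_nonneg (by have := hs0 n; positivity) (hk0 _)
    · filter_upwards [hsT.eventually_ge_atTop 1] with n hn
      rw [hQint n]
      have hK : 0 ≤ ∫ θ, k θ := integral_nonneg hk0
      have hss : (1 + s n) * s n ≤ 2 * Δ n := by rw [← hs2 n]; nlinarith
      calc Real.exp (-(r * Δ n)) * (1 + s n) * (s n * ∫ θ, k θ)
          = ((1 + s n) * s n) * (Real.exp (-(r * Δ n)) * ∫ θ, k θ) := by ring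
        _ ≤ (2 * Δ n) * (Real.exp (-(r * Δ n)) * ∫ θ, k θ) := by gcongr
        _ = _ := by field_simp
  have htail : ∀ᶠ n in atTop, ∀ t ∉ N n, h t * H n (a n + t / s n) ≤ Q n t := by
    filter_upwards [hfar, ha1] with n hn hna t ht
    by_cases hm : a n + t / s n ∈ Θ
    · have hr' := hn _ hm (by simpa [hN] using ht)
      have h1 : Real.exp (-Δ n * (L n (a n + t / s n) - L n (a n))) ≤ Real.exp (-(r * Δ n)) := by
        refine Real.exp_le_exp.2 ?_
        nlinarith [mul_le_mul_of_nonneg_left hr' (hΔpos n).le]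
      have h2 : h t ≤ (1 + s n) * (2 + |θ₀| + |a n + t / s n|) := by
        have e1 : |t / s n| ≤ |a n + t / s n| + |a n| := by
          simpa using abs_sub (a n + t / s n) (a n)
        have e2 : |a n| ≤ 1 + |θ₀| := by
          have := abs_add_le (a n - θ₀) θ₀
          rw [sub_add_cancel] at this
          linarith
        have e3 : |t| = s n * |t / s n| := by
          rw [abs_div, abs_of_pos (hs0 n), mul_div_cancel₀ _ (hs0 n).ne']
        have e4 := mul_le_mul_of_nonneg_left (e1.trans (add_le_add_right e2 _)) (hs0 n).le
        have e5 := hh1 t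
        have := hs0 n
        nlinarith [abs_nonneg θ₀, abs_nonneg (a n + t / s n)]
      simp only [hQ, hH, hk, Set.indicator_of_mem hm]
      have := hs0 n
      have := hπ0 (a n + t / s n)
      calc _ ≤ ((1 + s n) * (2 + |θ₀| + |a n + t / s n|)) *
            (π (a n + t / s n) * Real.exp (-(r * Δ n))) := by gcongr
        _ = _ := by ring
    · simp [hQ, hH, hk, Set.indicator_of_notMem hm]
  have hsum : Tendsto (fun n => (∫ t, P n t) + ∫ t, Q n t) atTop (𝓝 0) := by
    simpa using hP0.add hQ0
  refine squeeze_zero' (Eventually.of_forall fun n =>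
    integral_nonneg fun t => mul_nonneg (hh0 t) (abs_nonneg _)) ?_ hsum
  filter_upwards [htail, hPi] with n hn hPn
  rw [← integral_add hPn (hQi n)]
  refine integral_mono_of_nonneg
    (ae_of_all _ fun t => mul_nonneg (hh0 t) (abs_nonneg _)) (hPn.add (hQi n))
    (ae_of_all _ fun t => ?_)
  have hQt : 0 ≤ Q n t := mul_nonneg (by have := hs0 n; positivity) (hk0 _)
  change h t * |H n (a n + t / s n) - π θ₀ * Real.exp (-b * t ^ 2)| ≤ P n t + Q n t
  by_cases ht : t ∈ N n
  · simp only [hP, hF, Set.indicator_of_mem ht]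
    linarith
  · simp only [hP, hF, Set.indicator_of_notMem ht]
    have h1 := abs_sub_le (H n (a n + t / s n)) 0 (π θ₀ * Real.exp (-b * t ^ 2))
    rw [sub_zero, abs_of_nonneg (hH0 n _)] at h1
    have h2 := mul_le_mul_of_nonneg_left h1 (hh0 t)
    have h3 := hn t ht
    linarith

/-- `∫ |w_n(t)| dt → 0` and `∫ |t||w_n(t)| dt → 0`. -/
theorem stmt6 (Θ : Set ℝ) (hΘ : MeasurableSet Θ)
    (f : ℝ → ℕ → ℝ) (G : ℝ → ℝ) (π : ℝ → ℝ) (Δ : ℕ → ℝ)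
    (hΔpos : ∀ n, 0 < Δ n) (hΔ : Tendsto Δ atTop atTop)
    (hG : StrictConvexOn ℝ (Set.Ici (-1 : ℝ)) G)
    (hG3 : ContDiffOn ℝ 3 G (Set.Ici (-1 : ℝ))) (hG0 : G 0 = 0)
    (hf_pmf : ∀ θ ∈ Θ, (∀ k, 0 ≤ f θ k) ∧ ∑' k, f θ k = 1)
    (p : ℕ → ℝ) (hp : IsPMF p) (qhat : ℕ → ℕ → ℝ) (hqhat : ∀ n, IsPMF (qhat n))
    (hl1 : Tendsto (fun n => ∑' k, |qhat n k - p k|) atTop (𝓝 0))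
    (ha : ∃ C > 0, ∀ q₁ q₂ : ℕ → ℝ, IsPMF q₁ → IsPMF q₂ → ∀ θ ∈ Θ,
      |disparity G f q₁ θ - disparity G f q₂ θ| ≤ C * ∑' k, |q₁ k - q₂ k|)
    (hb : ∀ q : ℕ → ℝ, IsPMF q → ContDiffOn ℝ 2 (disparity G f q) Θ)
    (θp : ℝ) (hθp_int : θp ∈ interior Θ)
    (hθp_min : ∀ θ ∈ Θ, disparity G f p θp ≤ disparity G f p θ)
    (hθp_uniq : ∀ t ∈ Θ, (∀ θ ∈ Θ, disparity G f p t ≤ disparity G f p θ) → t = θp)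
    (hI_pos : 0 < iteratedDeriv 2 (disparity G f p) θp)
    (hI_conv : ∀ θseq : ℕ → ℝ, Tendsto θseq atTop (𝓝 θp) →
      Tendsto (fun n => iteratedDeriv 2 (disparity G f (qhat n)) (θseq n)) atTop
        (𝓝 (iteratedDeriv 2 (disparity G f p) θp)))
    (θhat : ℕ → ℝ) (hθhat_mem : ∀ n, θhat n ∈ Θ)
    (hθhat_min : ∀ n, ∀ θ ∈ Θ, disparity G f (qhat n) (θhat n) ≤ disparity G f (qhat n) θ)
    (hθhat_deriv : ∀ n, deriv (disparity G f (qhat n)) (θhat n) = 0)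
    (hθhat_conv : Tendsto θhat atTop (𝓝 θp))
    (hsep : ∀ η > 0, ∃ ρ > 0, ∀ θ ∈ Θ, η < |θ - θp| →
      ρ < disparity G f p θ - disparity G f p θp)
    (hπ_cont : Continuous π) (hπ_nn : ∀ θ, 0 ≤ π θ) (hπ_one : ∫ θ in Θ, π θ = 1)
    (hπ_mom : Integrable (fun θ => |θ| * π θ) (volume.restrict Θ)) :
    Tendsto (fun n => ∫ t : ℝ, |wAux G f π Θ p θp (Δ n) (qhat n) (θhat n) t|)
      atTop (𝓝 0) ∧
    Tendsto (fun n => ∫ t : ℝ, |t| * |wAux G f π Θ p θp (Δ n) (qhat n) (θhat n) t|)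
      atTop (𝓝 0) := by
  set I := iteratedDeriv 2 (disparity G f p) θp with hI
  set L : ℕ → ℝ → ℝ := fun n => disparity G f (qhat n) with hL
  -- a ball around `θp` inside `Θ` on which the second derivatives are eventually at least `I / 2`
  obtain ⟨ε₁, hε₁, hball⟩ := Metric.mem_nhds_iff.1 (mem_interior_iff_mem_nhds.1 hθp_int)
  have hunif : ∀ᶠ z : ℕ × ℝ in atTop ×ˢ 𝓝 θp, I / 2 < iteratedDeriv 2 (L z.1) z.2 :=
    (tendsto_uncurry_of_forall_seq (u := fun n => iteratedDeriv 2 (L n)) hI_conv).eventually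
      (lt_mem_nhds (half_lt_self hI_pos))
  obtain ⟨S, hS, V, hV, hSV⟩ := Filter.mem_prod_iff.1 hunif
  obtain ⟨ε₂, hε₂, hballV⟩ := Metric.mem_nhds_iff.1 hV
  obtain ⟨ε, hε, hεΘ, hεV⟩ : ∃ ε > 0, Metric.ball θp ε ⊆ Θ ∧ Metric.ball θp ε ⊆ V :=
    ⟨min ε₁ ε₂, lt_min hε₁ hε₂, (Metric.ball_subset_ball (min_le_left _ _)).trans hball,
      (Metric.ball_subset_ball (min_le_right _ _)).trans hballV⟩
  have hord : (Metric.ball θp ε).OrdConnected := (convex_ball θp ε).ordConnected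
  have htaylor : ∀ n θ, θhat n ∈ Metric.ball θp ε → θ ∈ Metric.ball θp ε →
      ∃ ξ ∈ uIcc (θhat n) θ, L n θ - L n (θhat n) =
        iteratedDeriv 2 (L n) ξ * (θ - θhat n) ^ 2 / 2 := fun n θ h1 h2 =>
    exists_sub_eq_iteratedDeriv_two Metric.isOpen_ball hord ((hb _ (hqhat n)).mono hεΘ) h1 h2
      (hθhat_deriv n)
  have hhat : ∀ δ > 0, ∀ᶠ n in atTop, |θhat n - θp| < δ := fun δ hδ => by
    simpa [Real.dist_eq] using Metric.tendsto_nhds.1 hθhat_conv δ hδ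
  have hnear : ∀ᶠ n in atTop, ∀ θ, |θ - θhat n| ≤ ε / 2 →
      θ ∈ Θ ∧ I / 4 * (θ - θhat n) ^ 2 ≤ L n θ - L n (θhat n) := by
    filter_upwards [hS, hhat (ε / 2) (by positivity)] with n hn hna θ hθ
    have h1 : θhat n ∈ Metric.ball θp ε := by
      rw [Metric.mem_ball, Real.dist_eq]; linarith
    have h2 : θ ∈ Metric.ball θp ε := by
      rw [Metric.mem_ball, Real.dist_eq]
      have := abs_sub_le θ (θhat n) θp
      linarith
    refine ⟨hεΘ h2, ?_⟩
    obtain ⟨ξ, hξ, he⟩ := htaylor n θ h1 h2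
    have h3 : I / 2 < iteratedDeriv 2 (L n) ξ :=
      @hSV (n, ξ) ⟨hn, hεV (hord.uIcc_subset h1 h2 hξ)⟩
    rw [he]
    nlinarith [sq_nonneg (θ - θhat n)]
  have hsT : Tendsto (fun n => √(Δ n)) atTop atTop := Real.tendsto_sqrt_atTop.comp hΔ
  have hlim : ∀ t, Tendsto (fun n => Δ n * (L n (θhat n + t / √(Δ n)) - L n (θhat n))) atTop
      (𝓝 (I / 2 * t ^ 2)) := by
    intro t
    have hx : Tendsto (fun n => θhat n + t / √(Δ n)) atTop (𝓝 θp) := by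
      simpa using hθhat_conv.add (hsT.const_div_atTop t)
    have hex : ∀ n, ∃ ξ ∈ uIcc (θhat n) (θhat n + t / √(Δ n)),
        θhat n ∈ Metric.ball θp ε → θhat n + t / √(Δ n) ∈ Metric.ball θp ε →
        L n (θhat n + t / √(Δ n)) - L n (θhat n) =
          iteratedDeriv 2 (L n) ξ * (θhat n + t / √(Δ n) - θhat n) ^ 2 / 2 := by
      intro n
      by_cases hmem : θhat n ∈ Metric.ball θp ε ∧ θhat n + t / √(Δ n) ∈ Metric.ball θp ε
      · obtain ⟨ξ, hξ, he⟩ := htaylor n _ hmem.1 hmem.2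
        exact ⟨ξ, hξ, fun _ _ => he⟩
      · exact ⟨θhat n, left_mem_uIcc, fun h1 h2 => absurd ⟨h1, h2⟩ hmem⟩
    choose ξ hξ he using hex
    have hξlim : Tendsto ξ atTop (𝓝 θp) := by
      refine tendsto_of_tendsto_of_tendsto_of_le_of_le (g := fun n => min (θhat n) _)
        (h := fun n => max (θhat n) _) ?_ ?_ (fun n => (hξ n).1) (fun n => (hξ n).2)
      · simpa using hθhat_conv.min hx
      · simpa using hθhat_conv.max hx
    have h2 : Tendsto (fun n => iteratedDeriv 2 (L n) (ξ n) / 2 * t ^ 2) atTop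
        (𝓝 (I / 2 * t ^ 2)) := ((hI_conv ξ hξlim).div_const 2).mul_const _
    refine h2.congr' ?_
    filter_upwards [hθhat_conv.eventually (Metric.ball_mem_nhds θp hε),
      hx.eventually (Metric.ball_mem_nhds θp hε)] with n h3 h4
    rw [he n h3 h4, add_sub_cancel_left, div_pow, Real.sq_sqrt (hΔpos n).le]
    have := (hΔpos n).ne'
    field_simp
  have hfar : ∃ r > 0, ∀ᶠ n in atTop, ∀ θ ∈ Θ, ε / 2 < |θ - θhat n| →
      r ≤ L n θ - L n (θhat n) := by
    obtain ⟨C, -, hC⟩ := ha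
    obtain ⟨ρ, hρ, hsep⟩ := hsep (ε / 4) (by positivity)
    have hCl : Tendsto (fun n => C * ∑' k, |qhat n k - p k|) atTop (𝓝 0) := by
      simpa using hl1.const_mul C
    refine ⟨ρ / 2, by positivity, ?_⟩
    filter_upwards [hhat (ε / 4) (by positivity),
      hCl.eventually (gt_mem_nhds (show 0 < ρ / 4 by positivity))] with n hna hn θ hθ hd
    have h1 : ε / 4 < |θ - θp| := by
      have h2 := abs_sub_le θ θp (θhat n)
      rw [abs_sub_comm θp] at h2
      linarith
    have h2 := hsep θ hθ h1
    have h3 := (abs_le.1 ((hC _ _ (hqhat n) hp θ hθ).trans hn.le)).1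
    have h4 := (abs_le.1 ((hC _ _ (hqhat n) hp θp (interior_subset hθp_int)).trans hn.le)).2
    have h5 := hθhat_min n θp (interior_subset hθp_int)
    simp only [hL]
    linarith
  have hπi : IntegrableOn π Θ := by
    by_contra hni
    rw [integral_undef hni] at hπ_one
    exact zero_ne_one hπ_one
  have hw : ∀ n t, wAux G f π Θ p θp (Δ n) (qhat n) (θhat n) t =
      Θ.indicator (fun θ => π θ * Real.exp (-Δ n * (L n θ - L n (θhat n))))
        (θhat n + t / √(Δ n)) - π θp * Real.exp (-(I / 2) * t ^ 2) := by
    intro n t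
    have hs0 : √(Δ n) ≠ 0 := (Real.sqrt_pos.2 (hΔpos n)).ne'
    have hmem : t ∈ (fun θ => √(Δ n) * (θ - θhat n)) '' Θ ↔ θhat n + t / √(Δ n) ∈ Θ := by
      constructor
      · rintro ⟨θ, hθ, rfl⟩
        simpa [mul_div_cancel_left₀ _ hs0] using hθ
      · intro hθ
        exact ⟨_, hθ, by simp only [add_sub_cancel_left]; field_simp⟩
    have hg : -(t ^ 2) * I / 2 = -(I / 2) * t ^ 2 := by ring
    rw [wAux, ← hI, hg]
    congr 1
    by_cases hm : θhat n + t / √(Δ n) ∈ Θ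
    · rw [Set.indicator_of_mem hm, Set.indicator_of_mem (hmem.2 hm)]
    · rw [Set.indicator_of_notMem hm, Set.indicator_of_notMem fun h => hm (hmem.1 h)]
  have key : ∀ h : ℝ → ℝ, Measurable h → (∀ t, 0 ≤ h t) → (∀ t, h t ≤ 1 + |t|) →
      Tendsto (fun n => ∫ t : ℝ, h t * |wAux G f π Θ p θp (Δ n) (qhat n) (θhat n) t|)
        atTop (𝓝 0) := by
    intro h hh hh0 hh1
    simp only [hw]
    exact tendsto_integral_weight_mul_abs_rescaled_sub hΘ hΔpos hΔ hθhat_conv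
      (fun n => (hb _ (hqhat n)).continuousOn) (by positivity) (by positivity)
      (half_pos hε) hnear hlim hfar hπ_cont hπ_nn hπi hπ_mom hh hh0 hh1
  constructor
  · simpa using key (fun _ => 1) measurable_const (fun _ => zero_le_one) (fun t => by simp)
  · exact key (fun t => |t|) (by fun_prop) abs_nonneg (fun t => by simp)
end

section
/- In the asymptotic setting described in the context, assume additionally that π is bounded, thrice differentiable with bounded third derivative, and π(θ_p) > 0. Let π̄_D^n denote the D-posterior density of t = Δ_n^{1/2}(θ − θ̂_n). Then sup_{t∈ℝ} |π̄_D^n(t) − φ(t; I^D(θ_p)^{−1})| → 0 as n → ∞, where φ(·; v) is the centered Gaussian density with variance v. -/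
open MeasureTheory Filter Topology Set

/-- The D-posterior density of `t = Δ_n^{1/2}(θ − θ̂_n)`, supported on
`R_n = {Δ_n^{1/2}(θ − θ̂_n) : θ ∈ Θ}`. -/
noncomputable def tPosterior (G : ℝ → ℝ) (f : ℝ → ℕ → ℝ) (π : ℝ → ℝ) (Θ : Set ℝ)
    (Δn : ℝ) (qn : ℕ → ℝ) (θn : ℝ) (t : ℝ) : ℝ :=
  Set.indicator ((fun θ => Real.sqrt Δn * (θ - θn)) '' Θ)
    (fun s => Real.exp (-Δn * disparity G f qn (θn + s / Real.sqrt Δn)) *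
        π (θn + s / Real.sqrt Δn) /
      ∫ u in (fun θ => Real.sqrt Δn * (θ - θn)) '' Θ,
        Real.exp (-Δn * disparity G f qn (θn + u / Real.sqrt Δn)) *
          π (θn + u / Real.sqrt Δn)) t

/-- Centered Gaussian density `φ(t; v) = (2πv)^{−1/2} e^{−t²/(2v)}` with variance `v`. -/
noncomputable def gaussD (v t : ℝ) : ℝ :=
  (Real.sqrt (2 * Real.pi * v))⁻¹ * Real.exp (-(t ^ 2) / (2 * v))

/-- Continuous convergence along sequences gives joint convergence along the product filter. -/
lemma tendsto_uncurry_atTop_prod_nhds {X Y : Type*} [TopologicalSpace X]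
    [FirstCountableTopology X] {F : ℕ → X → Y} {x : X} {l : Filter Y}
    (h : ∀ u : ℕ → X, Tendsto u atTop (𝓝 x) → Tendsto (fun n => F n (u n)) atTop l) :
    Tendsto (Function.uncurry F) (atTop ×ˢ 𝓝 x) l := by
  refine tendsto_of_subseq_tendsto fun ns hns => ?_
  obtain ⟨φ, hφ, hψ⟩ := strictMono_subseq_of_tendsto_atTop (tendsto_fst.comp hns)
  set ψ := (Prod.fst ∘ ns) ∘ φ
  set v : ℕ → X := fun k => (ns (φ k)).2
  have hv : Tendsto v atTop (𝓝 x) := (tendsto_snd.comp hns).comp hφ.tendsto_atTop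
  have hu : Tendsto (Function.extend ψ v fun _ => x) atTop (𝓝 x) := by
    intro U hU
    obtain ⟨K, hK⟩ := eventually_atTop.1 (hv hU)
    refine mem_map.2 ?_
    filter_upwards [eventually_ge_atTop (ψ K)] with n hn
    by_cases hr : ∃ k, ψ k = n
    · obtain ⟨k, rfl⟩ := hr
      simpa [hψ.injective.extend_apply] using hK k (hψ.le_iff_le.1 hn)
    · simpa [Function.extend_apply' _ _ _ hr] using mem_of_mem_nhds hU
  refine ⟨φ, ((h _ hu).comp hψ.tendsto_atTop).congr fun k => ?_⟩
  change F (ψ k) (Function.extend ψ v (fun _ => x) (ψ k)) = F (ψ k) (v k)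
  rw [hψ.injective.extend_apply]

/-- Second order expansion at a critical point, with a uniform bound on the second derivative. -/
lemma abs_sub_sub_quadratic_le {g : ℝ → ℝ} {U s : Set ℝ} {a x I ε : ℝ} (hU : IsOpen U)
    (hg : ContDiffOn ℝ 2 g U) (hsU : s ⊆ U) (hs : Convex ℝ s) (ha : a ∈ s) (hx : x ∈ s)
    (hda : deriv g a = 0) (h2 : ∀ y ∈ s, |iteratedDeriv 2 g y - I| ≤ ε) :
    |g x - g a - I / 2 * (x - a) ^ 2| ≤ ε * (x - a) ^ 2 := by
  have hε : 0 ≤ ε := (abs_nonneg _).trans (h2 a ha)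
  have hd1 : ∀ y ∈ U, HasDerivAt g (deriv g y) y := fun y hy =>
    ((hg.differentiableOn (by norm_num)).differentiableAt (hU.mem_nhds hy)).hasDerivAt
  have hd2 : ∀ y ∈ U, HasDerivAt (deriv g) (iteratedDeriv 2 g y) y := fun y hy => by
    have hc : ContDiffAt ℝ 1 (deriv g) y :=
      (hg.contDiffAt (hU.mem_nhds hy)).derivWithin (by norm_num)
    rw [iteratedDeriv_succ, iteratedDeriv_one]
    exact (hc.differentiableAt (by norm_num)).hasDerivAt
  have hfirst : ∀ y ∈ s, |deriv g y - I * (y - a)| ≤ ε * |y - a| := fun y hy => by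
    have h := hs.norm_image_sub_le_of_norm_hasDerivWithin_le
      (f := fun z => deriv g z - I * (z - a)) (f' := fun z => iteratedDeriv 2 g z - I)
      (fun z hz => by
        have := (hd2 z (hsU hz)).sub (((hasDerivAt_id' z).sub_const a).const_mul I)
        rw [mul_one] at this
        exact this.hasDerivWithinAt)
      (C := ε) h2 ha hy
    simpa [hda] using h
  have hsub : uIcc a x ⊆ s := hs.ordConnected.uIcc_subset ha hx
  have h := (convex_uIcc a x).norm_image_sub_le_of_norm_hasDerivWithin_le
    (f := fun z => g z - I / 2 * (z - a) ^ 2) (f' := fun z => deriv g z - I * (z - a))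
    (fun z hz => by
      have := (hd1 z (hsU (hsub hz))).sub
        ((((hasDerivAt_id' z).sub_const a).fun_pow 2).const_mul (I / 2))
      rw [show I / 2 * ((2 : ℕ) * (z - a) ^ (2 - 1) * 1) = I * (z - a) by
        push_cast; ring] at this
      exact this.hasDerivWithinAt)
    (C := ε * |x - a|)
    (fun z hz => (hfirst z (hsub hz)).trans
      (mul_le_mul_of_nonneg_left (abs_sub_left_of_mem_uIcc hz) hε))
    left_mem_uIcc right_mem_uIcc
  calc |g x - g a - I / 2 * (x - a) ^ 2|
      = ‖g x - I / 2 * (x - a) ^ 2 - (g a - I / 2 * (a - a) ^ 2)‖ := by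
        rw [Real.norm_eq_abs]; congr 1; ring
    _ ≤ ε * |x - a| * ‖x - a‖ := h
    _ = ε * (x - a) ^ 2 := by rw [Real.norm_eq_abs, mul_assoc, abs_mul_abs_self]; ring

lemma abs_exp_neg_sub_exp_neg_le {a b : ℝ} (ha : 0 ≤ a) (hb : 0 ≤ b) :
    |Real.exp (-a) - Real.exp (-b)| ≤ |a - b| := by
  wlog hab : a ≤ b generalizing a b
  · rw [abs_sub_comm, abs_sub_comm a]
    exact this hb ha (le_of_not_ge hab)
  have hmono : Real.exp (-b) ≤ Real.exp (-a) := Real.exp_le_exp.2 (by linarith)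
  rw [abs_of_nonneg (by linarith), abs_sub_comm, abs_of_nonneg (by linarith)]
  have h1 : Real.exp (-b) = Real.exp (-a) * Real.exp (-(b - a)) := by
    rw [← Real.exp_add]; congr 1; ring
  have h2 := Real.add_one_le_exp (-(b - a))
  have h3 : Real.exp (-a) ≤ 1 := Real.exp_le_one_iff.2 (by linarith)
  have h4 := Real.exp_pos (-a)
  rw [h1]
  nlinarith

/-- The unnormalized posterior density in the local coordinate `t = Δ^{1/2}(θ − a)`, for the
excess risk `E`, the prior density `w` and the parameter set `Θ`. -/
noncomputable def localDensity (Θ : Set ℝ) (w E : ℝ → ℝ) (Δ a t : ℝ) : ℝ :=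
  Θ.indicator (fun x => Real.exp (-Δ * E x) * w x) (a + t / √Δ)

/-- Hypotheses of Laplace's method for the integrals of `localDensity`: the excess risks `E n` are
uniformly quadratic near `c` around the minimizers `a n → c`, and well separated from `0` away
from `c`. -/
structure LaplaceSetting (Θ : Set ℝ) (w : ℝ → ℝ) (E : ℕ → ℝ → ℝ) (Δ a : ℕ → ℝ) (c I M : ℝ) :
    Prop where
  measurableSet : MeasurableSet Θ
  mem_nhds : Θ ∈ 𝓝 c
  continuous : Continuous w
  nonneg : ∀ x, 0 ≤ w x
  le_bound : ∀ x, w x ≤ M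
  integrableOn : IntegrableOn w Θ
  continuousOn : ∀ n, ContinuousOn (E n) Θ
  pos : ∀ n, 0 < Δ n
  tendsto_atTop : Tendsto Δ atTop atTop
  tendsto_center : Tendsto a atTop (𝓝 c)
  curvature_pos : 0 < I
  quadratic : ∀ ε > 0, ∃ δ > 0, ∀ᶠ n in atTop, ∀ x, |x - c| < δ →
    |E n x - I / 2 * (x - a n) ^ 2| ≤ ε * (x - a n) ^ 2
  separation : ∀ η > 0, ∃ ρ > 0, ∀ᶠ n in atTop, ∀ x ∈ Θ, η < |x - c| → ρ ≤ E n x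

namespace LaplaceSetting

variable {Θ : Set ℝ} {w : ℝ → ℝ} {E : ℕ → ℝ → ℝ} {Δ a : ℕ → ℝ} {c I M : ℝ}

lemma localDensity_nonneg (h : LaplaceSetting Θ w E Δ a c I M) (n : ℕ) (t : ℝ) :
    0 ≤ localDensity Θ w (E n) (Δ n) (a n) t :=
  indicator_nonneg (fun _ _ => mul_nonneg (Real.exp_pos _).le (h.nonneg _)) _

lemma bound_nonneg (h : LaplaceSetting Θ w E Δ a c I M) : 0 ≤ M :=
  (h.nonneg c).trans (h.le_bound c)

/-- In local coordinates a quadratic bound on the excess risk does not depend on `Δ`. -/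
lemma abs_mul_sub_le (h : LaplaceSetting Θ w E Δ a c I M) {n : ℕ} {ε t : ℝ}
    (hq : |E n (a n + t / √(Δ n)) - I / 2 * (a n + t / √(Δ n) - a n) ^ 2| ≤
      ε * (a n + t / √(Δ n) - a n) ^ 2) :
    |Δ n * E n (a n + t / √(Δ n)) - I / 2 * t ^ 2| ≤ ε * t ^ 2 := by
  have hpos := h.pos n
  have hsq : (a n + t / √(Δ n) - a n) ^ 2 * Δ n = t ^ 2 := by
    rw [add_sub_cancel_left, div_pow, Real.sq_sqrt hpos.le, div_mul_cancel₀ _ hpos.ne']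
  have := mul_le_mul_of_nonneg_right hq hpos.le
  rw [mul_assoc, hsq, ← abs_of_pos hpos, ← abs_mul, abs_of_pos hpos] at this
  rwa [sub_mul, mul_assoc (I / 2), hsq, mul_comm (E n _)] at this

/-- A Gaussian bound near the center plus an exponentially small multiple of the prior. -/
lemma localDensity_le (h : LaplaceSetting Θ w E Δ a c I M) :
    ∃ ρ > 0, ∀ᶠ n in atTop, ∀ t, localDensity Θ w (E n) (Δ n) (a n) t ≤
      M * Real.exp (-(I / 4) * t ^ 2) +
        Real.exp (-ρ * Δ n) * Θ.indicator w (a n + t / √(Δ n)) := by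
  obtain ⟨δ, hδ, hquad⟩ := h.quadratic (I / 4) (by linarith [h.curvature_pos])
  obtain ⟨ρ, hρ, hsep⟩ := h.separation (δ / 2) (by linarith)
  refine ⟨ρ, hρ, ?_⟩
  filter_upwards [hquad, hsep] with n hquad hsep t
  have hM := h.bound_nonneg
  have hpos := h.pos n
  unfold localDensity
  set x := a n + t / √(Δ n)
  by_cases hxΘ : x ∈ Θ
  · rw [indicator_of_mem hxΘ, indicator_of_mem hxΘ]
    have hw := h.nonneg x
    rcases lt_or_ge |x - c| δ with hnear | hfar
    · have hb := (abs_le.1 (h.abs_mul_sub_le (hquad x hnear))).1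
      have he : Real.exp (-Δ n * E n x) ≤ Real.exp (-(I / 4) * t ^ 2) :=
        Real.exp_le_exp.2 (by linarith)
      have := mul_le_mul he (h.le_bound x) hw (Real.exp_pos _).le
      have := mul_nonneg (Real.exp_pos (-ρ * Δ n)).le hw
      linarith
    · have hb := hsep x hxΘ (by linarith)
      have he : Real.exp (-Δ n * E n x) ≤ Real.exp (-ρ * Δ n) :=
        Real.exp_le_exp.2 (by nlinarith)
      have := mul_le_mul_of_nonneg_right he hw
      have := mul_nonneg hM (Real.exp_pos (-(I / 4) * t ^ 2)).le
      linarith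
  · simp only [indicator_of_notMem hxΘ, mul_zero, add_zero]
    positivity

lemma measurable_localDensity (h : LaplaceSetting Θ w E Δ a c I M) (n : ℕ) :
    Measurable (localDensity Θ w (E n) (Δ n) (a n)) := by
  classical
  have hm : Measurable (Θ.indicator fun x => Real.exp (-Δ n * E n x) * w x) := by
    rw [← piecewise_eq_indicator]
    exact ContinuousOn.measurable_piecewise
      ((Real.continuous_exp.comp_continuousOn (continuousOn_const.mul (h.continuousOn n))).mul
        h.continuous.continuousOn) continuousOn_const h.measurableSet
  exact hm.comp (by fun_prop)

lemma integrable_prior (h : LaplaceSetting Θ w E Δ a c I M) (n : ℕ) :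
    Integrable fun t => Θ.indicator w (a n + t / √(Δ n)) :=
  (((integrable_indicator_iff h.measurableSet).2 h.integrableOn).comp_add_left (a n)).comp_div
    (Real.sqrt_pos.2 (h.pos n)).ne'

lemma integral_prior (n : ℕ) :
    ∫ t, Θ.indicator w (a n + t / √(Δ n)) = √(Δ n) * ∫ x, Θ.indicator w x := by
  rw [Measure.integral_comp_div (fun y => Θ.indicator w (a n + y)) (√(Δ n)),
    integral_add_left_eq_self (Θ.indicator w), abs_of_nonneg (Real.sqrt_nonneg _), smul_eq_mul]

lemma tendsto_exp_mul_sqrt (h : LaplaceSetting Θ w E Δ a c I M) {ρ : ℝ} (hρ : 0 < ρ) (K : ℝ) :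
    Tendsto (fun n => Real.exp (-ρ * Δ n) * (√(Δ n) * K)) atTop (𝓝 0) := by
  have := ((tendsto_rpow_mul_exp_neg_mul_atTop_nhds_zero (1 / 2) ρ hρ).comp
    h.tendsto_atTop).mul_const K
  rw [zero_mul] at this
  refine this.congr fun n => ?_
  simp only [Function.comp, Real.sqrt_eq_rpow]
  ring

lemma tendsto_exp_mul (h : LaplaceSetting Θ w E Δ a c I M) {ρ : ℝ} (hρ : 0 < ρ) (K : ℝ) :
    Tendsto (fun n => Real.exp (-ρ * Δ n) * K) atTop (𝓝 0) := by
  have := ((tendsto_rpow_mul_exp_neg_mul_atTop_nhds_zero 0 ρ hρ).comp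
    h.tendsto_atTop).mul_const K
  simpa [Function.comp_def] using this

lemma gaussian_le (h : LaplaceSetting Θ w E Δ a c I M) (t : ℝ) :
    w c * Real.exp (-(I / 2) * t ^ 2) ≤ M * Real.exp (-(I / 4) * t ^ 2) :=
  mul_le_mul (h.le_bound c)
    (Real.exp_le_exp.2 (by nlinarith [h.curvature_pos, sq_nonneg t]))
    (Real.exp_pos _).le h.bound_nonneg

/-- Convergence of the local density, uniformly on bounded intervals. -/
lemma eventually_abs_sub_lt_of_abs_le (h : LaplaceSetting Θ w E Δ a c I M) (T : ℝ) {ε : ℝ}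
    (hε : 0 < ε) : ∀ᶠ n in atTop, ∀ t, |t| ≤ T →
      |localDensity Θ w (E n) (Δ n) (a n) t - w c * Real.exp (-(I / 2) * t ^ 2)| < ε := by
  have hM := h.bound_nonneg
  have hI := h.curvature_pos
  set κ := min (I / 4) (ε / 4 / ((M + 1) * (T ^ 2 + 1)))
  have hκpos : 0 < κ := lt_min (by linarith) (by positivity)
  obtain ⟨δ, hδ, hquad⟩ := h.quadratic κ hκpos
  obtain ⟨r, hr, hball⟩ := Metric.mem_nhds_iff.1 h.mem_nhds
  obtain ⟨r', hr', hw⟩ := Metric.continuousAt_iff.1 h.continuous.continuousAt (ε / 2) (half_pos hε)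
  set d := min δ (min r r')
  have hdpos : 0 < d := lt_min hδ (lt_min hr hr')
  have hT : Tendsto (fun n => T / √(Δ n)) atTop (𝓝 0) :=
    (Real.tendsto_sqrt_atTop.comp h.tendsto_atTop).const_div_atTop T
  filter_upwards [hquad, Metric.tendsto_nhds.1 h.tendsto_center (d / 2) (half_pos hdpos),
    hT.eventually_lt_const (half_pos hdpos)] with n hquad hcenter hTn t ht
  have hxc : |a n + t / √(Δ n) - c| < d := by
    rw [Real.dist_eq] at hcenter
    have h1 : |t / √(Δ n)| ≤ T / √(Δ n) := by
      rw [abs_div, abs_of_nonneg (Real.sqrt_nonneg _)]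
      exact div_le_div_of_nonneg_right ht (Real.sqrt_nonneg _)
    calc |a n + t / √(Δ n) - c| = |(a n - c) + t / √(Δ n)| := by congr 1; ring
      _ ≤ |a n - c| + |t / √(Δ n)| := abs_add_le _ _
      _ < d := by linarith
  unfold localDensity
  set x := a n + t / √(Δ n)
  have hxΘ : x ∈ Θ := hball (by
    rw [Metric.mem_ball, Real.dist_eq]
    exact hxc.trans_le ((min_le_right _ _).trans (min_le_left _ _)))
  have hwx : |w x - w c| < ε / 2 := by
    have := hw (x := x) (by
      rw [Real.dist_eq]
      exact hxc.trans_le ((min_le_right _ _).trans (min_le_right _ _)))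
    rwa [Real.dist_eq] at this
  have hq := h.abs_mul_sub_le (hquad x (hxc.trans_le (min_le_left _ _)))
  have hκI : κ ≤ I / 4 := min_le_left _ _
  have hE : 0 ≤ Δ n * E n x := by
    have := (abs_le.1 hq).1
    nlinarith [sq_nonneg t]
  have hexp := (abs_exp_neg_sub_exp_neg_le hE (by positivity : 0 ≤ I / 2 * t ^ 2)).trans hq
  have ht2 : t ^ 2 ≤ T ^ 2 := sq_le_sq' (by linarith [(abs_le.1 ht).1]) (abs_le.1 ht).2
  have hκle : κ * ((M + 1) * (T ^ 2 + 1)) ≤ ε / 4 :=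
    (le_div_iff₀ (by positivity)).1 (min_le_right _ _)
  rw [indicator_of_mem hxΘ]
  have hexp1 : |Real.exp (-(Δ n * E n x))| ≤ 1 := by
    rw [abs_of_pos (Real.exp_pos _)]
    exact Real.exp_le_one_iff.2 (by linarith)
  calc |Real.exp (-Δ n * E n x) * w x - w c * Real.exp (-(I / 2) * t ^ 2)|
      = |Real.exp (-(Δ n * E n x)) * (w x - w c) +
          (Real.exp (-(Δ n * E n x)) - Real.exp (-(I / 2 * t ^ 2))) * w c| := by
        rw [neg_mul, neg_mul]; congr 1; ring
    _ ≤ |Real.exp (-(Δ n * E n x))| * |w x - w c| +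
          |Real.exp (-(Δ n * E n x)) - Real.exp (-(I / 2 * t ^ 2))| * |w c| := by
        rw [← abs_mul, ← abs_mul]; exact abs_add_le _ _
    _ ≤ 1 * |w x - w c| + κ * T ^ 2 * M := by
        have hwc : |w c| ≤ M := by rw [abs_of_nonneg (h.nonneg c)]; exact h.le_bound c
        gcongr
        exact hexp.trans (by gcongr)
    _ < ε := by
        have : κ * T ^ 2 * M ≤ κ * ((M + 1) * (T ^ 2 + 1)) := by
          rw [mul_assoc]
          exact mul_le_mul_of_nonneg_left (by nlinarith [sq_nonneg T]) hκpos.le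
        linarith

/-- The local density converges uniformly to a Gaussian profile. -/
theorem tendstoUniformly_localDensity (h : LaplaceSetting Θ w E Δ a c I M) :
    TendstoUniformly (fun n => localDensity Θ w (E n) (Δ n) (a n))
      (fun t => w c * Real.exp (-(I / 2) * t ^ 2)) atTop := by
  rw [Metric.tendstoUniformly_iff]
  intro ε hε
  have hM := h.bound_nonneg
  have hI := h.curvature_pos
  obtain ⟨ρ, hρ, hbound⟩ := h.localDensity_le
  have hsq : Tendsto (fun T : ℝ => M * Real.exp (-(I / 4 * T ^ 2))) atTop (𝓝 (M * 0)) :=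
    (Real.tendsto_exp_neg_atTop_nhds_zero.comp
      ((tendsto_pow_atTop two_ne_zero).const_mul_atTop (by linarith : 0 < I / 4))).const_mul M
  rw [mul_zero] at hsq
  obtain ⟨T, hTε, hT0⟩ :=
    ((hsq.eventually_lt_const (half_pos hε)).and (eventually_ge_atTop 0)).exists
  filter_upwards [hbound, h.eventually_abs_sub_lt_of_abs_le T hε,
    (h.tendsto_exp_mul hρ M).eventually_lt_const (half_pos hε)] with n hbound hT hfar t
  rw [Real.dist_eq, abs_sub_comm]
  rcases le_or_gt |t| T with ht | ht
  · exact hT t ht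
  have ht2 : T ^ 2 ≤ t ^ 2 := by
    rw [← sq_abs t]; gcongr
  have hgauss : M * Real.exp (-(I / 4) * t ^ 2) < ε / 2 := by
    refine lt_of_le_of_lt ?_ hTε
    gcongr
    nlinarith
  have hprior : Real.exp (-ρ * Δ n) * Θ.indicator w (a n + t / √(Δ n)) ≤
      Real.exp (-ρ * Δ n) * M := by
    gcongr
    exact indicator_apply_le' (fun _ => h.le_bound _) fun _ => hM
  have h1 := h.localDensity_nonneg n t
  have h2 := hbound t
  have h3 := h.gaussian_le t
  have h4 : 0 ≤ w c * Real.exp (-(I / 2) * t ^ 2) := mul_nonneg (h.nonneg c) (Real.exp_pos _).le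
  rw [abs_lt]
  constructor <;> linarith

/-- Laplace's method: the normalizing constants converge. -/
theorem tendsto_integral_localDensity (h : LaplaceSetting Θ w E Δ a c I M) :
    Tendsto (fun n => ∫ t, localDensity Θ w (E n) (Δ n) (a n) t) atTop
      (𝓝 (w c * √(2 * Real.pi * I⁻¹))) := by
  have hM := h.bound_nonneg
  have hI := h.curvature_pos
  obtain ⟨ρ, hρ, hbound⟩ := h.localDensity_le
  set L : ℕ → ℝ → ℝ := fun n => localDensity Θ w (E n) (Δ n) (a n)
  set B : ℝ → ℝ := fun t => M * Real.exp (-(I / 4) * t ^ 2)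
  have hBint : Integrable B := (integrable_exp_neg_mul_sq (by linarith)).const_mul M
  have hBnn : ∀ t, 0 ≤ B t := fun t => mul_nonneg hM (Real.exp_pos _).le
  set K : ℕ → ℝ → ℝ := fun n t => min (L n t) (B t) with hK
  have hKm : ∀ n, AEStronglyMeasurable (K n) := fun n =>
    ((h.measurable_localDensity n).min (by fun_prop)).aestronglyMeasurable
  have hKB : ∀ n t, ‖K n t‖ ≤ B t := fun n t => by
    rw [Real.norm_of_nonneg (le_min (h.localDensity_nonneg n t) (hBnn t))]
    exact min_le_right _ _
  have hKlim : Tendsto (fun n => ∫ t, K n t) atTop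
      (𝓝 (∫ t, w c * Real.exp (-(I / 2) * t ^ 2))) := by
    refine tendsto_integral_of_dominated_convergence B hKm hBint
      (fun n => ae_of_all _ (hKB n)) (ae_of_all _ fun t => ?_)
    have := (h.tendstoUniformly_localDensity.tendsto_at t).min
      (tendsto_const_nhds (x := B t))
    rwa [min_eq_left (h.gaussian_le t)] at this
  have hval : ∫ t, w c * Real.exp (-(I / 2) * t ^ 2) = w c * √(2 * Real.pi * I⁻¹) := by
    rw [integral_const_mul, integral_gaussian]
    congr 2
    field_simp
  rw [hval] at hKlim
  have hgap : Tendsto (fun n => (∫ t, L n t) - ∫ t, K n t) atTop (𝓝 0) := by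
    refine tendsto_of_tendsto_of_tendsto_of_le_of_le' tendsto_const_nhds
      (h.tendsto_exp_mul_sqrt hρ (∫ x, Θ.indicator w x)) ?_ ?_ <;>
    filter_upwards [hbound] with n hbound
    all_goals
      have hprior := (h.integrable_prior n).const_mul (Real.exp (-ρ * Δ n))
      have hprior_nn : ∀ t, 0 ≤ Real.exp (-ρ * Δ n) * Θ.indicator w (a n + t / √(Δ n)) :=
        fun t => mul_nonneg (Real.exp_pos _).le (indicator_nonneg (fun x _ => h.nonneg x) _)
      have hKint : Integrable (K n) := hBint.mono' (hKm n) (ae_of_all _ (hKB n))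
      have hLint : Integrable (L n) := (hBint.add hprior).mono'
        (h.measurable_localDensity n).aestronglyMeasurable (ae_of_all _ fun t => by
          rw [Real.norm_of_nonneg (h.localDensity_nonneg n t)]
          exact hbound t)
      rw [← integral_sub hLint hKint]
    · exact integral_nonneg fun t => sub_nonneg.2 (min_le_left _ _)
    · rw [← integral_prior n, ← integral_const_mul]
      refine integral_mono (hLint.sub hKint) hprior fun t => ?_
      rcases min_choice (L n t) (B t) with hmin | hmin
      · simpa [hK, hmin] using hprior_nn t
      · have hle : L n t ≤ B t + Real.exp (-ρ * Δ n) * Θ.indicator w (a n + t / √(Δ n)) :=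
          hbound t
        simp only [hK, hmin]
        linarith
  simpa using hgap.add hKlim

end LaplaceSetting

/-- The D-posterior is the normalized local density of the excess disparity. -/
lemma tPosterior_eq_localDensity_div {G : ℝ → ℝ} {f : ℝ → ℕ → ℝ} {π : ℝ → ℝ} {Θ : Set ℝ}
    (hΘ : MeasurableSet Θ) {Δn : ℝ} (hΔn : 0 < Δn) (q : ℕ → ℝ) (a t : ℝ) :
    tPosterior G f π Θ Δn q a t =
      localDensity Θ π (fun x => disparity G f q x - disparity G f q a) Δn a t /
        ∫ s, localDensity Θ π (fun x => disparity G f q x - disparity G f q a) Δn a s := by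
  set D := disparity G f q with hD
  have hs : √Δn ≠ 0 := (Real.sqrt_pos.2 hΔn).ne'
  have himage : (fun θ => √Δn * (θ - a)) '' Θ = (fun s => a + s / √Δn) ⁻¹' Θ :=
    congrFun (image_eq_preimage_of_inverse (fun θ => by field_simp; ring)
      (fun s => by field_simp; ring)) Θ
  have hpt : ∀ s, ((fun s => a + s / √Δn) ⁻¹' Θ).indicator
      (fun s => Real.exp (-Δn * D (a + s / √Δn)) * π (a + s / √Δn)) s =
        Real.exp (-Δn * D a) * localDensity Θ π (fun x => D x - D a) Δn a s := fun s => by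
    unfold localDensity
    by_cases hsΘ : a + s / √Δn ∈ Θ
    · rw [indicator_of_mem hsΘ,
        indicator_of_mem (show s ∈ (fun s => a + s / √Δn) ⁻¹' Θ from hsΘ), ← mul_assoc,
        ← Real.exp_add]
      congr 2
      ring
    · rw [indicator_of_notMem hsΘ,
        indicator_of_notMem (show s ∉ (fun s => a + s / √Δn) ⁻¹' Θ from hsΘ), mul_zero]
  have hdiv : ∀ (R : Set ℝ) (N : ℝ → ℝ) (Z : ℝ),
      R.indicator (fun s => N s / Z) t = R.indicator N t / Z := fun R N Z => by
    by_cases ht : t ∈ R <;> simp [ht]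
  have hmeas : MeasurableSet ((fun s => a + s / √Δn) ⁻¹' Θ) :=
    (by fun_prop : Measurable fun s => a + s / √Δn) hΘ
  unfold tPosterior
  rw [himage, ← hD, ← integral_indicator hmeas]
  rw [hdiv, integral_congr_ae (ae_of_all _ hpt), hpt, integral_const_mul,
    mul_div_mul_left _ _ (Real.exp_pos _).ne']

/-- Dividing a uniformly convergent sequence by convergent constants, for a bounded limit. -/
lemma TendstoUniformly.div_of_tendsto {α : Type*} {F : ℕ → α → ℝ} {g : α → ℝ} {Z : ℕ → ℝ}
    {A b : ℝ} (hF : TendstoUniformly F g atTop) (hZ : Tendsto Z atTop (𝓝 A)) (hA : 0 < A)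
    (hg : ∀ x, |g x| ≤ b) :
    TendstoUniformly (fun n x => F n x / Z n) (fun x => g x / A) atTop := by
  rw [Metric.tendstoUniformly_iff] at hF ⊢
  intro ε hε
  have hzero : Tendsto (fun n => |(Z n)⁻¹ - A⁻¹| * b) atTop (𝓝 0) := by
    simpa using (((hZ.inv₀ hA.ne').sub_const A⁻¹).abs).mul_const b
  filter_upwards [hF (ε * A / 4) (by positivity), hZ.eventually_const_lt (half_lt_self hA),
    hzero.eventually_lt_const (half_pos hε)] with n hFn hZn hinv x
  have hFx := hFn x
  rw [Real.dist_eq, abs_sub_comm] at hFx ⊢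
  have hZpos : 0 < Z n := by linarith
  calc |F n x / Z n - g x / A| = |(F n x - g x) / Z n + ((Z n)⁻¹ - A⁻¹) * g x| := by
        congr 1; ring
    _ ≤ |F n x - g x| / Z n + |(Z n)⁻¹ - A⁻¹| * |g x| := by
        rw [← abs_mul, ← abs_of_pos hZpos, ← abs_div, abs_of_pos hZpos]
        exact abs_add_le _ _
    _ < ε / 2 + ε / 2 := by
        refine add_lt_add ((div_lt_iff₀ hZpos).2 (by nlinarith)) (lt_of_le_of_lt ?_ hinv)
        exact mul_le_mul_of_nonneg_left (hg x) (abs_nonneg _)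
    _ = ε := add_halves ε

/-- uniform convergence of the rescaled D-posterior density to the
Gaussian density with variance `I^D(θ_p)⁻¹`:
`sup_t |π̄_D^n(t) − φ(t; I^D(θ_p)⁻¹)| → 0`. -/
theorem stmt11
    (Θ : Set ℝ) (hΘ : MeasurableSet Θ)
    (f : ℝ → ℕ → ℝ) (G : ℝ → ℝ) (π : ℝ → ℝ) (Δ : ℕ → ℝ)
    (hΔpos : ∀ n, 0 < Δ n) (hΔ : Tendsto Δ atTop atTop)
    (hG : StrictConvexOn ℝ (Set.Ici (-1 : ℝ)) G)
    (hG3 : ContDiffOn ℝ 3 G (Set.Ici (-1 : ℝ))) (hG0 : G 0 = 0)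
    (hf_pmf : ∀ θ ∈ Θ, (∀ k, 0 ≤ f θ k) ∧ ∑' k, f θ k = 1)
    (p : ℕ → ℝ) (hp : IsPMF p) (qhat : ℕ → ℕ → ℝ) (hqhat : ∀ n, IsPMF (qhat n))
    (hl1 : Tendsto (fun n => ∑' k, |qhat n k - p k|) atTop (𝓝 0))
    (ha : ∃ C > 0, ∀ q₁ q₂ : ℕ → ℝ, IsPMF q₁ → IsPMF q₂ → ∀ θ ∈ Θ,
      |disparity G f q₁ θ - disparity G f q₂ θ| ≤ C * ∑' k, |q₁ k - q₂ k|)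
    (hb : ∀ q : ℕ → ℝ, IsPMF q → ContDiffOn ℝ 2 (disparity G f q) Θ)
    (θp : ℝ) (hθp_int : θp ∈ interior Θ)
    (hθp_min : ∀ θ ∈ Θ, disparity G f p θp ≤ disparity G f p θ)
    (hθp_uniq : ∀ t ∈ Θ, (∀ θ ∈ Θ, disparity G f p t ≤ disparity G f p θ) → t = θp)
    (hI_pos : 0 < iteratedDeriv 2 (disparity G f p) θp)
    (hI_conv : ∀ θseq : ℕ → ℝ, Tendsto θseq atTop (𝓝 θp) →
      Tendsto (fun n => iteratedDeriv 2 (disparity G f (qhat n)) (θseq n)) atTop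
        (𝓝 (iteratedDeriv 2 (disparity G f p) θp)))
    (θhat : ℕ → ℝ) (hθhat_mem : ∀ n, θhat n ∈ Θ)
    (hθhat_min : ∀ n, ∀ θ ∈ Θ, disparity G f (qhat n) (θhat n) ≤ disparity G f (qhat n) θ)
    (hθhat_deriv : ∀ n, deriv (disparity G f (qhat n)) (θhat n) = 0)
    (hθhat_conv : Tendsto θhat atTop (𝓝 θp))
    (hsep : ∀ η > 0, ∃ ρ > 0, ∀ θ ∈ Θ, η < |θ - θp| →
      ρ < disparity G f p θ - disparity G f p θp)
    (hπ_cont : Continuous π) (hπ_nn : ∀ θ, 0 ≤ π θ) (hπ_one : ∫ θ in Θ, π θ = 1)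
    (hπ_mom : Integrable (fun θ => |θ| * π θ) (volume.restrict Θ))
    (hπ_bdd : ∃ M, ∀ x, π x ≤ M)
    (hπ_smooth : ContDiff ℝ 3 π) (hπ3_bdd : ∃ M, ∀ x, |iteratedDeriv 3 π x| ≤ M)
    (hπθp : 0 < π θp) :
    ∀ ε > 0, ∃ N : ℕ, ∀ n ≥ N, ∀ t : ℝ,
      |tPosterior G f π Θ (Δ n) (qhat n) (θhat n) t -
        gaussD (iteratedDeriv 2 (disparity G f p) θp)⁻¹ t| < ε := by
  obtain ⟨M, hM⟩ := hπ_bdd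
  obtain ⟨C, -, hC⟩ := ha
  set I := iteratedDeriv 2 (disparity G f p) θp
  obtain ⟨r, hr, hball⟩ := Metric.mem_nhds_iff.1 (mem_interior_iff_mem_nhds.1 hθp_int)
  have hsetting : LaplaceSetting Θ π
      (fun n x => disparity G f (qhat n) x - disparity G f (qhat n) (θhat n)) Δ θhat θp I M := by
    refine ⟨hΘ, mem_interior_iff_mem_nhds.1 hθp_int, hπ_cont, hπ_nn, hM,
      Integrable.of_integral_ne_zero (by rw [hπ_one]; exact one_ne_zero),
      fun n => (hb _ (hqhat n)).continuousOn.sub continuousOn_const, hΔpos, hΔ, hθhat_conv,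
      hI_pos, fun ε hε => ?_, fun η hη => ?_⟩
    · have hunif := Metric.tendsto_nhds.1 (tendsto_uncurry_atTop_prod_nhds hI_conv) ε hε
      obtain ⟨P, hP, Q, hQ, hPQ⟩ := eventually_prod_iff.1 hunif
      obtain ⟨δ, hδ, hδQ⟩ := Metric.eventually_nhds_iff_ball.1 hQ
      have hmin : 0 < min δ r := lt_min hδ hr
      refine ⟨min δ r, hmin, ?_⟩
      filter_upwards [hP, hθhat_conv (Metric.ball_mem_nhds θp hmin)] with n hPn hn x hx
      refine abs_sub_sub_quadratic_le Metric.isOpen_ball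
        ((hb _ (hqhat n)).mono hball) (Metric.ball_subset_ball (min_le_right δ r))
        (convex_ball θp _) hn (by rwa [Metric.mem_ball, Real.dist_eq]) (hθhat_deriv n)
        fun y hy => ?_
      have := hPQ hPn (hδQ y (Metric.ball_subset_ball (min_le_left δ r) hy))
      rw [Real.dist_eq] at this
      exact this.le
    · obtain ⟨ρ, hρ, hsepρ⟩ := hsep η hη
      refine ⟨ρ / 2, half_pos hρ, ?_⟩
      have hsmall : Tendsto (fun n => C * ∑' k, |qhat n k - p k|) atTop (𝓝 0) := by
        simpa using hl1.const_mul C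
      filter_upwards [hsmall.eventually_lt_const (by positivity : 0 < ρ / 4)] with n hn x hx hηx
      have h1 := (abs_le.1 (hC _ _ (hqhat n) hp x hx)).1
      have h2 := (abs_le.1 (hC _ _ (hqhat n) hp θp (interior_subset hθp_int))).2
      have h3 := hθhat_min n θp (interior_subset hθp_int)
      have h4 := hsepρ x hx hηx
      linarith
  have hA : 0 < π θp * √(2 * Real.pi * I⁻¹) :=
    mul_pos hπθp (Real.sqrt_pos.2 (by positivity))
  have hlim := hsetting.tendstoUniformly_localDensity.div_of_tendsto
    hsetting.tendsto_integral_localDensity hA (b := π θp) fun t => by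
      rw [abs_of_nonneg (mul_nonneg hπθp.le (Real.exp_pos _).le)]
      exact mul_le_of_le_one_right hπθp.le
        (Real.exp_le_one_iff.2 (by nlinarith [sq_nonneg t]))
  intro ε hε
  obtain ⟨N, hN⟩ := eventually_atTop.1 (Metric.tendstoUniformly_iff.1 hlim ε hε)
  refine ⟨N, fun n hn t => ?_⟩
  have hgauss : gaussD I⁻¹ t =
      π θp * Real.exp (-(I / 2) * t ^ 2) / (π θp * √(2 * Real.pi * I⁻¹)) := by
    have hexp : -(t ^ 2) / (2 * I⁻¹) = -(I / 2) * t ^ 2 := by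
      rw [← div_eq_mul_inv, div_div_eq_mul_div]
      ring
    rw [mul_div_mul_left _ _ hπθp.ne', gaussD, hexp, ← div_eq_inv_mul]
  rw [tPosterior_eq_localDensity_div hΘ (hΔpos n), hgauss, abs_sub_comm, ← Real.dist_eq]
  exact hN n hn t
end

section
/- In the asymptotic setting described in the context, assume additionally that Θ is complete and separable, π is bounded, thrice differentiable with bounded third derivative, π(θ_p) > 0, and that there is n₀ such that for every n ≥ n₀: there exist a compact set C_n ⊆ Θ and θ⁺ ∈ C_n with inf_{θ∈Θ∖C_n} (Δ_n D(q̂_n,θ) − log π(θ)) > Δ_n D(q̂_n,θ⁺) − log π(θ⁺), and the minimizer θ_n^{+D} of θ ↦ Δ_n D(q̂_n,θ) − log π(θ) over Θ (the MDAP estimator) is unique. Then Δ_n^{1/2} (θ_n^{+D} − θ̂_n) → 0 as n → ∞; i.e., the MDAP estimator mimics the minimum disparity estimator at rate Δ_n^{1/2}. -/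
open MeasureTheory Filter Topology Set

/-- Second-order Taylor formula with Lagrange remainder around a critical point. -/
theorem exists_mem_uIcc_sub_eq_of_deriv_eq_zero {g : ℝ → ℝ} {U : Set ℝ} (hU : IsOpen U)
    (hg : ContDiffOn ℝ 2 g U) {a b : ℝ} (hab : uIcc a b ⊆ U) (hd : deriv g a = 0) :
    ∃ ξ ∈ uIcc a b, g b - g a = iteratedDeriv 2 g ξ * (b - a) ^ 2 / 2 := by
  rcases eq_or_ne a b with rfl | hne
  · exact ⟨a, left_mem_uIcc, by simp⟩
  obtain ⟨ξ, hξ, h⟩ := taylor_mean_remainder_lagrange_iteratedDeriv (n := 1) hne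
    (by simpa [one_add_one_eq_two] using hg.mono hab)
  refine ⟨ξ, Ioo_subset_Icc_self hξ, ?_⟩
  have hdiff : DifferentiableAt ℝ g a :=
    (hg.contDiffAt (hU.mem_nhds (hab left_mem_uIcc))).differentiableAt (by norm_num)
  have hdw : derivWithin g (uIcc a b) a = 0 := by
    rw [hdiff.derivWithin (uniqueDiffOn_uIcc hne a left_mem_uIcc), hd]
  simpa [taylorWithinEval_succ, iteratedDerivWithin_one, hdw] using h

/-- If the second derivatives of `D n` converge continuously at `θ₀` to a positive limit, and
`a n → θ₀` are critical points of `D n`, then along any `b n → θ₀` the increment of `D n` between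
`a n` and `b n` eventually dominates a multiple of `(b n - a n) ^ 2`. -/
theorem eventually_mul_sq_le_sub_of_tendsto_iteratedDeriv_two {D : ℕ → ℝ → ℝ} {U : Set ℝ}
    {θ₀ I : ℝ} (hU : U ∈ 𝓝 θ₀) (hD : ∀ n, ContDiffOn ℝ 2 (D n) U) (hI : 0 < I)
    (hconv : ∀ ξ : ℕ → ℝ, Tendsto ξ atTop (𝓝 θ₀) →
      Tendsto (fun n => iteratedDeriv 2 (D n) (ξ n)) atTop (𝓝 I))
    {a b : ℕ → ℝ} (ha : Tendsto a atTop (𝓝 θ₀)) (hb : Tendsto b atTop (𝓝 θ₀))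
    (hda : ∀ n, deriv (D n) (a n) = 0) :
    ∀ᶠ n in atTop, I / 4 * (b n - a n) ^ 2 ≤ D n (b n) - D n (a n) := by
  obtain ⟨r, hr, hrU⟩ := Metric.mem_nhds_iff.1 hU
  have hball : ∀ᶠ n in atTop, uIcc (a n) (b n) ⊆ Metric.ball θ₀ r := by
    filter_upwards [ha (Metric.ball_mem_nhds θ₀ hr), hb (Metric.ball_mem_nhds θ₀ hr)] with n h₁ h₂
    exact (convex_ball θ₀ r).ordConnected.uIcc_subset h₁ h₂
  have hex : ∀ n, ∃ ξ ∈ uIcc (a n) (b n), uIcc (a n) (b n) ⊆ Metric.ball θ₀ r →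
      D n (b n) - D n (a n) = iteratedDeriv 2 (D n) ξ * (b n - a n) ^ 2 / 2 := by
    intro n
    by_cases h : uIcc (a n) (b n) ⊆ Metric.ball θ₀ r
    · obtain ⟨ξ, hξ, h'⟩ := exists_mem_uIcc_sub_eq_of_deriv_eq_zero Metric.isOpen_ball
        ((hD n).mono hrU) h (hda n)
      exact ⟨ξ, hξ, fun _ => h'⟩
    · exact ⟨a n, left_mem_uIcc, fun h' => absurd h' h⟩
  choose ξ hξ hξD using hex
  have hξθ : Tendsto ξ atTop (𝓝 θ₀) := by
    have hmin : Tendsto (fun n => min (a n) (b n)) atTop (𝓝 θ₀) := by simpa using ha.min hb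
    have hmax : Tendsto (fun n => max (a n) (b n)) atTop (𝓝 θ₀) := by simpa using ha.max hb
    exact tendsto_of_tendsto_of_tendsto_of_le_of_le hmin hmax (fun n => (hξ n).1)
      (fun n => (hξ n).2)
  filter_upwards [hball, (hconv ξ hξθ).eventually (lt_mem_nhds (half_lt_self hI))] with n h₁ h₂
  rw [hξD n h₁]
  nlinarith [mul_le_mul_of_nonneg_right h₂.le (sq_nonneg (b n - a n))]

/-- Near-minimizers of uniformly convergent functions converge to a well-separated minimizer. -/
theorem tendsto_of_well_separated_of_near_min {Θ : Set ℝ} {F : ℝ → ℝ} {D : ℕ → ℝ → ℝ}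
    {θ₀ : ℝ} {ε κ : ℕ → ℝ} {a b : ℕ → ℝ} (hθ₀ : θ₀ ∈ Θ)
    (hunif : ∀ n, ∀ θ ∈ Θ, |D n θ - F θ| ≤ ε n) (hε : Tendsto ε atTop (𝓝 0))
    (hsep : ∀ η > 0, ∃ ρ > 0, ∀ θ ∈ Θ, η < |θ - θ₀| → ρ < F θ - F θ₀)
    (ha : ∀ n, ∀ θ ∈ Θ, D n (a n) ≤ D n θ) (hb : ∀ᶠ n in atTop, b n ∈ Θ)
    (hab : ∀ᶠ n in atTop, D n (b n) - D n (a n) ≤ κ n) (hκ : Tendsto κ atTop (𝓝 0)) :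
    Tendsto b atTop (𝓝 θ₀) := by
  rw [Metric.tendsto_nhds]
  intro η hη
  obtain ⟨ρ, hρ, hsepρ⟩ := hsep (η / 2) (half_pos hη)
  have hsum : Tendsto (fun n => κ n + 2 * ε n) atTop (𝓝 0) := by
    simpa using hκ.add (hε.const_mul 2)
  filter_upwards [hb, hab, hsum.eventually (gt_mem_nhds hρ)] with n hbn habn hn
  rw [Real.dist_eq]
  by_contra! hfar
  have h₁ := hsepρ (b n) hbn (by linarith)
  have h₂ := abs_le.1 (hunif n (b n) hbn)
  have h₃ := abs_le.1 (hunif n θ₀ hθ₀)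
  linarith [ha n θ₀ hθ₀]

/-- the MDAP estimator mimics the minimum disparity estimator at rate
`Δ_n^{1/2}`: `Δ_n^{1/2}(θ_n^{+D} − θ̂_n) → 0`. -/
theorem stmt12
    (Θ : Set ℝ) (hΘ : MeasurableSet Θ)
    (f : ℝ → ℕ → ℝ) (G : ℝ → ℝ) (π : ℝ → ℝ) (Δ : ℕ → ℝ)
    (hΔpos : ∀ n, 0 < Δ n) (hΔ : Tendsto Δ atTop atTop)
    (hG : StrictConvexOn ℝ (Set.Ici (-1 : ℝ)) G)
    (hG3 : ContDiffOn ℝ 3 G (Set.Ici (-1 : ℝ))) (hG0 : G 0 = 0)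
    (hf_pmf : ∀ θ ∈ Θ, (∀ k, 0 ≤ f θ k) ∧ ∑' k, f θ k = 1)
    (p : ℕ → ℝ) (hp : IsPMF p) (qhat : ℕ → ℕ → ℝ) (hqhat : ∀ n, IsPMF (qhat n))
    (hl1 : Tendsto (fun n => ∑' k, |qhat n k - p k|) atTop (𝓝 0))
    (ha : ∃ C > 0, ∀ q₁ q₂ : ℕ → ℝ, IsPMF q₁ → IsPMF q₂ → ∀ θ ∈ Θ,
      |disparity G f q₁ θ - disparity G f q₂ θ| ≤ C * ∑' k, |q₁ k - q₂ k|)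
    (hb : ∀ q : ℕ → ℝ, IsPMF q → ContDiffOn ℝ 2 (disparity G f q) Θ)
    (θp : ℝ) (hθp_int : θp ∈ interior Θ)
    (hθp_min : ∀ θ ∈ Θ, disparity G f p θp ≤ disparity G f p θ)
    (hθp_uniq : ∀ t ∈ Θ, (∀ θ ∈ Θ, disparity G f p t ≤ disparity G f p θ) → t = θp)
    (hI_pos : 0 < iteratedDeriv 2 (disparity G f p) θp)
    (hI_conv : ∀ θseq : ℕ → ℝ, Tendsto θseq atTop (𝓝 θp) →
      Tendsto (fun n => iteratedDeriv 2 (disparity G f (qhat n)) (θseq n)) atTop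
        (𝓝 (iteratedDeriv 2 (disparity G f p) θp)))
    (θhat : ℕ → ℝ) (hθhat_mem : ∀ n, θhat n ∈ Θ)
    (hθhat_min : ∀ n, ∀ θ ∈ Θ, disparity G f (qhat n) (θhat n) ≤ disparity G f (qhat n) θ)
    (hθhat_deriv : ∀ n, deriv (disparity G f (qhat n)) (θhat n) = 0)
    (hθhat_conv : Tendsto θhat atTop (𝓝 θp))
    (hsep : ∀ η > 0, ∃ ρ > 0, ∀ θ ∈ Θ, η < |θ - θp| →
      ρ < disparity G f p θ - disparity G f p θp)
    (hπ_cont : Continuous π) (hπ_nn : ∀ θ, 0 ≤ π θ) (hπ_one : ∫ θ in Θ, π θ = 1)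
    (hπ_mom : Integrable (fun θ => |θ| * π θ) (volume.restrict Θ))
    (hΘclosed : IsClosed Θ)
    (hπ_bdd : ∃ M, ∀ x, π x ≤ M)
    (hπ_smooth : ContDiff ℝ 3 π) (hπ3_bdd : ∃ M, ∀ x, |iteratedDeriv 3 π x| ≤ M)
    (hπθp : 0 < π θp)
    (θplus : ℕ → ℝ) (n₀ : ℕ)
    (hcoer : ∀ n ≥ n₀, ∃ C : Set ℝ, C ⊆ Θ ∧ IsCompact C ∧ ∃ θC ∈ C, ∃ ε > 0,
      ∀ θ ∈ Θ \ C, mdapObj G f π (Δ n) (qhat n) θC + ε ≤ mdapObj G f π (Δ n) (qhat n) θ)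
    (hθplus_mem : ∀ n ≥ n₀, θplus n ∈ Θ)
    (hθplus_min : ∀ n ≥ n₀, ∀ θ ∈ Θ,
      mdapObj G f π (Δ n) (qhat n) (θplus n) ≤ mdapObj G f π (Δ n) (qhat n) θ)
    (hθplus_uniq : ∀ n ≥ n₀, ∀ t ∈ Θ,
      (∀ θ ∈ Θ, mdapObj G f π (Δ n) (qhat n) t ≤ mdapObj G f π (Δ n) (qhat n) θ) →
      t = θplus n) :
    Tendsto (fun n => Real.sqrt (Δ n) * (θplus n - θhat n)) atTop (𝓝 0) := by
  obtain ⟨K, hK, hlip⟩ := ha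
  obtain ⟨M, hM⟩ := hπ_bdd
  have hlog_hat : Tendsto (fun n => Real.log (π (θhat n))) atTop (𝓝 (Real.log (π θp))) :=
    ((hπ_cont.tendsto θp).comp hθhat_conv).log hπθp.ne'
  have hgap : ∀ᶠ n in atTop,
      Δ n * (disparity G f (qhat n) (θplus n) - disparity G f (qhat n) (θhat n)) ≤
        Real.log (π (θplus n)) - Real.log (π (θhat n)) := by
    filter_upwards [eventually_ge_atTop n₀] with n hn
    have h := hθplus_min n hn (θhat n) (hθhat_mem n)
    simp only [mdapObj] at h
    linarith
  have hplus_conv : Tendsto θplus atTop (𝓝 θp) := by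
    refine tendsto_of_well_separated_of_near_min (D := fun n => disparity G f (qhat n))
      (ε := fun n => K * ∑' k, |qhat n k - p k|)
      (κ := fun n => (M - Real.log (π (θhat n))) / Δ n) (interior_subset hθp_int)
      (fun n => hlip (qhat n) p (hqhat n) hp) (by simpa using hl1.const_mul K) hsep hθhat_min
      ((eventually_ge_atTop n₀).mono hθplus_mem) ?_
      ((tendsto_const_nhds.sub hlog_hat).div_atTop hΔ)
    filter_upwards [hgap] with n hn
    rw [le_div_iff₀' (hΔpos n)]
    linarith [Real.log_le_self (hπ_nn (θplus n)), hM (θplus n)]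
  have hlog_plus : Tendsto (fun n => Real.log (π (θplus n))) atTop (𝓝 (Real.log (π θp))) :=
    ((hπ_cont.tendsto θp).comp hplus_conv).log hπθp.ne'
  have hquad := eventually_mul_sq_le_sub_of_tendsto_iteratedDeriv_two
    (mem_interior_iff_mem_nhds.1 hθp_int) (fun n => hb (qhat n) (hqhat n)) hI_pos hI_conv
    hθhat_conv hplus_conv hθhat_deriv
  set I := iteratedDeriv 2 (disparity G f p) θp
  have hsq : Tendsto (fun n => (√(Δ n) * (θplus n - θhat n)) ^ 2) atTop (𝓝 0) := by
    have hbound : Tendsto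
        (fun n => (Real.log (π (θplus n)) - Real.log (π (θhat n))) / (I / 4)) atTop (𝓝 0) := by
      simpa using (hlog_plus.sub hlog_hat).div_const (I / 4)
    refine tendsto_of_tendsto_of_tendsto_of_le_of_le' tendsto_const_nhds hbound
      (Eventually.of_forall fun n => sq_nonneg _) ?_
    filter_upwards [hgap, hquad] with n h₁ h₂
    rw [le_div_iff₀ (by positivity), mul_pow, Real.sq_sqrt (hΔpos n).le]
    linarith [mul_le_mul_of_nonneg_left h₂ (hΔpos n).le]
  rw [tendsto_zero_iff_abs_tendsto_zero]
  simpa [Function.comp_def, Real.sqrt_sq_eq_abs] using hsq.sqrt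
end

section
/- Fix α ∈ (0,1) and L ∈ ℕ, let p = p(θ₀) for some θ₀ ∈ Θ, and let p^{α,L} = (1−α)p + α η_L, where η_L is the point mass at L. Let (Δ_n) be positive reals with Δ_n → ∞, and assume π is thrice differentiable with bounded third derivative and ∫_Θ |θ| π(θ) dθ < ∞. Suppose both q = p and q = p^{α,L} satisfy: T(q) exists, is the unique minimizer of D(q,·), lies in the interior of Θ, π(T(q)) > 0; D(q,·) is twice continuously differentiable with ∂²_θ D(q,θ)|_{θ=T(q)} > 0; and for every η > 0 there is ρ > 0 with inf_{|θ−T(q)|>η} D(q,θ) − D(q,T(q)) > ρ. Then the α-influence function of the EDAP function approximates that of the minimum disparity functional at rate o(Δ_n^{−1/2}): Δ_n^{1/2} · ( α^{−1}[T̄_{Δ_n}(p^{α,L}) − T̄_{Δ_n}(p)] − α^{−1}[T(p^{α,L}) − T(p)] ) → 0 as n → ∞. -/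
open MeasureTheory Filter Topology Set

/-- Gross-error contamination `(1−α)p + α η_L` with `η_L` the point mass at `L`. -/
noncomputable def contam (p : ℕ → ℝ) (α : ℝ) (L : ℕ) : ℕ → ℝ :=
  fun k => (1 - α) * p k + α * (if k = L then 1 else 0)

lemma tendsto_sub_div_sq_of_deriv_eq_zero {D : ℝ → ℝ} {t : ℝ} (hD : ContDiffAt ℝ 2 D t)
    (h0 : deriv D t = 0) :
    Tendsto (fun x => (D x - D t) / (x - t) ^ 2) (𝓝[≠] t) (𝓝 (iteratedDeriv 2 D t / 2)) := by
  have hev : ∀ᶠ x in 𝓝 t, ContDiffAt ℝ 2 D x := hD.eventually (by simp)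
  have hdd : DifferentiableAt ℝ (deriv D) t :=
    (hD.derivWithin (m := 1) (by norm_num)).differentiableAt (by simp)
  have hslope : Tendsto (fun x => deriv D x / (x - t)) (𝓝[≠] t) (𝓝 (iteratedDeriv 2 D t)) := by
    have h := hasDerivAt_iff_tendsto_slope.mp hdd.hasDerivAt
    rw [iteratedDeriv_succ, iteratedDeriv_one]
    refine h.congr fun x => ?_
    rw [slope_def_field, h0, sub_zero]
  refine HasDerivAt.lhopital_zero_nhdsNE (f' := deriv D) (g' := fun x => 2 * (x - t)) ?_ ?_ ?_ ?_ ?_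
    ?_
  · filter_upwards [hev.filter_mono nhdsWithin_le_nhds] with x hx
    exact (hx.differentiableAt (by simp)).hasDerivAt.sub_const _
  · refine Eventually.of_forall fun x => ?_
    convert! ((hasDerivAt_id' x).sub_const t).pow 2 using 1
    simp
  · filter_upwards [self_mem_nhdsWithin] with x hx
    exact mul_ne_zero two_ne_zero (sub_ne_zero.mpr hx)
  · have h : Tendsto (fun x => D x - D t) (𝓝 t) (𝓝 (D t - D t)) :=
      hD.continuousAt.tendsto.sub_const _
    rw [sub_self] at h
    exact h.mono_left nhdsWithin_le_nhds
  · have h : Tendsto (fun x => (x - t) ^ 2) (𝓝 t) (𝓝 ((t - t) ^ 2)) := by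
      apply Continuous.tendsto
      fun_prop
    rw [sub_self, zero_pow two_ne_zero] at h
    exact h.mono_left nhdsWithin_le_nhds
  · refine (hslope.div_const 2).congr fun x => ?_
    rw [div_div, mul_comm]

lemma integrable_abs_pow_mul_exp_neg_mul_sq {c : ℝ} (hc : 0 < c) (k : ℕ) :
    Integrable fun x : ℝ => |x| ^ k * Real.exp (-c * x ^ 2) := by
  have h := (integrable_rpow_mul_exp_neg_mul_sq hc (s := k)
    (by linarith [k.cast_nonneg (α := ℝ)])).norm
  simpa [abs_pow, abs_of_pos (Real.exp_pos _)] using h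

/-- Rescaling an integral over a ball around `t` by a factor `s`. -/
lemma pow_mul_setIntegral_closedBall (h : ℝ → ℝ) (t η : ℝ) {s : ℝ} (hs : 0 < s) (k : ℕ) :
    s ^ (k + 1) * ∫ θ in Metric.closedBall t η, (θ - t) ^ k * h θ =
      ∫ u, u ^ k * (Metric.closedBall t η).indicator h (t + s⁻¹ * u) := by
  have h1 : ∫ θ in Metric.closedBall t η, (θ - t) ^ k * h θ =
      ∫ v, v ^ k * (Metric.closedBall t η).indicator h (t + v) := by
    rw [← integral_indicator Metric.isClosed_closedBall.measurableSet, ← integral_add_left_eq_self _ t]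
    congr 1 with v
    by_cases hv : t + v ∈ Metric.closedBall t η
    · simp [hv, indicator_of_mem]
    · simp only [indicator_of_notMem hv, mul_zero]
  have h2 := Measure.integral_comp_mul_left
    (fun v => v ^ k * (Metric.closedBall t η).indicator h (t + v)) s⁻¹
  rw [inv_inv, abs_of_pos hs, smul_eq_mul] at h2
  rw [h1, pow_succ, mul_assoc, ← h2, ← integral_const_mul]
  congr 1 with u
  rw [mul_pow, ← mul_assoc, ← mul_assoc, ← mul_pow, mul_inv_cancel₀ hs.ne', one_pow, one_mul]

/-- Laplace asymptotics of the `k`-th central moment over a ball around the minimizer. -/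
lemma tendsto_laplace_closedBall {E w : ℝ → ℝ} {t η a c : ℝ} (hη : 0 < η) (hc : 0 < c)
    (hE : ContinuousOn E (Metric.closedBall t η)) (hw : Continuous w)
    (hEc : ∀ θ ∈ Metric.closedBall t η, c * (θ - t) ^ 2 ≤ E θ)
    (hEa : Tendsto (fun θ => E θ / (θ - t) ^ 2) (𝓝[≠] t) (𝓝 a))
    {s : ℕ → ℝ} (hs : ∀ n, 0 < s n) (hs' : Tendsto s atTop atTop) (k : ℕ) :
    Tendsto (fun n => s n ^ (k + 1) *
        ∫ θ in Metric.closedBall t η, (θ - t) ^ k * (Real.exp (-(s n ^ 2) * E θ) * w θ))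
      atTop (𝓝 (∫ u, u ^ k * (Real.exp (-a * u ^ 2) * w t))) := by
  obtain ⟨M, hM⟩ := (isCompact_closedBall t η).exists_bound_of_continuousOn hw.continuousOn
  simp_rw [fun n => pow_mul_setIntegral_closedBall
    (fun θ => Real.exp (-(s n ^ 2) * E θ) * w θ) t η (hs n) k]
  have hinv : Tendsto (fun n => (s n)⁻¹) atTop (𝓝 0) := tendsto_inv_atTop_zero.comp hs'
  refine tendsto_integral_filter_of_dominated_convergence
    (fun u => M * (|u| ^ k * Real.exp (-c * u ^ 2))) ?_ ?_
    ((integrable_abs_pow_mul_exp_neg_mul_sq hc k).const_mul M) ?_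
  · refine Eventually.of_forall fun n => Measurable.aestronglyMeasurable ?_
    have hm : Measurable ((Metric.closedBall t η).indicator
        fun θ => Real.exp (-(s n ^ 2) * E θ) * w θ) := by
      classical
      rw [← piecewise_eq_indicator]
      refine ContinuousOn.measurable_piecewise ?_ continuousOn_const
        Metric.isClosed_closedBall.measurableSet
      exact (hE.const_mul _).rexp.mul hw.continuousOn
    exact (by fun_prop : Measurable fun u : ℝ => u ^ k).mul
      (hm.comp (by fun_prop : Measurable fun u : ℝ => t + (s n)⁻¹ * u))
  · refine Eventually.of_forall fun n => Eventually.of_forall fun u => ?_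
    rw [norm_mul, norm_pow, Real.norm_eq_abs u, mul_left_comm]
    refine mul_le_mul_of_nonneg_left ?_ (by positivity)
    by_cases hu : t + (s n)⁻¹ * u ∈ Metric.closedBall t η
    · rw [indicator_of_mem hu, norm_mul, Real.norm_of_nonneg (Real.exp_pos _).le, mul_comm]
      refine mul_le_mul (hM _ hu) (Real.exp_le_exp.mpr ?_) (Real.exp_pos _).le
        ((norm_nonneg _).trans (hM _ hu))
      have h := mul_le_mul_of_nonneg_left (hEc _ hu) (sq_nonneg (s n))
      have h' : s n ^ 2 * (c * (t + (s n)⁻¹ * u - t) ^ 2) = c * u ^ 2 := by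
        have := (hs n).ne'
        field_simp
        ring
      linarith
    · rw [indicator_of_notMem hu, norm_zero]
      exact mul_nonneg ((norm_nonneg _).trans (hM t (Metric.mem_closedBall_self hη.le)))
        (Real.exp_pos _).le
  · have hne : ∀ᵐ u : ℝ, u ≠ 0 := by simp [ae_iff]
    filter_upwards [hne] with u hu
    refine Tendsto.const_mul _ ?_
    have hlim : Tendsto (fun n => t + (s n)⁻¹ * u) atTop (𝓝 t) := by
      simpa using (hinv.mul_const u).const_add t
    have hlim' : Tendsto (fun n => t + (s n)⁻¹ * u) atTop (𝓝[≠] t) := by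
      refine tendsto_nhdsWithin_iff.mpr ⟨hlim, Eventually.of_forall fun n => ?_⟩
      simp [(hs n).ne', hu]
    have hexp : Tendsto (fun n => Real.exp (-(E (t + (s n)⁻¹ * u) /
        (t + (s n)⁻¹ * u - t) ^ 2) * u ^ 2) * w (t + (s n)⁻¹ * u)) atTop
        (𝓝 (Real.exp (-a * u ^ 2) * w t)) :=
      (Real.continuous_exp.tendsto _).comp (((hEa.comp hlim').neg).mul_const _) |>.mul
        ((hw.tendsto t).comp hlim)
    refine hexp.congr' ?_
    filter_upwards [hlim.eventually (Metric.closedBall_mem_nhds t hη)] with n hn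
    rw [indicator_of_mem (show _ ∈ Metric.closedBall t η from hn)]
    congr 2
    have := (hs n).ne'
    rw [add_sub_cancel_left]
    field_simp

/-- Laplace asymptotics of the `k`-th central moment over a general domain. -/
lemma tendsto_laplace_moment {Θ : Set ℝ} (hΘ : MeasurableSet Θ) {E w : ℝ → ℝ} {t a : ℝ}
    (ht : Θ ∈ 𝓝 t) (ha : 0 < a) (hEΘ : ContinuousOn E Θ) (hw : Continuous w)
    (hE0 : E t = 0) (hEnn : ∀ θ ∈ Θ, 0 ≤ E θ)
    (hEa : Tendsto (fun θ => E θ / (θ - t) ^ 2) (𝓝[≠] t) (𝓝 a))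
    (hsep : ∀ η > 0, ∃ ρ > 0, ∀ θ ∈ Θ, η < |θ - t| → ρ < E θ)
    {s : ℕ → ℝ} (hs : ∀ n, 0 < s n) (hs' : Tendsto s atTop atTop) (k : ℕ)
    (hint : IntegrableOn (fun θ => (θ - t) ^ k * w θ) Θ) :
    (∀ n, IntegrableOn (fun θ => (θ - t) ^ k * (Real.exp (-(s n ^ 2) * E θ) * w θ)) Θ) ∧
    Tendsto (fun n => s n ^ (k + 1) *
        ∫ θ in Θ, (θ - t) ^ k * (Real.exp (-(s n ^ 2) * E θ) * w θ))
      atTop (𝓝 (∫ u, u ^ k * (Real.exp (-a * u ^ 2) * w t))) := by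
  obtain ⟨η, hη, hηΘ, hηc⟩ : ∃ η > 0, Metric.closedBall t η ⊆ Θ ∧
      ∀ θ ∈ Metric.closedBall t η, a / 2 * (θ - t) ^ 2 ≤ E θ := by
    have hev : ∀ᶠ θ in 𝓝[≠] t, a / 2 < E θ / (θ - t) ^ 2 :=
      hEa.eventually (lt_mem_nhds (half_lt_self ha))
    have hev' := (eventually_nhdsWithin_iff.mp hev).and ht
    obtain ⟨η, hη, h⟩ := Metric.nhds_basis_closedBall.eventually_iff.mp hev'
    refine ⟨η, hη, fun θ hθ => (h hθ).2, fun θ hθ => ?_⟩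
    rcases eq_or_ne θ t with rfl | hne
    · simp [hE0]
    · have hpos : 0 < (θ - t) ^ 2 := by have := sub_ne_zero.mpr hne; positivity
      exact ((lt_div_iff₀ hpos).mp ((h hθ).1 hne)).le
  have hbound : ∀ n, ∀ θ ∈ Θ, ‖(θ - t) ^ k * (Real.exp (-(s n ^ 2) * E θ) * w θ)‖ ≤
      ‖(θ - t) ^ k * w θ‖ := fun n θ hθ => by
    rw [norm_mul, norm_mul, norm_mul, Real.norm_of_nonneg (Real.exp_pos _).le]
    refine mul_le_mul_of_nonneg_left (mul_le_of_le_one_left (norm_nonneg _) ?_) (norm_nonneg _)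
    rw [Real.exp_le_one_iff, neg_mul, neg_nonpos]
    exact mul_nonneg (sq_nonneg _) (hEnn θ hθ)
  have hI : ∀ n, IntegrableOn
      (fun θ => (θ - t) ^ k * (Real.exp (-(s n ^ 2) * E θ) * w θ)) Θ := fun n => by
    refine Integrable.mono hint ?_ ((ae_restrict_iff' hΘ).mpr (Eventually.of_forall (hbound n)))
    refine ContinuousOn.aestronglyMeasurable ?_ hΘ
    exact ContinuousOn.mul (by fun_prop) ((hEΘ.const_mul _).rexp.mul hw.continuousOn)
  refine ⟨hI, ?_⟩
  obtain ⟨ρ, hρ, hρE⟩ := hsep η hη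
  set B := Metric.closedBall t η with hB
  have hBm : MeasurableSet B := Metric.isClosed_closedBall.measurableSet
  have hnear := tendsto_laplace_closedBall hη (half_pos ha) (hEΘ.mono hηΘ) hw hηc hEa hs hs' k
  have hfar : Tendsto (fun n => s n ^ (k + 1) *
      ∫ θ in Θ \ B, (θ - t) ^ k * (Real.exp (-(s n ^ 2) * E θ) * w θ)) atTop (𝓝 0) := by
    have hlim : Tendsto (fun n => s n ^ (k + 1) * Real.exp (-ρ * s n) *
        ∫ θ in Θ \ B, ‖(θ - t) ^ k * w θ‖) atTop (𝓝 0) := by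
      have h := (tendsto_rpow_mul_exp_neg_mul_atTop_nhds_zero ((k + 1 : ℕ) : ℝ) ρ hρ).comp hs'
      simp only [Function.comp_def, Real.rpow_natCast] at h
      simpa using h.mul_const (∫ θ in Θ \ B, ‖(θ - t) ^ k * w θ‖)
    refine squeeze_zero_norm' ?_ hlim
    filter_upwards [hs'.eventually_ge_atTop 1] with n hn
    rw [norm_mul, Real.norm_of_nonneg (pow_pos (hs n) _).le, mul_assoc, ← integral_const_mul]
    refine mul_le_mul_of_nonneg_left ?_ (pow_pos (hs n) _).le
    refine norm_integral_le_of_norm_le ((hint.mono_set sdiff_subset).norm.const_mul _) ?_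
    refine (ae_restrict_iff' (hΘ.diff hBm)).mpr (Eventually.of_forall fun θ hθ => ?_)
    rw [norm_mul, norm_mul, norm_mul, Real.norm_of_nonneg (Real.exp_pos _).le, mul_left_comm]
    refine mul_le_mul_of_nonneg_right (Real.exp_le_exp.mpr ?_) (by positivity)
    have hθE := hρE θ hθ.1 (by simpa [hB, Real.dist_eq] using hθ.2)
    nlinarith [mul_le_mul_of_nonneg_right hn (hs n).le, hs n]
  have hsum := hnear.add hfar
  rw [add_zero] at hsum
  refine hsum.congr fun n => ?_
  rw [← mul_add, setIntegral_sdiff hBm (hI n) hηΘ, add_sub_cancel]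

/-- The EDAP value approximates the minimizer of the disparity at rate `o(Δ ^ (-1/2))`. -/
lemma tendsto_sqrt_mul_edap_sub {Θ : Set ℝ} (hΘ : MeasurableSet Θ)
    {f : ℝ → ℕ → ℝ} {G π : ℝ → ℝ} {Δ : ℕ → ℝ} (hΔpos : ∀ n, 0 < Δ n)
    (hΔ : Tendsto Δ atTop atTop) (hπ_int : IntegrableOn π Θ)
    (hπ_cont : Continuous π) (hπ_mom : IntegrableOn (fun θ => |θ| * π θ) Θ)
    {q : ℕ → ℝ} {t : ℝ} (ht : t ∈ interior Θ)
    (hmin : ∀ θ ∈ Θ, disparity G f q t ≤ disparity G f q θ) (hπt : 0 < π t)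
    (hD : ContDiffOn ℝ 2 (disparity G f q) Θ) (hD2 : 0 < iteratedDeriv 2 (disparity G f q) t)
    (hsep : ∀ η > 0, ∃ ρ > 0, ∀ θ ∈ Θ, η < |θ - t| →
      ρ < disparity G f q θ - disparity G f q t) :
    Tendsto (fun n => √(Δ n) * (edap G f π Θ (Δ n) q - t)) atTop (𝓝 0) := by
  set D := disparity G f q
  have htn : Θ ∈ 𝓝 t := mem_interior_iff_mem_nhds.mp ht
  have hlocmin : IsLocalMin D t := by filter_upwards [htn] with θ hθ using hmin θ hθ
  have htaylor := tendsto_sub_div_sq_of_deriv_eq_zero (hD.contDiffAt htn) hlocmin.deriv_eq_zero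
  have hs : ∀ n, 0 < √(Δ n) := fun n => Real.sqrt_pos.mpr (hΔpos n)
  have hs' : Tendsto (fun n => √(Δ n)) atTop atTop := Real.tendsto_sqrt_atTop.comp hΔ
  have hmom1 : IntegrableOn (fun θ => θ * π θ) Θ := by
    refine Integrable.mono hπ_mom (by fun_prop) (Eventually.of_forall fun θ => ?_)
    simp
  have key := fun k hint => tendsto_laplace_moment (E := fun θ => D θ - D t) hΘ htn (half_pos hD2)
    (hD.continuousOn.sub continuousOn_const) hπ_cont (sub_self (D t))
    (fun θ hθ => sub_nonneg.mpr (hmin θ hθ)) htaylor hsep hs hs' k hint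
  obtain ⟨hI0, h0⟩ := key 0 (by simpa using hπ_int)
  obtain ⟨hI1, h1⟩ := key 1 (by
    simpa [sub_mul, IntegrableOn] using Integrable.sub' hmom1 (hπ_int.const_mul t))
  have hz1 : ∫ u : ℝ, u ^ 1 * (Real.exp (-(iteratedDeriv 2 D t / 2) * u ^ 2) * π t) = 0 := by
    have h := integral_neg_eq_self
      (fun u : ℝ => u ^ 1 * (Real.exp (-(iteratedDeriv 2 D t / 2) * u ^ 2) * π t)) volume
    simp only [pow_one, even_two.neg_pow, neg_mul_comm, mul_neg, integral_neg] at h ⊢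
    linarith
  have hz0 : 0 < ∫ u : ℝ, u ^ 0 * (Real.exp (-(iteratedDeriv 2 D t / 2) * u ^ 2) * π t) := by
    simp only [pow_zero, one_mul]
    rw [integral_mul_const, integral_gaussian]
    positivity
  have hquot := h1.div h0 hz0.ne'
  rw [hz1, zero_div] at hquot
  have hne := h0.eventually (lt_mem_nhds hz0)
  refine hquot.congr' ?_
  filter_upwards [hne] with n hn
  simp only [Pi.div_apply, zero_add, pow_zero, one_mul, pow_one, Real.sq_sqrt (hΔpos n).le]
    at hn hI0 hI1 ⊢
  have hnum : ∫ θ in Θ, (θ - t) * (Real.exp (-Δ n * (D θ - D t)) * π θ) =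
      (∫ θ in Θ, θ * (Real.exp (-Δ n * (D θ - D t)) * π θ)) -
        t * ∫ θ in Θ, Real.exp (-Δ n * (D θ - D t)) * π θ := by
    have hI0n := hI0 n
    have hI1n := hI1 n
    rw [Real.sq_sqrt (hΔpos n).le] at hI0n hI1n
    have h := integral_add hI1n (hI0n.const_mul t)
    rw [integral_const_mul] at h
    rw [eq_sub_iff_add_eq, ← h]
    congr 1 with θ
    ring
  have hedap : edap G f π Θ (Δ n) q =
      (∫ θ in Θ, θ * (Real.exp (-Δ n * (D θ - D t)) * π θ)) /
        ∫ θ in Θ, Real.exp (-Δ n * (D θ - D t)) * π θ := by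
    have hexp : ∀ θ, Real.exp (-Δ n * (D θ - D t)) =
        Real.exp (Δ n * D t) * Real.exp (-Δ n * D θ) := fun θ => by
      rw [← Real.exp_add]; ring_nf
    rw [edap, ← mul_div_mul_left _ _ (Real.exp_pos (Δ n * D t)).ne', ← integral_const_mul,
      ← integral_const_mul]
    congr 2 with θ
    · rw [hexp θ]; ring
    · rw [hexp θ]; ring
  have hpos : 0 < ∫ θ in Θ, Real.exp (-Δ n * (D θ - D t)) * π θ :=
    pos_of_mul_pos_right hn (hs n).le
  have hsn := (hs n).ne'
  rw [hedap, hnum]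
  generalize (∫ θ in Θ, Real.exp (-Δ n * (D θ - D t)) * π θ) = I at hpos ⊢
  generalize (∫ θ in Θ, θ * (Real.exp (-Δ n * (D θ - D t)) * π θ)) = J
  field_simp
  rw [Real.sq_sqrt (hΔpos n).le, mul_comm]

/-- the α-influence function of the EDAP function approximates the
α-influence function of the minimum disparity functional at rate `o(Δ_n^{−1/2})`. -/
theorem stmt13 (Θ : Set ℝ) (hΘ : MeasurableSet Θ)
    (f : ℝ → ℕ → ℝ) (G : ℝ → ℝ) (π : ℝ → ℝ) (Δ : ℕ → ℝ)
    (hΔpos : ∀ n, 0 < Δ n) (hΔ : Tendsto Δ atTop atTop)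
    (hf_pmf : ∀ θ ∈ Θ, (∀ k, 0 ≤ f θ k) ∧ ∑' k, f θ k = 1)
    (hG : StrictConvexOn ℝ (Set.Ici (-1 : ℝ)) G)
    (hG3 : ContDiffOn ℝ 3 G (Set.Ici (-1 : ℝ))) (hG0 : G 0 = 0)
    (hπ_nn : ∀ θ, 0 ≤ π θ) (hπ_one : ∫ θ in Θ, π θ = 1)
    (hπ_smooth : ContDiff ℝ 3 π) (hπ3_bdd : ∃ M, ∀ x, |iteratedDeriv 3 π x| ≤ M)
    (hπ_mom : Integrable (fun θ => |θ| * π θ) (volume.restrict Θ))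
    (α : ℝ) (hα0 : 0 < α) (hα1 : α < 1) (L : ℕ)
    (θ₀ : ℝ) (hθ₀ : θ₀ ∈ Θ) (p : ℕ → ℝ) (hp : p = f θ₀) (hp_pmf : IsPMF p)
    -- hypotheses at `q = p`, with minimum disparity value `Tp`
    (Tp : ℝ) (hTp_int : Tp ∈ interior Θ)
    (hTp_min : ∀ θ ∈ Θ, disparity G f p Tp ≤ disparity G f p θ)
    (hTp_uniq : ∀ t ∈ Θ, (∀ θ ∈ Θ, disparity G f p t ≤ disparity G f p θ) → t = Tp)
    (hπTp : 0 < π Tp)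
    (hDp_C2 : ContDiffOn ℝ 2 (disparity G f p) Θ)
    (hDp2_pos : 0 < iteratedDeriv 2 (disparity G f p) Tp)
    (hsep_p : ∀ η > 0, ∃ ρ > 0, ∀ θ ∈ Θ, η < |θ - Tp| →
      ρ < disparity G f p θ - disparity G f p Tp)
    -- hypotheses at `q = (1−α)p + αη_L`, with minimum disparity value `TpαL`
    (TpαL : ℝ) (hTpαL_int : TpαL ∈ interior Θ)
    (hTpαL_min : ∀ θ ∈ Θ, disparity G f (contam p α L) TpαL ≤ disparity G f (contam p α L) θ)
    (hTpαL_uniq : ∀ t ∈ Θ,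
      (∀ θ ∈ Θ, disparity G f (contam p α L) t ≤ disparity G f (contam p α L) θ) → t = TpαL)
    (hπTpαL : 0 < π TpαL)
    (hDpαL_C2 : ContDiffOn ℝ 2 (disparity G f (contam p α L)) Θ)
    (hDpαL2_pos : 0 < iteratedDeriv 2 (disparity G f (contam p α L)) TpαL)
    (hsep_pαL : ∀ η > 0, ∃ ρ > 0, ∀ θ ∈ Θ, η < |θ - TpαL| →
      ρ < disparity G f (contam p α L) θ - disparity G f (contam p α L) TpαL) :
    Tendsto (fun n => Real.sqrt (Δ n) *
        (α⁻¹ * (edap G f π Θ (Δ n) (contam p α L) - edap G f π Θ (Δ n) p) -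
         α⁻¹ * (TpαL - Tp)))
      atTop (𝓝 0) := by

  have hπ_int : IntegrableOn π Θ := by
    by_contra h
    rw [integral_undef h] at hπ_one
    exact zero_ne_one hπ_one
  have h1 := tendsto_sqrt_mul_edap_sub hΘ hΔpos hΔ hπ_int hπ_smooth.continuous hπ_mom
    hTp_int hTp_min hπTp hDp_C2 hDp2_pos hsep_p
  have h2 := tendsto_sqrt_mul_edap_sub hΘ hΔpos hΔ hπ_int hπ_smooth.continuous hπ_mom
    hTpαL_int hTpαL_min hπTpαL hDpαL_C2 hDpαL2_pos hsep_pαL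
  have h := (h2.sub h1).const_mul α⁻¹
  rw [sub_zero, mul_zero] at h
  refine h.congr fun n => ?_
  ring
end

section
/- Assume p_k(·) is continuous on Θ for each k, G and its derivative G' are bounded on [−1,∞), π is a probability density on Θ with ∫_Θ |θ| π(θ) dθ < ∞, and p = p(θ₀) for some θ₀ ∈ Θ. Fix Δ > 0 and L ∈ ℕ, and let η_L be the point mass at L. Then the influence function of the EDAP function at p is finite: the limit IF(L, T̄_Δ, p) := lim_{α→0⁺} α^{−1} ( T̄_Δ((1−α)p + α η_L) − T̄_Δ(p) ) exists and is a finite real number. -/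
open MeasureTheory Filter Topology Set

/-- A continuous function on `[-1, ∞)` which is differentiable with bounded derivative inside is
Lipschitz. -/
lemma abs_sub_le_of_deriv_bdd {G : ℝ → ℝ} {K : ℝ} (hc : ContinuousOn G (Ici (-1)))
    (hd : ∀ x, -1 < x → DifferentiableAt ℝ G x) (hK : ∀ x, -1 ≤ x → |deriv G x| ≤ K)
    {x y : ℝ} (hx : -1 ≤ x) (hy : -1 ≤ y) : |G y - G x| ≤ K * |y - x| := by
  wlog hxy : x < y generalizing x y
  · rcases eq_or_lt_of_le (not_lt.mp hxy) with h | h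
    · simp [h]
    · rw [abs_sub_comm, abs_sub_comm y]
      exact this hy hx h
  obtain ⟨c, hc', h⟩ := exists_deriv_eq_slope G hxy
    (hc.mono fun z hz => hx.trans hz.1)
    (fun z hz => (hd z (hx.trans_lt hz.1)).differentiableWithinAt)
  have hyx : 0 < y - x := sub_pos.mpr hxy
  rw [eq_div_iff hyx.ne'] at h
  rw [← h, abs_mul]
  exact mul_le_mul_of_nonneg_right (hK c (hx.trans hc'.1.le)) (abs_nonneg _)

lemma abs_exp_sub_exp_le_of_le {a b c : ℝ} (ha : a ≤ c) (hb : b ≤ c) :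
    |Real.exp a - Real.exp b| ≤ Real.exp c * |a - b| := by
  have key : ∀ a b : ℝ, a ≤ c → Real.exp a - Real.exp b ≤ Real.exp c * |a - b| := by
    intro a b ha
    have h1 := Real.add_one_le_exp (b - a)
    have h2 : Real.exp b = Real.exp a * Real.exp (b - a) := by
      rw [← Real.exp_add]; congr 1; ring
    calc Real.exp a - Real.exp b ≤ Real.exp a * (a - b) := by
          rw [h2]; nlinarith [Real.exp_pos a]
      _ ≤ Real.exp a * |a - b| := by gcongr; exact le_abs_self _
      _ ≤ Real.exp c * |a - b| := by gcongr
  rw [abs_le]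
  constructor
  · have := key b a hb
    rw [abs_sub_comm] at this
    linarith
  · exact key a b ha

lemma summable_of_tsum_eq_one {q : ℕ → ℝ} (h : ∑' k, q k = 1) : Summable q := by
  by_contra hs
  rw [tsum_eq_zero_of_not_summable hs] at h
  exact zero_ne_one h

lemma neg_one_le_pearson {f : ℝ → ℕ → ℝ} {q : ℕ → ℝ} (hq : ∀ k, 0 ≤ q k) (θ : ℝ) (k : ℕ) :
    -1 ≤ pearson f q θ k := by
  unfold pearson
  split_ifs with h
  · have := div_nonneg (hq k) h.le
    linarith
  · norm_num

lemma norm_disparity_term_le {G : ℝ → ℝ} {f : ℝ → ℕ → ℝ} {q : ℕ → ℝ} {M θ : ℝ}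
    (hM : ∀ x, -1 ≤ x → |G x| ≤ M) (hq : ∀ k, 0 ≤ q k) (hf : ∀ k, 0 ≤ f θ k) (k : ℕ) :
    ‖G (pearson f q θ k) * f θ k‖ ≤ M * f θ k := by
  rw [Real.norm_eq_abs, abs_mul, abs_of_nonneg (hf k)]
  exact mul_le_mul_of_nonneg_right (hM _ (neg_one_le_pearson hq θ k)) (hf k)

lemma summable_disparity {G : ℝ → ℝ} {f : ℝ → ℕ → ℝ} {q : ℕ → ℝ} {M θ : ℝ}
    (hM : ∀ x, -1 ≤ x → |G x| ≤ M) (hq : ∀ k, 0 ≤ q k) (hf : ∀ k, 0 ≤ f θ k)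
    (hf1 : ∑' k, f θ k = 1) : Summable fun k => G (pearson f q θ k) * f θ k :=
  .of_norm_bounded ((summable_of_tsum_eq_one hf1).mul_left M) (norm_disparity_term_le hM hq hf)

lemma abs_disparity_le {G : ℝ → ℝ} {f : ℝ → ℕ → ℝ} {q : ℕ → ℝ} {M θ : ℝ}
    (hM : ∀ x, -1 ≤ x → |G x| ≤ M) (hq : ∀ k, 0 ≤ q k) (hf : ∀ k, 0 ≤ f θ k)
    (hf1 : ∑' k, f θ k = 1) : |disparity G f q θ| ≤ M := by
  have h := tsum_of_norm_bounded ((summable_of_tsum_eq_one hf1).mul_left M).hasSum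
    (norm_disparity_term_le hM hq hf)
  rwa [tsum_mul_left, hf1, mul_one] at h

lemma contam_nonneg {p : ℕ → ℝ} (hp : ∀ k, 0 ≤ p k) {α : ℝ} (h0 : 0 ≤ α) (h1 : α ≤ 1) (L k : ℕ) :
    0 ≤ contam p α L k := by
  have := mul_nonneg (sub_nonneg.mpr h1) (hp k)
  unfold contam
  split_ifs <;> linarith

@[simp] lemma contam_zero (p : ℕ → ℝ) (L : ℕ) : contam p 0 L = p := by
  ext k
  simp [contam]

lemma pearson_contam {f : ℝ → ℕ → ℝ} {θ : ℝ} {k : ℕ} (hf : 0 < f θ k) (p : ℕ → ℝ) (α : ℝ) (L : ℕ) :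
    pearson f (contam p α L) θ k =
      pearson f p θ k + α * (((if k = L then 1 else 0) - p k) / f θ k) := by
  simp only [pearson, hf, if_true, contam]
  ring

lemma aestronglyMeasurable_disparity {Θ : Set ℝ} (hΘ : MeasurableSet Θ) {f : ℝ → ℕ → ℝ}
    {G : ℝ → ℝ} {M : ℝ} (hf_pmf : ∀ θ ∈ Θ, (∀ k, 0 ≤ f θ k) ∧ ∑' k, f θ k = 1)
    (hf_cont : ∀ k, ContinuousOn (fun θ => f θ k) Θ) (hG : ContinuousOn G (Ici (-1)))
    (hM : ∀ x, -1 ≤ x → |G x| ≤ M) {q : ℕ → ℝ} (hq : ∀ k, 0 ≤ q k) :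
    AEStronglyMeasurable (fun θ => disparity G f q θ) (volume.restrict Θ) := by
  have hG' : Continuous fun x => G (max (-1) x) :=
    hG.comp_continuous (by fun_prop) fun x => mem_Ici.mpr (le_max_left _ _)
  refine aestronglyMeasurable_of_tendsto_ae atTop
    (f := fun (n : ℕ) θ => ∑ k ∈ Finset.range n, G (max (-1) (pearson f q θ k)) * f θ k)
    (fun n => ?_) ?_
  · refine AEMeasurable.aestronglyMeasurable (Finset.aemeasurable_fun_sum _ fun k _ => ?_)
    have hfk : AEMeasurable (fun θ => f θ k) (volume.restrict Θ) :=
      ((hf_cont k).aestronglyMeasurable hΘ).aemeasurable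
    have hφ : Measurable fun y : ℝ => if 0 < y then q k / y - 1 else 0 :=
      Measurable.ite measurableSet_Ioi (by fun_prop) (by fun_prop)
    exact (hG'.measurable.comp_aemeasurable (hφ.comp_aemeasurable hfk)).mul hfk
  · filter_upwards [ae_restrict_mem hΘ] with θ hθ
    simp only [max_eq_right (neg_one_le_pearson hq θ _)]
    exact (summable_disparity hM hq (hf_pmf θ hθ).1 (hf_pmf θ hθ).2).hasSum.tendsto_sum_nat

section Contamination

variable {f : ℝ → ℕ → ℝ} {G : ℝ → ℝ} {M K θ : ℝ} {p : ℕ → ℝ}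

lemma norm_disparity_term_sub_le (hK : ∀ x y, -1 ≤ x → -1 ≤ y → |G y - G x| ≤ K * |y - x|)
    (hp : ∀ k, 0 ≤ p k) (hf : ∀ k, 0 ≤ f θ k) (L : ℕ) {α : ℝ} (h0 : 0 ≤ α) (h1 : α ≤ 1) (k : ℕ) :
    ‖G (pearson f (contam p α L) θ k) * f θ k - G (pearson f p θ k) * f θ k‖ ≤
      α * (K * |(if k = L then 1 else 0) - p k|) := by
  have hK0 : 0 ≤ K := by simpa using (abs_nonneg _).trans (hK 0 1 (by norm_num) (by norm_num))
  rcases (hf k).eq_or_lt with h | h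
  · rw [← h]
    simp only [mul_zero, sub_zero, norm_zero]
    positivity
  · have := hK _ _ (neg_one_le_pearson (f := f) hp θ k)
      (neg_one_le_pearson (f := f) (contam_nonneg hp h0 h1 L) θ k)
    rw [← sub_mul, Real.norm_eq_abs, abs_mul, abs_of_pos h]
    refine (mul_le_mul_of_nonneg_right this h.le).trans_eq ?_
    rw [pearson_contam h, add_sub_cancel_left, abs_mul, abs_div, abs_of_nonneg h0, abs_of_pos h]
    field_simp

lemma summable_abs_pointMass_sub (hp : Summable p) (L : ℕ) :
    Summable fun k => |(if k = L then (1 : ℝ) else 0) - p k| :=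
  ((hasSum_ite_eq L (1 : ℝ)).summable.sub hp).abs

lemma abs_disparity_sub_le (hM : ∀ x, -1 ≤ x → |G x| ≤ M)
    (hK : ∀ x y, -1 ≤ x → -1 ≤ y → |G y - G x| ≤ K * |y - x|)
    (hp : ∀ k, 0 ≤ p k) (hps : Summable p) (hf : ∀ k, 0 ≤ f θ k) (hf1 : ∑' k, f θ k = 1) (L : ℕ)
    {α : ℝ} (h0 : 0 ≤ α) (h1 : α ≤ 1) :
    |disparity G f (contam p α L) θ - disparity G f p θ| ≤
      α * (K * ∑' k, |(if k = L then 1 else 0) - p k|) := by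
  unfold disparity
  rw [← (summable_disparity hM (contam_nonneg hp h0 h1 L) hf hf1).tsum_sub
    (summable_disparity hM hp hf hf1), ← tsum_mul_left, ← tsum_mul_left]
  exact tsum_of_norm_bounded
    (((summable_abs_pointMass_sub hps L).mul_left K).mul_left α).hasSum
    (norm_disparity_term_sub_le hK hp hf L h0 h1)

lemma eventually_mem_Ioc_zero_one : ∀ᶠ α : ℝ in 𝓝[>] 0, α ∈ Ioc (0 : ℝ) 1 :=
  Ioc_mem_nhdsGT one_pos

lemma exists_hasDerivWithinAt_disparity (hGd : DifferentiableOn ℝ G (Ici (-1)))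
    (hM : ∀ x, -1 ≤ x → |G x| ≤ M)
    (hK : ∀ x y, -1 ≤ x → -1 ≤ y → |G y - G x| ≤ K * |y - x|)
    (hp : ∀ k, 0 ≤ p k) (hps : Summable p) (hf : ∀ k, 0 ≤ f θ k) (hf1 : ∑' k, f θ k = 1) (L : ℕ) :
    ∃ d, HasDerivWithinAt (fun α => disparity G f (contam p α L) θ) d (Ioi 0) 0 := by
  have hterm : ∀ k, ∃ d, HasDerivWithinAt
      (fun α => G (pearson f (contam p α L) θ k) * f θ k) d (Ioc 0 1) 0 := by
    intro k
    rcases (hf k).eq_or_lt with h | h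
    · exact ⟨0, by simpa [← h] using hasDerivWithinAt_const (0 : ℝ) (Ioc (0 : ℝ) 1) (0 : ℝ)⟩
    · have hin : DifferentiableWithinAt ℝ (fun α => pearson f (contam p α L) θ k) (Ioc 0 1) 0 := by
        simp only [pearson_contam h]
        fun_prop
      have hG0 : DifferentiableWithinAt ℝ G (Ici (-1)) (pearson f (contam p 0 L) θ k) :=
        hGd _ (by simpa using neg_one_le_pearson hp θ k)
      have hcomp := DifferentiableWithinAt.comp (f := fun α => pearson f (contam p α L) θ k)
        (0 : ℝ) hG0 hin fun α hα => mem_Ici.mpr <| neg_one_le_pearson (contam_nonneg hp hα.1.le hα.2 L) θ k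
      exact ⟨_, (hcomp.mul_const (f θ k)).hasDerivWithinAt⟩
  choose d hd using hterm
  refine ⟨∑' k, d k, ?_⟩
  rw [hasDerivWithinAt_iff_tendsto_slope' (by simp)]
  have hlim := tendsto_tsum_of_dominated_convergence (𝓕 := 𝓝[>] (0 : ℝ))
    (f := fun α k => slope (fun α => G (pearson f (contam p α L) θ k) * f θ k) 0 α) (g := d)
    ((summable_abs_pointMass_sub hps L).mul_left K) (fun k => ?_) ?_
  · refine hlim.congr' ?_
    filter_upwards [eventually_mem_Ioc_zero_one] with α hα
    simp only [slope_def_field, sub_zero, contam_zero, disparity]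
    rw [tsum_div_const, (summable_disparity hM (contam_nonneg hp hα.1.le hα.2 L) hf hf1).tsum_sub
      (summable_disparity hM hp hf hf1)]
  · have := (hasDerivWithinAt_iff_tendsto_slope' (by simp)).mp (hd k)
    rwa [nhdsWithin_Ioc_eq_nhdsGT one_pos] at this
  · filter_upwards [eventually_mem_Ioc_zero_one] with α hα k
    simp only [slope_def_field, sub_zero, contam_zero]
    rw [norm_div, Real.norm_of_nonneg hα.1.le, div_le_iff₀ hα.1, mul_comm _ α]
    exact norm_disparity_term_sub_le hK hp hf L hα.1.le hα.2 k

lemma exists_hasDerivWithinAt_integral {Θ : Set ℝ} (hΘ : MeasurableSet Θ)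
    (hf_pmf : ∀ θ ∈ Θ, (∀ k, 0 ≤ f θ k) ∧ ∑' k, f θ k = 1)
    (hf_cont : ∀ k, ContinuousOn (fun θ => f θ k) Θ) (hGd : DifferentiableOn ℝ G (Ici (-1)))
    (hM : ∀ x, -1 ≤ x → |G x| ≤ M)
    (hK : ∀ x y, -1 ≤ x → -1 ≤ y → |G y - G x| ≤ K * |y - x|)
    (hp : ∀ k, 0 ≤ p k) (hps : Summable p) (L : ℕ) {Δ : ℝ} (hΔ : 0 < Δ) {w : ℝ → ℝ}
    (hw : IntegrableOn w Θ) :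
    ∃ d, HasDerivWithinAt
      (fun α => ∫ θ in Θ, Real.exp (-Δ * disparity G f (contam p α L) θ) * w θ) d (Ioi 0) 0 := by
  have hpt : ∀ θ, ∃ d, θ ∈ Θ → HasDerivWithinAt
      (fun α => Real.exp (-Δ * disparity G f (contam p α L) θ) * w θ) d (Ioi 0) 0 := by
    intro θ
    by_cases hθ : θ ∈ Θ
    · obtain ⟨d, hd⟩ := exists_hasDerivWithinAt_disparity hGd hM hK hp hps
        (hf_pmf θ hθ).1 (hf_pmf θ hθ).2 L
      exact ⟨_, fun _ => (hd.const_mul (-Δ)).exp.mul_const (w θ)⟩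
    · exact ⟨0, fun h => absurd h hθ⟩
  choose d hd using hpt
  have hexp : ∀ q : ℕ → ℝ, (∀ k, 0 ≤ q k) → ∀ θ ∈ Θ, -Δ * disparity G f q θ ≤ Δ * M := by
    intro q hq θ hθ
    have := (abs_le.mp (abs_disparity_le hM hq (hf_pmf θ hθ).1 (hf_pmf θ hθ).2)).1
    nlinarith
  have hmeas : ∀ q : ℕ → ℝ, (∀ k, 0 ≤ q k) → AEStronglyMeasurable
      (fun θ => Real.exp (-Δ * disparity G f q θ)) (volume.restrict Θ) := fun q hq =>
    Real.continuous_exp.comp_aestronglyMeasurable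
      ((aestronglyMeasurable_disparity hΘ hf_pmf hf_cont hGd.continuousOn hM hq).const_mul (-Δ))
  have hint : ∀ q : ℕ → ℝ, (∀ k, 0 ≤ q k) → Integrable
      (fun θ => Real.exp (-Δ * disparity G f q θ) * w θ) (volume.restrict Θ) := by
    intro q hq
    refine hw.bdd_mul (c := Real.exp (Δ * M)) (hmeas q hq) ?_
    filter_upwards [ae_restrict_mem hΘ] with θ hθ
    rw [Real.norm_of_nonneg (Real.exp_pos _).le]
    exact Real.exp_le_exp.mpr (hexp q hq θ hθ)
  refine ⟨∫ θ in Θ, d θ, ?_⟩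
  rw [hasDerivWithinAt_iff_tendsto_slope' (by simp)]
  set C := K * ∑' k, |(if k = L then 1 else 0) - p k|
  have hlim := tendsto_integral_filter_of_dominated_convergence (l := 𝓝[>] (0 : ℝ))
    (μ := volume.restrict Θ) (f := d)
    (F := fun α θ => slope (fun α => Real.exp (-Δ * disparity G f (contam p α L) θ) * w θ) 0 α)
    (fun θ => Real.exp (Δ * M) * (Δ * C) * |w θ|) ?_ ?_ (hw.abs.const_mul _) ?_
  · refine hlim.congr' ?_
    filter_upwards [eventually_mem_Ioc_zero_one] with α hα
    simp only [slope_def_field, sub_zero, contam_zero]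
    rw [integral_div, integral_sub (hint _ (contam_nonneg hp hα.1.le hα.2 L)) (hint _ hp)]
  · filter_upwards [eventually_mem_Ioc_zero_one] with α hα
    simp only [slope_def_field, sub_zero, contam_zero]
    exact (((hint _ (contam_nonneg hp hα.1.le hα.2 L)).sub (hint _ hp)).div_const α).1
  · filter_upwards [eventually_mem_Ioc_zero_one] with α hα
    filter_upwards [ae_restrict_mem hΘ] with θ hθ
    simp only [slope_def_field, sub_zero, contam_zero]
    rw [norm_div, Real.norm_of_nonneg hα.1.le, div_le_iff₀ hα.1, ← sub_mul, norm_mul,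
      Real.norm_eq_abs, Real.norm_eq_abs, mul_right_comm]
    refine mul_le_mul_of_nonneg_right ?_ (abs_nonneg _)
    refine (abs_exp_sub_exp_le_of_le (hexp _ (contam_nonneg hp hα.1.le hα.2 L) θ hθ)
      (hexp _ hp θ hθ)).trans ?_
    rw [mul_assoc]
    refine mul_le_mul_of_nonneg_left ?_ (Real.exp_pos _).le
    rw [← mul_sub, abs_mul, abs_neg, abs_of_pos hΔ, mul_assoc, mul_comm C]
    exact mul_le_mul_of_nonneg_left (abs_disparity_sub_le hM hK hp hps (hf_pmf θ hθ).1
      (hf_pmf θ hθ).2 L hα.1.le hα.2) hΔ.le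
  · filter_upwards [ae_restrict_mem hΘ] with θ hθ
    exact (hasDerivWithinAt_iff_tendsto_slope' (by simp)).mp (hd θ hθ)

end Contamination

lemma integral_exp_disparity_pos {Θ : Set ℝ} (hΘ : MeasurableSet Θ) {f : ℝ → ℕ → ℝ}
    {G w : ℝ → ℝ} {M : ℝ} (hf_pmf : ∀ θ ∈ Θ, (∀ k, 0 ≤ f θ k) ∧ ∑' k, f θ k = 1)
    (hf_cont : ∀ k, ContinuousOn (fun θ => f θ k) Θ) (hG : ContinuousOn G (Ici (-1)))
    (hM : ∀ x, -1 ≤ x → |G x| ≤ M) {q : ℕ → ℝ} (hq : ∀ k, 0 ≤ q k) {Δ : ℝ} (hΔ : 0 < Δ)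
    (hw : IntegrableOn w Θ) (hw0 : ∀ θ, 0 ≤ w θ) (hw1 : 0 < ∫ θ in Θ, w θ) :
    0 < ∫ θ in Θ, Real.exp (-Δ * disparity G f q θ) * w θ := by
  have hD : ∀ θ ∈ Θ, |disparity G f q θ| ≤ M := fun θ hθ =>
    abs_disparity_le hM hq (hf_pmf θ hθ).1 (hf_pmf θ hθ).2
  have hint : Integrable (fun θ => Real.exp (-Δ * disparity G f q θ) * w θ)
      (volume.restrict Θ) := by
    refine hw.bdd_mul (c := Real.exp (Δ * M)) (Real.continuous_exp.comp_aestronglyMeasurable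
      ((aestronglyMeasurable_disparity hΘ hf_pmf hf_cont hG hM hq).const_mul (-Δ))) ?_
    filter_upwards [ae_restrict_mem hΘ] with θ hθ
    rw [Real.norm_of_nonneg (Real.exp_pos _).le]
    refine Real.exp_le_exp.mpr ?_
    nlinarith [(abs_le.mp (hD θ hθ)).1]
  have hle : ∫ θ in Θ, Real.exp (-(Δ * M)) * w θ ≤
      ∫ θ in Θ, Real.exp (-Δ * disparity G f q θ) * w θ := by
    refine setIntegral_mono_on (hw.const_mul _) hint hΘ fun θ hθ => ?_
    refine mul_le_mul_of_nonneg_right (Real.exp_le_exp.mpr ?_) (hw0 θ)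
    nlinarith [(abs_le.mp (hD θ hθ)).2]
  rw [integral_const_mul] at hle
  exact (mul_pos (Real.exp_pos _) hw1).trans_le hle

/-- the influence function of the EDAP function at `p` exists and is
finite: `IF(L, T̄_Δ, p) = lim_{α→0⁺} α⁻¹(T̄_Δ((1−α)p + αη_L) − T̄_Δ(p))` is a finite real. -/
theorem stmt14 (Θ : Set ℝ) (hΘ : MeasurableSet Θ)
    (f : ℝ → ℕ → ℝ) (G : ℝ → ℝ) (π : ℝ → ℝ)
    (hf_pmf : ∀ θ ∈ Θ, (∀ k, 0 ≤ f θ k) ∧ ∑' k, f θ k = 1)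
    (hf_cont : ∀ k, ContinuousOn (fun θ => f θ k) Θ)
    (hG : StrictConvexOn ℝ (Set.Ici (-1 : ℝ)) G)
    (hG3 : ContDiffOn ℝ 3 G (Set.Ici (-1 : ℝ))) (hG0 : G 0 = 0)
    (hG_bdd : ∃ M, ∀ x : ℝ, -1 ≤ x → |G x| ≤ M)
    (hG'_bdd : ∃ M, ∀ x : ℝ, -1 ≤ x → |deriv G x| ≤ M)
    (hπ_meas : Measurable π) (hπ_nn : ∀ θ, 0 ≤ π θ) (hπ_one : ∫ θ in Θ, π θ = 1)
    (hπ_mom : Integrable (fun θ => |θ| * π θ) (volume.restrict Θ))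
    (θ₀ : ℝ) (hθ₀ : θ₀ ∈ Θ) (p : ℕ → ℝ) (hp : p = f θ₀) (hp_pmf : IsPMF p)
    (Δ : ℝ) (hΔ : 0 < Δ) (L : ℕ) :
    ∃ l : ℝ, Tendsto (fun α : ℝ => α⁻¹ * (edap G f π Θ Δ (contam p α L) - edap G f π Θ Δ p))
      (𝓝[>] (0 : ℝ)) (𝓝 l) := by
  obtain ⟨M, hM⟩ := hG_bdd
  obtain ⟨K, hK'⟩ := hG'_bdd
  have hGd : DifferentiableOn ℝ G (Ici (-1)) := hG3.differentiableOn (by norm_num)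
  have hK : ∀ x y, -1 ≤ x → -1 ≤ y → |G y - G x| ≤ K * |y - x| := fun x y hx hy =>
    abs_sub_le_of_deriv_bdd hGd.continuousOn
      (fun z hz => hGd.differentiableAt (Ici_mem_nhds hz)) hK' hx hy
  have hps : Summable p := summable_of_tsum_eq_one hp_pmf.2
  have hπ : IntegrableOn π Θ := by
    by_contra h
    rw [integral_undef h] at hπ_one
    exact zero_ne_one hπ_one
  have hθπ : IntegrableOn (fun θ => θ * π θ) Θ := by
    refine hπ_mom.mono (by fun_prop) (ae_of_all _ fun θ => ?_)
    simp
  obtain ⟨a, ha⟩ := exists_hasDerivWithinAt_integral hΘ hf_pmf hf_cont hGd hM hK hp_pmf.1 hps L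
    hΔ hθπ
  obtain ⟨b, hb⟩ := exists_hasDerivWithinAt_integral hΘ hf_pmf hf_cont hGd hM hK hp_pmf.1 hps L
    hΔ hπ
  have hpos := integral_exp_disparity_pos hΘ hf_pmf hf_cont hGd.continuousOn hM hp_pmf.1 hΔ hπ
    hπ_nn (by rw [hπ_one]; exact one_pos)
  have hquot := ha.div hb (by rw [contam_zero]; exact hpos.ne')
  rw [hasDerivWithinAt_iff_tendsto_slope' (by simp)] at hquot
  refine ⟨_, hquot.congr fun α => ?_⟩
  simp only [slope_def_field, sub_zero, contam_zero, edap, Pi.div_apply]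
  rw [div_eq_inv_mul]
  simp only [mul_left_comm (Real.exp _), mul_assoc]
end

section
/- Suppose there exist real numbers r ≤ R such that r ≤ D(q,θ) ≤ R for every q ∈ Γ and θ ∈ Θ, that the function δ ↦ (δ+1)G'(δ) − G(δ) is bounded on [−1,∞), and that ∫_Θ |θ| π(θ) dθ < ∞. Then for every Δ > 0 and every q ∈ Γ, |T̄_Δ(q)| ≤ e^{Δ(R−r)} ∫_Θ |θ| π(θ) dθ. Consequently, for every p ∈ Γ and every α ∈ (0,1), b(α, T̄_Δ, p) := sup_{q̄∈Γ} |T̄_Δ((1−α)p + αq̄) − T̄_Δ(p)| < ∞; that is, the breakdown point of the EDAP function at p equals 1. -/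
open MeasureTheory Filter Topology Set

theorem IsPMF.mix {p q : ℕ → ℝ} (hp : IsPMF p) (hq : IsPMF q) {α : ℝ} (h0 : 0 ≤ α)
    (h1 : α ≤ 1) : IsPMF (fun k => (1 - α) * p k + α * q k) := by
  refine ⟨fun k => add_nonneg (mul_nonneg (sub_nonneg.2 h1) (hp.1 k))
    (mul_nonneg h0 (hq.1 k)), ?_⟩
  rw [(hp.summable.mul_left _).tsum_add (hq.summable.mul_left _), tsum_mul_left, tsum_mul_left,
    hp.2, hq.2]
  ring

/-- No measurability of the disparity in `θ` is needed: where an integral defining the EDAP value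
diverges or is undefined, the value is `0`. -/
theorem abs_edap_le {Θ : Set ℝ} (hΘ : MeasurableSet Θ) {f : ℝ → ℕ → ℝ} {G π : ℝ → ℝ}
    {q : ℕ → ℝ} {r R : ℝ}
    (hbdd : ∀ θ ∈ Θ, r ≤ disparity G f q θ ∧ disparity G f q θ ≤ R)
    (hπ_nn : ∀ θ, 0 ≤ π θ) (hπ_one : ∫ θ in Θ, π θ = 1)
    (hπ_mom : Integrable (fun θ => |θ| * π θ) (volume.restrict Θ)) {Δ : ℝ} (hΔ : 0 < Δ) :
    |edap G f π Θ Δ q| ≤ Real.exp (Δ * (R - r)) * ∫ θ in Θ, |θ| * π θ := by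
  have hm : 0 ≤ ∫ θ in Θ, |θ| * π θ :=
    integral_nonneg fun θ => mul_nonneg (abs_nonneg θ) (hπ_nn θ)
  have hπ_int : Integrable π (volume.restrict Θ) := by
    by_contra h
    rw [integral_undef h] at hπ_one
    exact zero_ne_one hπ_one
  unfold edap
  by_cases hD : Integrable (fun θ => Real.exp (-Δ * disparity G f q θ) * π θ)
      (volume.restrict Θ)
  · have hden : Real.exp (-Δ * R) ≤ ∫ θ in Θ, Real.exp (-Δ * disparity G f q θ) * π θ := by
      calc Real.exp (-Δ * R) = ∫ θ in Θ, Real.exp (-Δ * R) * π θ := by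
            rw [integral_const_mul, hπ_one, mul_one]
        _ ≤ _ := by
            refine setIntegral_mono_on (hπ_int.const_mul _) hD hΘ fun θ hθ => ?_
            refine mul_le_mul_of_nonneg_right (Real.exp_le_exp.2 ?_) (hπ_nn θ)
            nlinarith [(hbdd θ hθ).2]
    have hnum : |∫ θ in Θ, θ * Real.exp (-Δ * disparity G f q θ) * π θ| ≤
        Real.exp (-Δ * r) * ∫ θ in Θ, |θ| * π θ := by
      rw [← integral_const_mul, ← Real.norm_eq_abs]
      refine norm_integral_le_of_norm_le (hπ_mom.const_mul _)
        ((ae_restrict_iff' hΘ).2 (ae_of_all _ fun θ hθ => ?_))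
      rw [Real.norm_eq_abs, abs_mul, abs_mul, Real.abs_exp, abs_of_nonneg (hπ_nn θ),
        mul_comm |θ|, mul_assoc]
      refine mul_le_mul_of_nonneg_right (Real.exp_le_exp.2 ?_)
        (mul_nonneg (abs_nonneg θ) (hπ_nn θ))
      nlinarith [(hbdd θ hθ).1]
    have hpos := (Real.exp_pos _).trans_le hden
    rw [abs_div, abs_of_pos hpos, div_le_iff₀ hpos]
    calc _ ≤ _ := hnum
      _ = Real.exp (Δ * (R - r)) * (∫ θ in Θ, |θ| * π θ) * Real.exp (-Δ * R) := by
          rw [mul_right_comm, ← Real.exp_add]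
          ring_nf
      _ ≤ _ := mul_le_mul_of_nonneg_left hden (mul_nonneg (Real.exp_pos _).le hm)
  · rw [integral_undef hD, div_zero, abs_zero]
    exact mul_nonneg (Real.exp_pos _).le hm

/-- if the disparity is bounded (`r ≤ D ≤ R` on `Γ × Θ`) and the
residual adjustment function is bounded, then `|T̄_Δ(q)| ≤ e^{Δ(R−r)} ∫_Θ |θ|π(θ)dθ`
for every `Δ > 0` and `q ∈ Γ`; consequently `b(α, T̄_Δ, p) < ∞` for every `p ∈ Γ`
and `α ∈ (0,1)`, i.e. the breakdown point of the EDAP at `p` is 1. -/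
theorem stmt15 (Θ : Set ℝ) (hΘ : MeasurableSet Θ)
    (f : ℝ → ℕ → ℝ) (G : ℝ → ℝ) (π : ℝ → ℝ)
    (hf_pmf : ∀ θ ∈ Θ, (∀ k, 0 ≤ f θ k) ∧ ∑' k, f θ k = 1)
    (hG : StrictConvexOn ℝ (Set.Ici (-1 : ℝ)) G)
    (hG3 : ContDiffOn ℝ 3 G (Set.Ici (-1 : ℝ))) (hG0 : G 0 = 0)
    (r R : ℝ)
    (hbdd : ∀ q : ℕ → ℝ, IsPMF q → ∀ θ ∈ Θ,
      r ≤ disparity G f q θ ∧ disparity G f q θ ≤ R)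
    (hRAF : ∃ M, ∀ x : ℝ, -1 ≤ x → |(x + 1) * deriv G x - G x| ≤ M)
    (hπ_nn : ∀ θ, 0 ≤ π θ) (hπ_one : ∫ θ in Θ, π θ = 1)
    (hπ_mom : Integrable (fun θ => |θ| * π θ) (volume.restrict Θ)) :
    (∀ Δ : ℝ, 0 < Δ → ∀ q : ℕ → ℝ, IsPMF q →
      |edap G f π Θ Δ q| ≤ Real.exp (Δ * (R - r)) * ∫ θ in Θ, |θ| * π θ) ∧
    (∀ Δ : ℝ, 0 < Δ → ∀ p : ℕ → ℝ, IsPMF p → ∀ α : ℝ, 0 < α → α < 1 →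
      ∃ B : ℝ, ∀ qbar : ℕ → ℝ, IsPMF qbar →
        |edap G f π Θ Δ (fun k => (1 - α) * p k + α * qbar k) - edap G f π Θ Δ p| ≤ B) := by
  have key : ∀ Δ : ℝ, 0 < Δ → ∀ q : ℕ → ℝ, IsPMF q →
      |edap G f π Θ Δ q| ≤ Real.exp (Δ * (R - r)) * ∫ θ in Θ, |θ| * π θ :=
    fun Δ hΔ q hq => abs_edap_le hΘ (hbdd q hq) hπ_nn hπ_one hπ_mom hΔ
  refine ⟨key, fun Δ hΔ p hp α h0 h1 => ⟨_, fun qbar hq => (abs_sub _ _).trans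
    (add_le_add (key Δ hΔ _ (hp.mix hq h0.le h1.le)) (key Δ hΔ p hp))⟩⟩
end

section
/- Fix α ∈ (0,1). Assume G and G' are bounded on [−1,∞), lim_{|θ|→∞} Σ_k min(p_k, p_k(θ)) = 0, and (q̄_L)_{L∈ℕ} ⊆ Γ satisfies lim_{L→∞} Σ_k min(q̄_{L,k}, p_k) = 0 and, for every c > 0, lim_{L→∞} sup_{|θ|≤c} Σ_k min(q̄_{L,k}, p_k(θ)) = 0. Then for every δ > 0: (i) there exist L₁ ∈ ℕ and M₁ > 0 such that sup_{θ∈Θ, |θ|>M₁} sup_{L>L₁} |D((1−α)p + αq̄_L, θ) − D(αq̄_L, θ)| < δ; and (ii) for every M₂ > 0 there exists L₂ ∈ ℕ such that sup_{θ∈Θ, |θ|<M₂} sup_{L>L₂} |D((1−α)p + αq̄_L, θ) − D((1−α)p, θ)| < δ. -/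
open MeasureTheory Filter Topology Set

/-- A function with derivative bounded by `C` on `[-1, ∞)` is `C`-Lipschitz there. -/
lemma abs_sub_le_of_abs_deriv_le {G : ℝ → ℝ} {C : ℝ}
    (hG : ContDiffOn ℝ 3 G (Set.Ici (-1 : ℝ)))
    (hC : ∀ x : ℝ, -1 ≤ x → |deriv G x| ≤ C) {x y : ℝ} (hx : -1 ≤ x) (hxy : x ≤ y) :
    |G y - G x| ≤ C * (y - x) := by
  rcases hxy.eq_or_lt with rfl | hlt
  · simp
  · have hcont : ContinuousOn G (Set.Icc x y) :=
      hG.continuousOn.mono fun z hz => hx.trans hz.1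
    have hdiff : DifferentiableOn ℝ G (Set.Ioo x y) :=
      (hG.differentiableOn (by norm_num)).mono fun z hz => hx.trans hz.1.le
    obtain ⟨c, hc, hslope⟩ := exists_deriv_eq_slope G hlt hcont hdiff
    have hpos : 0 < y - x := sub_pos.2 hlt
    have hmul : G y - G x = deriv G c * (y - x) := by
      rw [hslope, div_mul_cancel₀ _ hpos.ne']
    rw [hmul, abs_mul, abs_of_pos hpos]
    exact mul_le_mul_of_nonneg_right (hC c (hx.trans hc.1.le)) hpos.le

/-- Adding mass `b` to `a` changes the disparity by at most a multiple of the overlap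
of `b` with the model. -/
lemma abs_disparity_add_sub_le {f : ℝ → ℕ → ℝ} {G : ℝ → ℝ} {M C θ : ℝ}
    (hG : ContDiffOn ℝ 3 G (Set.Ici (-1 : ℝ)))
    (hM : ∀ x : ℝ, -1 ≤ x → |G x| ≤ M) (hC : ∀ x : ℝ, -1 ≤ x → |deriv G x| ≤ C)
    (hf : ∀ k, 0 ≤ f θ k) (hfs : Summable (f θ))
    {a b c : ℕ → ℝ} (ha : ∀ k, 0 ≤ a k) (hb : ∀ k, 0 ≤ b k) (hbc : ∀ k, b k ≤ c k) :
    |disparity G f (fun k => a k + b k) θ - disparity G f a θ| ≤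
      (2 * M + C) * ∑' k, min (c k) (f θ k) := by
  have hM0 : 0 ≤ M := (abs_nonneg _).trans (hM 0 (by norm_num))
  have hC0 : 0 ≤ C := (abs_nonneg _).trans (hC 0 (by norm_num))
  have hab : ∀ k, 0 ≤ a k + b k := fun k => add_nonneg (ha k) (hb k)
  have hsum : ∀ q : ℕ → ℝ, (∀ k, 0 ≤ q k) → Summable fun k => G (pearson f q θ k) * f θ k := by
    intro q hq
    refine Summable.of_norm_bounded (hfs.mul_left M) fun k => ?_
    rw [Real.norm_eq_abs, abs_mul, abs_of_nonneg (hf k)]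
    exact mul_le_mul_of_nonneg_right (hM _ (neg_one_le_pearson hq θ k)) (hf k)
  have hmin : Summable fun k => min (c k) (f θ k) :=
    hfs.of_nonneg_of_le (fun k => le_min ((hb k).trans (hbc k)) (hf k)) fun k => min_le_right _ _
  have hterm : ∀ k, ‖G (pearson f (fun k => a k + b k) θ k) * f θ k -
      G (pearson f a θ k) * f θ k‖ ≤ (2 * M + C) * min (c k) (f θ k) := by
    intro k
    rw [Real.norm_eq_abs, ← sub_mul, abs_mul, abs_of_nonneg (hf k)]
    have hck : 0 ≤ c k := (hb k).trans (hbc k)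
    rcases (hf k).eq_or_lt with h0 | hpos
    · simp [← h0, hck]
    · have h1 := neg_one_le_pearson (f := f) hab θ k
      have h2 := neg_one_le_pearson (f := f) ha θ k
      have hbd : |G (pearson f (fun k => a k + b k) θ k) - G (pearson f a θ k)| ≤ 2 * M := by
        have := abs_sub (G (pearson f (fun k => a k + b k) θ k)) (G (pearson f a θ k))
        linarith [hM _ h1, hM _ h2]
      have hdiff : pearson f (fun k => a k + b k) θ k - pearson f a θ k = b k / f θ k := by
        simp only [pearson, hpos, if_true]
        ring
      have hle : pearson f a θ k ≤ pearson f (fun k => a k + b k) θ k := by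
        linarith [div_nonneg (hb k) hpos.le]
      have hlip := abs_sub_le_of_abs_deriv_le hG hC h2 hle
      rw [hdiff] at hlip
      rcases min_choice (c k) (f θ k) with h | h <;> rw [h]
      · calc _ ≤ C * (b k / f θ k) * f θ k := mul_le_mul_of_nonneg_right hlip hpos.le
          _ = C * b k := by field_simp
          _ ≤ (2 * M + C) * c k :=
            mul_le_mul (by linarith) (hbc k) (hb k) (by positivity)
      · exact mul_le_mul_of_nonneg_right (by linarith) hpos.le
  unfold disparity
  rw [← (hsum _ hab).tsum_sub (hsum _ ha), ← tsum_mul_left, ← Real.norm_eq_abs]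
  exact tsum_of_norm_bounded (hmin.mul_left _).hasSum hterm

/-- Lemma 1: for contaminating sequences `q̄_L` singular to `p` and to the
parametric family, the disparity of the contaminated mixture is uniformly close to
`D(αq̄_L, ·)` far out and to `D((1−α)p, ·)` on bounded sets. -/
theorem stmt17 (Θ : Set ℝ)
    (f : ℝ → ℕ → ℝ) (G : ℝ → ℝ)
    (α : ℝ) (hα0 : 0 < α) (hα1 : α < 1)
    (hf_pmf : ∀ θ ∈ Θ, (∀ k, 0 ≤ f θ k) ∧ ∑' k, f θ k = 1)
    (hG : StrictConvexOn ℝ (Set.Ici (-1 : ℝ)) G)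
    (hG3 : ContDiffOn ℝ 3 G (Set.Ici (-1 : ℝ))) (hG0 : G 0 = 0)
    (hG_bdd : ∃ M, ∀ x : ℝ, -1 ≤ x → |G x| ≤ M)
    (hG'_bdd : ∃ M, ∀ x : ℝ, -1 ≤ x → |deriv G x| ≤ M)
    (p : ℕ → ℝ) (hp_pmf : IsPMF p)
    (hortho_family : ∀ ε > 0, ∃ M, ∀ θ ∈ Θ, M < |θ| →
      (∑' k, min (p k) (f θ k)) < ε)
    (qbar : ℕ → ℕ → ℝ) (hqbar : ∀ L, IsPMF (qbar L))
    (hortho_contam : Tendsto (fun L => ∑' k, min (qbar L k) (p k)) atTop (𝓝 0))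
    (hortho_contam_family : ∀ c > 0, ∀ ε > 0, ∃ L₂ : ℕ, ∀ L ≥ L₂, ∀ θ ∈ Θ, |θ| ≤ c →
      (∑' k, min (qbar L k) (f θ k)) < ε) :
    ∀ δ > 0,
      (∃ L₁ : ℕ, ∃ M₁ > 0, ∀ θ ∈ Θ, M₁ < |θ| → ∀ L > L₁,
        |disparity G f (fun k => (1 - α) * p k + α * qbar L k) θ -
          disparity G f (fun k => α * qbar L k) θ| < δ) ∧
      (∀ M₂ > 0, ∃ L₂ : ℕ, ∀ θ ∈ Θ, |θ| < M₂ → ∀ L > L₂,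
        |disparity G f (fun k => (1 - α) * p k + α * qbar L k) θ -
          disparity G f (fun k => (1 - α) * p k) θ| < δ) := by
  obtain ⟨M, hM⟩ := hG_bdd
  obtain ⟨C, hC⟩ := hG'_bdd
  have hM0 : 0 ≤ M := (abs_nonneg _).trans (hM 0 (by norm_num))
  have hC0 : 0 ≤ C := (abs_nonneg _).trans (hC 0 (by norm_num))
  have hfs : ∀ θ ∈ Θ, Summable (f θ) := fun θ hθ => by
    by_contra h
    have := (hf_pmf θ hθ).2
    rw [tsum_eq_zero_of_not_summable h] at this
    norm_num at this
  have hp : ∀ k, 0 ≤ (1 - α) * p k := fun k => mul_nonneg (by linarith) (hp_pmf.1 k)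
  have hq : ∀ L k, 0 ≤ α * qbar L k := fun L k => mul_nonneg hα0.le ((hqbar L).1 k)
  intro δ hδ
  have hK : 0 < 2 * M + C + 1 := by positivity
  have hε : 0 < δ / (2 * M + C + 1) := div_pos hδ hK
  have hlt : ∀ s : ℝ, 0 ≤ s → s < δ / (2 * M + C + 1) → (2 * M + C) * s < δ := by
    intro s hs h
    rw [lt_div_iff₀ hK] at h
    linarith
  refine ⟨?_, fun M₂ hM₂ => ?_⟩
  · obtain ⟨M₁, hM₁⟩ := hortho_family _ hε
    refine ⟨0, max M₁ 1, by positivity, fun θ hθ hθM L _ => ?_⟩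
    have hle := abs_disparity_add_sub_le (c := p) hG3 hM hC (hf_pmf θ hθ).1 (hfs θ hθ) (hq L) hp
      fun k => mul_le_of_le_one_left (hp_pmf.1 k) (by linarith)
    simp only [add_comm (α * _)] at hle
    exact hle.trans_lt (hlt _ (tsum_nonneg fun k => le_min (hp_pmf.1 k) ((hf_pmf θ hθ).1 k))
      (hM₁ θ hθ ((le_max_left _ _).trans_lt hθM)))
  · obtain ⟨L₂, hL₂⟩ := hortho_contam_family M₂ hM₂ _ hε
    refine ⟨L₂, fun θ hθ hθM L hL => ?_⟩
    have hle := abs_disparity_add_sub_le (c := qbar L) hG3 hM hC (hf_pmf θ hθ).1 (hfs θ hθ) hp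
      (hq L) fun k => mul_le_of_le_one_left ((hqbar L).1 k) hα1.le
    exact hle.trans_lt (hlt _
      (tsum_nonneg fun k => le_min ((hqbar L).1 k) ((hf_pmf θ hθ).1 k))
      (hL₂ L hL.le θ hθ hθM.le))
end
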